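/- arXiv:2411.15578 — 3 statements merged into one kernel-verified Lean document; each statement's English description precedes it below -/
import Mathlib

section
/- Every real λ ≠ log 2 belongs to the resolvent set of log 𝒞, the generator of the Hölder semigroup on L²(ℝ). Moreover, ‖R(λ, log 𝒞)‖ = 1/(λ − log 2) for every real λ > log 2, and lim_{λ→−∞} ‖R(λ, log 𝒞)‖ = 2/π. -/
open MeasureTheory Complex Filter

noncomputable section

/-- `L²(ℝ)` with complex values. -/
abbrev L2 : Type := MeasureTheory.Lp ℂ 2 (MeasureTheory.volume : MeasureTheory.Measure ℝ)

/-- `T` is the Hausdorff operator with kernel `K`: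
`(T f)(x) = ∫_ℝ K(u) f(ux) du`. -/
def IsHausdorffOp (K : ℝ → ℂ) (T : L2 →L[ℂ] L2) : Prop :=
  ∀ f : L2, ∀ᵐ x : ℝ ∂MeasureTheory.volume, T f x = ∫ u : ℝ, K u * f (u * x)

/-- The kernel `(1/Γ(α)) (log(1/u))^{α-1} χ_{(0,1)}(u)` of the Hölder operator `H_α`. -/
def holderKernel (α : ℂ) : ℝ → ℂ := fun u =>
  if u ∈ Set.Ioo (0:ℝ) 1 then (Complex.Gamma α)⁻¹ * ((Real.log u⁻¹ : ℝ) : ℂ) ^ (α - 1) else 0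

/-- The (generally unbounded, partially defined) operator `A` is the infinitesimal
generator of the one-parameter family `T` of bounded operators. -/
def IsGeneratorOf (T : ℝ → (L2 →L[ℂ] L2)) (A : L2 →ₗ.[ℂ] L2) : Prop :=
  ∀ f : L2,
    (f ∈ A.domain ↔ ∃ g : L2,
      Filter.Tendsto (fun t : ℝ => (t : ℂ)⁻¹ • (T t f - f))
        (nhdsWithin 0 (Set.Ioi 0)) (nhds g)) ∧
    ∀ hf : f ∈ A.domain,
      Filter.Tendsto (fun t : ℝ => (t : ℂ)⁻¹ • (T t f - f))
        (nhdsWithin 0 (Set.Ioi 0)) (nhds (A ⟨f, hf⟩))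

/-- `R` is the resolvent `(z I - A)⁻¹` of the partially defined operator `A`. -/
def IsResolventOf (A : L2 →ₗ.[ℂ] L2) (z : ℂ) (R : L2 →L[ℂ] L2) : Prop :=
  (∀ f : L2, ∃ hf : R f ∈ A.domain, z • (R f) - A ⟨R f, hf⟩ = f) ∧
  (∀ f : L2, ∀ hf : f ∈ A.domain, R (z • f - A ⟨f, hf⟩) = f)


lemma gk_integrable {t : ℝ} (ht : 0 < t) {c : ℝ} (hc : 0 < c) :
    IntegrableOn (fun r : ℝ => r ^ (t - 1) * Real.exp (-(c * r))) (Set.Ioi 0) := by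
  have h : (∫ r : ℝ in Set.Ioi 0, r ^ (t - 1) * Real.exp (-(c * r))) ≠ 0 := by
    rw [Real.integral_rpow_mul_exp_neg_mul_Ioi ht hc]
    have := Real.Gamma_pos_of_pos ht
    positivity
  exact not_imp_comm.1 integral_undef h

lemma gk_meas (t : ℝ) (z : ℂ) :
    Measurable (fun r : ℝ => (r : ℂ) ^ ((t : ℂ) - 1) * exp (-(z * r))) := by
  fun_prop

lemma gk_norm {t : ℝ} {z : ℂ} {r : ℝ} (hr : 0 < r) :
    ‖(r : ℂ) ^ ((t : ℂ) - 1) * exp (-(z * r))‖ = r ^ (t - 1) * Real.exp (-(z.re * r)) := by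
  rw [norm_mul, norm_cpow_eq_rpow_re_of_pos hr, norm_exp]
  simp

lemma gk_integrable' {t : ℝ} (ht : 0 < t) {z : ℂ} (hz : 0 < z.re) :
    IntegrableOn (fun r : ℝ => (r : ℂ) ^ ((t : ℂ) - 1) * exp (-(z * r))) (Set.Ioi 0) := by
  refine Integrable.mono' (gk_integrable ht hz) (gk_meas t z).aestronglyMeasurable ?_
  filter_upwards [ae_restrict_mem measurableSet_Ioi] with r hr
  rw [gk_norm hr]

lemma gk_hasDerivAt {t : ℝ} (ht : 0 < t) {z : ℂ} (hz : 0 < z.re) :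
    HasDerivAt (fun z : ℂ => ∫ r : ℝ in Set.Ioi 0, (r : ℂ) ^ ((t : ℂ) - 1) * exp (-(z * r)))
      (∫ r : ℝ in Set.Ioi 0, (r : ℂ) ^ ((t : ℂ) - 1) * (exp (-(z * r)) * (-r))) z := by
  have hz2 : 0 < z.re / 2 := by positivity
  refine (hasDerivAt_integral_of_dominated_loc_of_deriv_le
    (bound := fun r : ℝ => r ^ ((t+1) - 1) * Real.exp (-(z.re / 2 * r)))
    (F' := fun (z : ℂ) (r : ℝ) => (r : ℂ) ^ ((t : ℂ) - 1) * (exp (-(z * r)) * (-r)))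
    (s := Metric.ball z (z.re/2)) (Metric.ball_mem_nhds z hz2)
    (Eventually.of_forall fun w => (gk_meas t w).aestronglyMeasurable)
    (gk_integrable' ht hz) ?_ ?_ (gk_integrable (by linarith) hz2) ?_).2
  · exact Measurable.aestronglyMeasurable (by fun_prop)
  · filter_upwards [ae_restrict_mem measurableSet_Ioi] with r hr w hw
    have hr0 : (0:ℝ) < r := hr
    rw [← mul_assoc, norm_mul, gk_norm hr]
    have : z.re / 2 ≤ w.re := by
      have h1 : |(w - z).re| ≤ ‖w - z‖ := abs_re_le_norm _
      have h2 : ‖w - z‖ < z.re / 2 := by simpa [dist_eq_norm] using hw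
      have := abs_le.1 h1
      simp only [sub_re] at this
      linarith [this.1]
    have e : r ^ (t + 1 - 1) = r ^ (t-1) * r := by
      rw [← Real.rpow_add_one hr0.ne']; ring_nf
    rw [e]
    simp only [norm_neg, norm_real, Real.norm_eq_abs, abs_of_pos hr0]
    have : Real.exp (-(w.re * r)) ≤ Real.exp (-(z.re / 2 * r)) := by
      apply Real.exp_le_exp.2
      nlinarith
    have hp : 0 ≤ r ^ (t-1) * r := by positivity
    calc _ = (r ^ (t-1) * r) * Real.exp (-(w.re * r)) := by ring
      _ ≤ _ := by gcongr
  · filter_upwards with r w hw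
    refine HasDerivAt.const_mul _ ?_
    have : HasDerivAt (fun w : ℂ => -(w * r)) (-r) w := by
      simpa using ((hasDerivAt_id w).mul_const (r:ℂ)).fun_neg
    exact this.cexp

lemma gamma_int {t : ℝ} (ht : 0 < t) {z : ℂ} (hz : 0 < z.re) :
    ∫ r : ℝ in Set.Ioi 0, (r : ℂ) ^ ((t : ℂ) - 1) * exp (-(z * r))
      = (1 / z) ^ (t : ℂ) * Gamma t := by
  have hopen : IsOpen {z : ℂ | 0 < z.re} := isOpen_lt continuous_const continuous_re
  have hne : ∀ z : ℂ, 0 < z.re → z ≠ 0 := by rintro z h rfl; simp at h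
  have A1 : AnalyticOnNhd ℂ
      (fun z : ℂ => ∫ r : ℝ in Set.Ioi 0, (r : ℂ) ^ ((t : ℂ) - 1) * exp (-(z * r)))
      {z : ℂ | 0 < z.re} :=
    DifferentiableOn.analyticOnNhd
      (fun z hz => (gk_hasDerivAt ht hz).differentiableAt.differentiableWithinAt) hopen
  have A2 : AnalyticOnNhd ℂ (fun z : ℂ => (1 / z) ^ (t : ℂ) * Gamma t) {z : ℂ | 0 < z.re} := by
    refine DifferentiableOn.analyticOnNhd (fun z hz => ?_) hopen
    apply DifferentiableAt.differentiableWithinAt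
    refine DifferentiableAt.mul_const ?_ _
    refine DifferentiableAt.cpow_const ?_ ?_
    · exact (differentiableAt_const _).div differentiableAt_id (hne z hz)
    · left
      rw [one_div, inv_re]
      have := normSq_pos.2 (hne z hz)
      have hz' : 0 < z.re := hz
      positivity
  have hpre : IsPreconnected {z : ℂ | 0 < z.re} := (convex_halfSpace_re_gt 0).isPreconnected
  refine A1.eqOn_of_preconnected_of_frequently_eq A2 hpre (z₀ := 1) (by simp) ?_ hz
  have : Tendsto (fun n : ℕ => (((1:ℝ) + 1 / ((n:ℝ)+1) : ℝ) : ℂ)) atTop (nhdsWithin 1 {1}ᶜ) := by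
    rw [tendsto_nhdsWithin_iff]
    constructor
    · have h : Tendsto (fun n : ℕ => (1:ℝ) + 1 / ((n:ℝ)+1)) atTop (nhds (1+0)) :=
        tendsto_const_nhds.add tendsto_one_div_add_atTop_nhds_zero_nat
      have := (continuous_ofReal.tendsto _).comp h
      simpa [Function.comp_def] using this
    · refine Eventually.of_forall fun n => ?_
      simp only [Set.mem_compl_iff, Set.mem_singleton_iff]
      rw [← ofReal_one, ofReal_inj]
      have : 0 < 1 / ((n:ℝ)+1) := by positivity
      linarith
  refine this.frequently (Frequently.of_forall fun n => ?_)
  exact integral_cpow_mul_exp_neg_mul_Ioi (by simpa using ht) (by positivity)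

open scoped ENNReal

def sg (b : Bool) : ℝ := if b then 1 else -1

lemma sg_ne (b : Bool) : sg b ≠ 0 := by cases b <;> simp [sg]

lemma sg_abs (b : Bool) : |sg b| = 1 := by cases b <;> simp [sg]

lemma sg_meas (b : Bool) : Measurable (fun s : ℝ => sg b * Real.exp s) := by fun_prop

lemma image_sg (b : Bool) :
    (fun s : ℝ => sg b * Real.exp s) '' Set.univ = if b then Set.Ioi 0 else Set.Iio 0 := by
  ext x
  cases b
  · simp only [sg, Set.image_univ, Set.mem_range]
    constructor
    · rintro ⟨s, rfl⟩
      simp [Real.exp_pos]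
    · intro h
      have h : x < 0 := by simpa using h
      exact ⟨Real.log (-x), by rw [Real.exp_log (by linarith)]; simp⟩
  · simp only [sg, Set.image_univ, Set.mem_range]
    constructor
    · rintro ⟨s, rfl⟩
      simp [Real.exp_pos]
    · intro h
      have h : 0 < x := by simpa using h
      exact ⟨Real.log x, by rw [Real.exp_log h]; simp⟩

lemma lint_sg (b : Bool) (F : ℝ → ℝ≥0∞) :
    ∫⁻ s : ℝ, ENNReal.ofReal (Real.exp s) * F (sg b * Real.exp s)
      = ∫⁻ x in (if b then Set.Ioi 0 else Set.Iio 0), F x := by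
  rw [← image_sg b, lintegral_image_eq_lintegral_abs_deriv_mul (f' := fun s => sg b * Real.exp s)
    MeasurableSet.univ]
  · simp [abs_mul, sg_abs]
  · intro x _
    exact ((Real.hasDerivAt_exp x).const_mul _).hasDerivWithinAt
  · intro x _ y _ h
    have := mul_left_cancel₀ (sg_ne b) h
    exact Real.exp_injective this

lemma lint_pm (F : ℝ → ℝ≥0∞) :
    ∫⁻ x, F x = (∫⁻ s : ℝ, ENNReal.ofReal (Real.exp s) * F (sg true * Real.exp s))
      + ∫⁻ s : ℝ, ENNReal.ofReal (Real.exp s) * F (sg false * Real.exp s) := by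
  rw [lint_sg, lint_sg]
  simp only [if_true, Bool.false_eq_true, if_false]
  rw [← setLIntegral_congr (Iio_ae_eq_Iic (a := (0:ℝ))).symm]
  rw [add_comm, ← lintegral_add_compl F (measurableSet_Iic (a := (0:ℝ))), Set.compl_Iic]

lemma qmp_sg (b : Bool) :
    Measure.QuasiMeasurePreserving (fun s : ℝ => sg b * Real.exp s) volume volume := by
  refine ⟨sg_meas b, ?_⟩
  refine Measure.AbsolutelyContinuous.mk fun N hN h0 => ?_
  rw [Measure.map_apply (sg_meas b) hN]
  have h1 : ∫⁻ s : ℝ, ENNReal.ofReal (Real.exp s) * N.indicator 1 (sg b * Real.exp s) = 0 := by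
    rw [lint_sg]
    refine le_antisymm ((setLIntegral_le_lintegral _ _).trans ?_) bot_le
    rw [lintegral_indicator_one hN, h0]
  rw [lintegral_eq_zero_iff] at h1
  · rw [measure_eq_zero_iff_ae_notMem]
    filter_upwards [h1] with s hs hmem
    have hmem : sg b * Real.exp s ∈ N := hmem
    simp [Set.indicator_of_mem hmem] at hs
    exact absurd hs (not_le.2 (Real.exp_pos s))
  · have : Measurable (N.indicator (1 : ℝ → ℝ≥0∞)) := measurable_one.indicator hN
    exact (by fun_prop : Measurable fun s : ℝ => ENNReal.ofReal (Real.exp s)).mul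
      (this.comp (sg_meas b))

def n2 (f : ℝ → ℂ) : ℝ≥0∞ := ∫⁻ x, ‖f x‖ₑ ^ 2

lemma eLp_n2 (f : ℝ → ℂ) : eLpNorm f 2 volume ^ 2 = n2 f := by
  have := eLpNorm_nnreal_pow_eq_lintegral (f := f) (μ := (volume : Measure ℝ)) (p := 2) (by simp)
  simpa [n2] using this

lemma memLp_n2 {f : ℝ → ℂ} (hf : AEStronglyMeasurable f volume) :
    MemLp f 2 volume ↔ n2 f < ∞ := by
  rw [← eLp_n2, MemLp]
  simp [hf]

lemma norm_n2 (f : L2) : ENNReal.ofReal (‖f‖ ^ 2) = n2 f := by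
  rw [← eLp_n2, Lp.norm_def, ENNReal.ofReal_pow (by simp), ENNReal.ofReal_toReal]
  exact Lp.eLpNorm_ne_top f

lemma n2_lt (f : L2) : n2 f < ∞ := by rw [← norm_n2]; simp

lemma n2_congr {f g : ℝ → ℂ} (h : f =ᵐ[volume] g) : n2 f = n2 g :=
  lintegral_congr_ae (by filter_upwards [h] with x hx; rw [hx])

def vfun (b : Bool) (f : ℝ → ℂ) : ℝ → ℂ :=
  fun s => (Real.exp (s/2) : ℂ) * f (sg b * Real.exp s)

lemma vfun_enorm (b : Bool) (f : ℝ → ℂ) (s : ℝ) :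
    ‖vfun b f s‖ₑ ^ 2 = ENNReal.ofReal (Real.exp s) * ‖f (sg b * Real.exp s)‖ₑ ^ 2 := by
  rw [vfun, enorm_mul, mul_pow]
  congr 1
  rw [← ofReal_norm, norm_real, Real.norm_eq_abs, abs_of_pos (Real.exp_pos _),
    ← ENNReal.ofReal_pow (Real.exp_pos _).le, ← Real.exp_nat_mul]
  congr 2
  push_cast
  ring

lemma vfun_n2 (f : ℝ → ℂ) : n2 f = n2 (vfun true f) + n2 (vfun false f) := by
  simp only [n2, vfun_enorm]
  exact lint_pm (fun x => ‖f x‖ₑ ^ 2)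

lemma vfun_congr (b : Bool) {f g : ℝ → ℂ} (h : f =ᵐ[volume] g) :
    vfun b f =ᵐ[volume] vfun b g := by
  filter_upwards [(qmp_sg b).ae h] with s hs
  simp only [vfun]
  rw [hs]

lemma vfun_meas (b : Bool) (f : L2) : AEStronglyMeasurable (vfun b f) volume := by
  have h1 : Measurable f := (Lp.stronglyMeasurable f).measurable
  have : Measurable (vfun b f) := by
    unfold vfun
    exact (by fun_prop : Measurable fun s : ℝ => (Real.exp (s/2) : ℂ)).mul (h1.comp (sg_meas b))
  exact this.aestronglyMeasurable

lemma vfun_memLp (b : Bool) (f : L2) : MemLp (vfun b f) 2 volume := by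
  rw [memLp_n2 (vfun_meas b f)]
  have := n2_lt f
  rw [vfun_n2] at this
  cases b
  · exact lt_of_le_of_lt le_add_self this
  · exact lt_of_le_of_lt le_self_add this

def V (b : Bool) : L2 →ₗ[ℂ] L2 where
  toFun f := (vfun_memLp b f).toLp
  map_add' f g := by
    rw [← MemLp.toLp_add]
    apply MemLp.toLp_congr
    refine (vfun_congr b (Lp.coeFn_add f g)).trans ?_
    refine Eventually.of_forall fun s => ?_
    simp [vfun, mul_add]
  map_smul' c f := by
    simp only [RingHom.id_apply]
    rw [← MemLp.toLp_const_smul]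
    apply MemLp.toLp_congr
    refine (vfun_congr b (Lp.coeFn_smul c f)).trans ?_
    refine Eventually.of_forall fun s => ?_
    simp [vfun, mul_left_comm]

lemma V_coe (b : Bool) (f : L2) : V b f =ᵐ[volume] vfun b f := (vfun_memLp b f).coeFn_toLp

lemma V_norm (f : L2) : ‖f‖ ^ 2 = ‖V true f‖ ^ 2 + ‖V false f‖ ^ 2 := by
  have := vfun_n2 f
  rw [← n2_congr (V_coe true f), ← n2_congr (V_coe false f), ← norm_n2, ← norm_n2, ← norm_n2,
    ← ENNReal.ofReal_add (by positivity) (by positivity),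
    ENNReal.ofReal_eq_ofReal_iff (by positivity) (by positivity)] at this
  exact this

lemma V_surj (p q : L2) : ∃ f : L2, V true f = p ∧ V false f = q := by
  let F : ℝ → ℂ := fun x => (Real.exp (-(Real.log x) / 2) : ℂ) *
    if 0 < x then p (Real.log x) else q (Real.log x)
  have hp : Measurable p := (Lp.stronglyMeasurable p).measurable
  have hq : Measurable q := (Lp.stronglyMeasurable q).measurable
  have hF : Measurable F := by
    refine Measurable.mul (by fun_prop) ?_
    exact Measurable.ite measurableSet_Ioi (hp.comp Real.measurable_log)
      (hq.comp Real.measurable_log)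
  have key : ∀ s : ℝ, (Real.exp (s/2) : ℂ) * (Real.exp (-s/2) : ℂ) = 1 := by
    intro s
    rw [← ofReal_mul, ← Real.exp_add]
    ring_nf
    simp
  have e1 : vfun true F = p := by
    ext s
    simp only [vfun, sg, F, if_true, one_mul, Real.exp_pos, Real.log_exp]
    rw [← mul_assoc, key, one_mul]
  have e2 : vfun false F = q := by
    ext s
    have : ¬ (0 < -Real.exp s) := by linarith [Real.exp_pos s]
    simp only [vfun, sg, F, Bool.false_eq_true, if_false, neg_mul, one_mul, Real.log_neg_eq_log,
      this, Real.log_exp]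
    rw [← mul_assoc, key, one_mul]
  have hm : MemLp F 2 volume := by
    rw [memLp_n2 hF.aestronglyMeasurable, vfun_n2, e1, e2]
    exact ENNReal.add_lt_top.2 ⟨n2_lt p, n2_lt q⟩
  refine ⟨hm.toLp, ?_, ?_⟩
  · apply Lp.ext
    refine (V_coe _ _).trans ((vfun_congr _ hm.coeFn_toLp).trans ?_)
    rw [e1]
  · apply Lp.ext
    refine (V_coe _ _).trans ((vfun_congr _ hm.coeFn_toLp).trans ?_)
    rw [e2]

open scoped FourierTransform SchwartzMap ComplexConjugate

lemma inner_schwartz (φ : 𝓢(ℝ, ℂ)) (g : L2) :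
    inner ℂ (φ.toLp 2 : L2) g = ∫ s, conj (φ s) * g s := by
  rw [L2.inner_def]
  apply integral_congr_ae
  filter_upwards [φ.coeFn_toLp 2 volume] with s hs
  rw [hs, RCLike.inner_apply, mul_comm]

lemma fourier_shift (φ : 𝓢(ℝ, ℂ)) (r ξ : ℝ) :
    𝓕 (φ.compSubConstCLM ℂ (-r)) ξ = exp (2 * Real.pi * r * ξ * I) * 𝓕 φ ξ := by
  rw [SchwartzMap.fourier_coe, SchwartzMap.fourier_coe, Real.fourier_real_eq_integral_exp_smul,
    Real.fourier_real_eq_integral_exp_smul]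
  simp only [SchwartzMap.compSubConstCLM_apply, smul_eq_mul, sub_neg_eq_add]
  rw [← integral_const_mul, ← integral_sub_right_eq_self _ r]
  congr 1
  ext v
  rw [sub_add_cancel, ← mul_assoc, ← exp_add]
  congr 2
  push_cast
  ring

lemma inner_shift (φ : 𝓢(ℝ, ℂ)) (g : L2) (r : ℝ) :
    ∫ s, conj (φ s) * g (s - r)
      = ∫ ξ : ℝ, exp (-(2 * Real.pi * r * ξ * I)) * (conj (𝓕 φ ξ) * (𝓕 g : L2) ξ) := by
  rw [← integral_add_right_eq_self _ r]
  have h1 := inner_schwartz (φ.compSubConstCLM ℂ (-r)) g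
  simp only [SchwartzMap.compSubConstCLM_apply, sub_neg_eq_add] at h1
  simp only [add_sub_cancel_right]
  rw [← h1, ← Lp.inner_fourier_eq, SchwartzMap.toLp_fourier_eq, inner_schwartz]
  congr 1
  ext ξ
  rw [fourier_shift, map_mul, ← exp_conj]
  have h2 : conj (2:ℂ) = 2 := Complex.conj_ofNat 2
  simp [h2]
  ring

lemma conv_integrable {κ : ℝ → ℂ} (hκ : Integrable κ) (φ : 𝓢(ℝ, ℂ)) (g : L2) :
    Integrable (fun p : ℝ × ℝ => conj (φ p.1) * (κ p.2 * g (p.1 - p.2)))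
      (volume.prod volume) := by
  have hg : Integrable (fun s => ‖g s‖ ^ 2) := (Lp.memLp g).integrable_norm_pow (by simp)
  have hφ : Integrable (fun s => ‖φ s‖ ^ 2) := (φ.memLp 2 volume).integrable_norm_pow (by simp)
  have h1 : Integrable (fun p : ℝ × ℝ => ‖κ p.2‖ * ‖g (p.1 - p.2)‖ ^ 2) (volume.prod volume) :=
    hκ.norm.convolution_integrand (ContinuousLinearMap.mul ℝ ℝ) hg
  have h2 : Integrable (fun p : ℝ × ℝ => ‖φ p.1‖ ^ 2 * ‖κ p.2‖) (volume.prod volume) :=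
    hφ.mul_prod hκ.norm
  refine Integrable.mono' (h1.add h2) ?_ ?_
  · have hm : AEStronglyMeasurable (fun p : ℝ × ℝ => κ p.2 * g (p.1 - p.2))
        (volume.prod volume) :=
      hκ.aestronglyMeasurable.convolution_integrand (ContinuousLinearMap.mul ℂ ℂ)
        (Lp.aestronglyMeasurable g)
    refine AEStronglyMeasurable.mul ?_ hm
    have : Continuous (fun p : ℝ × ℝ => conj (φ p.1)) := by fun_prop
    exact this.aestronglyMeasurable
  · refine Eventually.of_forall fun p => ?_
    simp only [Pi.add_apply, norm_mul, RCLike.norm_conj]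
    nlinarith [sq_nonneg (‖φ p.1‖ - ‖g (p.1 - p.2)‖), norm_nonneg (κ p.2), norm_nonneg (φ p.1),
      norm_nonneg (g (p.1-p.2)), mul_nonneg (norm_nonneg (κ p.2)) (sq_nonneg (‖φ p.1‖ - ‖g (p.1 - p.2)‖)), mul_nonneg (norm_nonneg (κ p.2)) (mul_nonneg (norm_nonneg (φ p.1)) (norm_nonneg (g (p.1 - p.2))))]

lemma four_integrable {κ : ℝ → ℂ} (hκ : Integrable κ) (φ : 𝓢(ℝ, ℂ)) (g : L2) :
    Integrable (fun p : ℝ × ℝ => κ p.1 *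
      (exp (-(2 * Real.pi * p.1 * p.2 * I)) * (conj (φ p.2) * g p.2)))
      (volume.prod volume) := by
  have h0 : Integrable (fun ξ => conj (φ ξ) * g ξ) := by
    have h : Integrable (fun ξ => g ξ * conj (φ ξ)) :=
      (Lp.memLp g).integrable_mul ((φ.memLp 2 volume).star)
    simpa [mul_comm] using h
  have h1 := hκ.mul_prod h0
  refine Integrable.mono' h1.norm ?_ ?_
  · have : Continuous (fun p : ℝ × ℝ => exp (-(2 * Real.pi * p.1 * p.2 * I))) := by fun_prop
    refine (this.aestronglyMeasurable.mul h1.aestronglyMeasurable).congr ?_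
    refine Eventually.of_forall fun p => ?_
    simp only [Pi.mul_apply]
    ring
  · refine Eventually.of_forall fun p => ?_
    simp only [norm_mul]
    have : ‖exp (-(2 * Real.pi * p.1 * p.2 * I))‖ = 1 := by
      rw [norm_exp]; simp
    rw [this, one_mul]

lemma conv_fourier {κ : ℝ → ℂ} (hκ : Integrable κ) (g h q : L2)
    (hh : h =ᵐ[volume] fun s => ∫ r, κ r * g (s - r))
    (hq : q =ᵐ[volume] fun ξ => (∫ r : ℝ, κ r * exp (-(2 * Real.pi * r * ξ * I))) * (𝓕 g : L2) ξ) :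
    𝓕 h = q := by
  have hd : DenseRange (SchwartzMap.toLpCLM ℝ ℂ 2 (volume : Measure ℝ)) :=
    SchwartzMap.denseRange_toLpCLM ENNReal.ofNat_ne_top
  suffices H : h = 𝓕⁻ q by rw [H]; exact FourierTransform.fourier_fourierInv_eq q
  refine hd.eq_of_inner_right ℂ ?_
  intro φ
  change inner ℂ (φ.toLp 2 : L2) h = inner ℂ (φ.toLp 2 : L2) (𝓕⁻ q)
  have e2 : inner ℂ (φ.toLp 2 : L2) (𝓕⁻ q) = inner ℂ ((𝓕 φ).toLp 2 : L2) q := by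
    rw [← Lp.inner_fourier_eq, FourierTransform.fourier_fourierInv_eq q, SchwartzMap.toLp_fourier_eq]
  rw [e2, inner_schwartz, inner_schwartz]
  calc ∫ s, conj (φ s) * h s
      = ∫ s, ∫ r, conj (φ s) * (κ r * g (s - r)) := by
        apply integral_congr_ae
        filter_upwards [hh] with s hs
        rw [hs, integral_const_mul]
    _ = ∫ r, ∫ s, conj (φ s) * (κ r * g (s - r)) :=
        integral_integral_swap (conv_integrable hκ φ g)
    _ = ∫ r : ℝ, ∫ ξ : ℝ, κ r * (exp (-(2 * Real.pi * r * ξ * I)) * (conj (𝓕 φ ξ) * (𝓕 g : L2) ξ)) := by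
        congr 1
        ext r
        rw [integral_const_mul, ← inner_shift, ← integral_const_mul]
        congr 1
        ext s
        ring
    _ = ∫ ξ : ℝ, ∫ r : ℝ, κ r * (exp (-(2 * Real.pi * r * ξ * I)) * (conj (𝓕 φ ξ) * (𝓕 g : L2) ξ)) :=
        integral_integral_swap (four_integrable hκ (𝓕 φ) (𝓕 g))
    _ = ∫ ξ, conj (𝓕 φ ξ) * q ξ := by
        apply integral_congr_ae
        filter_upwards [hq] with ξ hξ
        rw [hξ, mul_left_comm, ← integral_mul_const]
        congr 1
        ext r
        ring

def ell (ξ : ℝ) : ℂ := log (1 / (1/2 + 2 * Real.pi * ξ * I))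

lemma zz_re (ξ : ℝ) : (1/2 + 2 * Real.pi * ξ * I : ℂ).re = 1/2 := by
  simp

lemma zz_im (ξ : ℝ) : (1/2 + 2 * Real.pi * ξ * I : ℂ).im = 2 * Real.pi * ξ := by
  simp

lemma zz_ne (ξ : ℝ) : (1/2 + 2 * Real.pi * ξ * I : ℂ) ≠ 0 := by
  intro h
  have := zz_re ξ
  rw [h] at this
  norm_num at this

lemma zzinv_re (ξ : ℝ) : 0 < (1 / (1/2 + 2 * Real.pi * ξ * I) : ℂ).re := by
  rw [one_div, inv_re, zz_re]
  have := normSq_pos.2 (zz_ne ξ)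
  positivity

lemma ell_cont : Continuous ell := by
  unfold ell
  rw [continuous_iff_continuousAt]
  intro ξ
  refine ContinuousAt.clog ?_ (Or.inl (zzinv_re ξ))
  refine ContinuousAt.div continuousAt_const ?_ (zz_ne ξ)
  fun_prop

lemma ell_re (ξ : ℝ) : (ell ξ).re = - Real.log ‖(1/2 + 2 * Real.pi * ξ * I : ℂ)‖ := by
  rw [ell, log_re, one_div, norm_inv, Real.log_inv]

lemma zz_norm (ξ : ℝ) : 1/2 ≤ ‖(1/2 + 2 * Real.pi * ξ * I : ℂ)‖ := by
  have := abs_re_le_norm (1/2 + 2 * Real.pi * ξ * I : ℂ)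
  rw [zz_re] at this
  exact (le_abs_self _).trans this

lemma ell_re_le (ξ : ℝ) : (ell ξ).re ≤ Real.log 2 := by
  rw [ell_re]
  have := Real.log_le_log (by norm_num) (zz_norm ξ)
  rw [one_div, Real.log_inv] at this
  linarith

def kap (t : ℝ) : ℝ → ℂ := (Set.Ioi (0:ℝ)).indicator
  (fun r => (Gamma t)⁻¹ * ((r:ℂ) ^ ((t:ℂ) - 1) * exp (-((1/2) * r))))

lemma kap_integrable {t : ℝ} (ht : 0 < t) : Integrable (kap t) := by
  unfold kap
  rw [integrable_indicator_iff measurableSet_Ioi]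
  exact (gk_integrable' ht (z := 1/2) (by norm_num)).const_mul _

lemma kap_fourier {t : ℝ} (ht : 0 < t) (ξ : ℝ) :
    ∫ r : ℝ, kap t r * exp (-(2 * Real.pi * r * ξ * I)) = exp (t * ell ξ) := by
  have hG : Gamma (t:ℂ) ≠ 0 := Gamma_ne_zero_of_re_pos (by simpa using ht)
  have h := gamma_int ht (z := 1/2 + 2 * Real.pi * ξ * I) (by rw [zz_re]; norm_num)
  have e : ∀ r : ℝ, kap t r * exp (-(2 * Real.pi * r * ξ * I)) =
      (Set.Ioi (0:ℝ)).indicator (fun r : ℝ => (Gamma t)⁻¹ * ((r:ℂ) ^ ((t:ℂ) - 1) *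
        exp (-((1/2 + 2 * Real.pi * ξ * I) * r)))) r := by
    intro r
    by_cases hr : r ∈ Set.Ioi (0:ℝ)
    · rw [kap, Set.indicator_of_mem hr, Set.indicator_of_mem hr, mul_assoc, mul_assoc, ← exp_add]
      congr 3
      ring_nf
    · rw [kap, Set.indicator_of_notMem hr, Set.indicator_of_notMem hr, zero_mul]
  simp_rw [e]
  rw [integral_indicator measurableSet_Ioi, integral_const_mul, h, mul_comm, mul_assoc,
    mul_inv_cancel₀ hG, mul_one, cpow_def_of_ne_zero (one_div_ne_zero (zz_ne ξ)), ell, mul_comm]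

lemma image_exp_neg : (fun r : ℝ => Real.exp (-r)) '' Set.Ioi 0 = Set.Ioo 0 1 := by
  ext u
  constructor
  · rintro ⟨r, hr, rfl⟩
    have hr : 0 < r := hr
    exact ⟨Real.exp_pos _, by rw [Real.exp_lt_one_iff]; linarith⟩
  · rintro ⟨h0, h1⟩
    refine ⟨-Real.log u, ?_, ?_⟩
    · have := Real.log_neg h0 h1
      simpa using this
    · simp [Real.exp_log h0]

lemma holder_change (t : ℝ) (b : Bool) (f : ℝ → ℂ) (s : ℝ) :
    (Real.exp (s/2) : ℂ) * ∫ u : ℝ, holderKernel t u * f (u * (sg b * Real.exp s))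
      = ∫ r : ℝ, kap t r * vfun b f (s - r) := by
  have e1 : ∀ u : ℝ, holderKernel t u * f (u * (sg b * Real.exp s)) =
      (Set.Ioo (0:ℝ) 1).indicator (fun u : ℝ =>
        ((Gamma t)⁻¹ * ((Real.log u⁻¹ : ℝ) : ℂ) ^ ((t:ℂ) - 1))
          * f (u * (sg b * Real.exp s))) u := by
    intro u
    by_cases hu : u ∈ Set.Ioo (0:ℝ) 1
    · rw [Set.indicator_of_mem hu, holderKernel, if_pos hu]
    · rw [Set.indicator_of_notMem hu, holderKernel, if_neg hu, zero_mul]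
  simp_rw [e1]
  rw [integral_indicator measurableSet_Ioo, ← image_exp_neg,
    integral_image_eq_integral_abs_deriv_smul (f' := fun r => -Real.exp (-r)) measurableSet_Ioi,
    ← integral_const_mul]
  · rw [← integral_indicator measurableSet_Ioi]
    congr 1
    ext r
    by_cases hr : r ∈ Set.Ioi (0:ℝ)
    · rw [kap, Set.indicator_of_mem hr, Set.indicator_of_mem hr, vfun, ← Real.exp_neg, neg_neg,
        Real.log_exp, abs_neg, abs_of_pos (Real.exp_pos _), real_smul]
      have a1 : Real.exp (-r) * (sg b * Real.exp s) = sg b * Real.exp (s - r) := by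
        rw [sub_eq_add_neg, Real.exp_add]; ring
      rw [a1]
      have a2 : (Real.exp (s/2) : ℂ) * (Real.exp (-r) : ℂ) =
          exp (-(1/2 * r)) * (Real.exp ((s-r)/2) : ℂ) := by
        push_cast
        rw [← exp_add, ← exp_add]
        congr 1
        ring
      linear_combination ((Gamma t)⁻¹ * (r:ℂ) ^ ((t:ℂ) - 1)) * f (sg b * Real.exp (s - r)) * a2
    · rw [kap, Set.indicator_of_notMem hr, Set.indicator_of_notMem hr, zero_mul]
  · intro x _
    have := (Real.hasDerivAt_exp (-x)).comp x (hasDerivAt_neg x)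
    simpa [Function.comp_def] using this.hasDerivWithinAt
  · intro x _ y _ h
    have := Real.exp_injective h
    linarith

lemma V_holder {t : ℝ} {T : L2 →L[ℂ] L2} (hT : IsHausdorffOp (holderKernel t) T)
    (b : Bool) (f : L2) :
    V b (T f) =ᵐ[volume] fun s => ∫ r : ℝ, kap t r * (V b f) (s - r) := by
  filter_upwards [V_coe b (T f), (qmp_sg b).ae (hT f)] with s h1 h2
  rw [h1, vfun, h2, holder_change]
  apply integral_congr_ae
  have hq : Measure.QuasiMeasurePreserving (fun r : ℝ => s - r) volume volume :=
    (Measure.measurePreserving_sub_left volume s).quasiMeasurePreserving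
  filter_upwards [hq.ae (V_coe b f)] with r hr
  rw [hr]

lemma mul_memLp {m : ℝ → ℂ} (hm : Measurable m) {C : ℝ} (hC : ∀ ξ, ‖m ξ‖ ≤ C) (g : L2) :
    MemLp (fun ξ => m ξ * g ξ) 2 volume := by
  refine MemLp.of_le_mul (c := C) (Lp.memLp g)
    (hm.aestronglyMeasurable.mul (Lp.aestronglyMeasurable g)) ?_
  refine Eventually.of_forall fun ξ => ?_
  rw [norm_mul]
  exact mul_le_mul_of_nonneg_right (hC ξ) (norm_nonneg _)

def U (b : Bool) : L2 →ₗ[ℂ] L2 :=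
  (Lp.fourierTransformₗᵢ ℝ ℂ).toLinearEquiv.toLinearMap ∘ₗ V b

lemma U_apply (b : Bool) (f : L2) : U b f = 𝓕 (V b f) := rfl

lemma U_norm (f : L2) : ‖f‖ ^ 2 = ‖U true f‖ ^ 2 + ‖U false f‖ ^ 2 := by
  rw [U_apply, U_apply, Lp.norm_fourier_eq, Lp.norm_fourier_eq, V_norm]

lemma U_surj (p q : L2) : ∃ f : L2, U true f = p ∧ U false f = q := by
  obtain ⟨f, h1, h2⟩ := V_surj (𝓕⁻ p) (𝓕⁻ q)
  refine ⟨f, ?_, ?_⟩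
  · rw [U_apply, h1]; exact FourierTransform.fourier_fourierInv_eq p
  · rw [U_apply, h2]; exact FourierTransform.fourier_fourierInv_eq q

lemma exp_ell_bound {t : ℝ} (ht : 0 < t) (ξ : ℝ) : ‖exp (t * ell ξ)‖ ≤ Real.exp (t * Real.log 2) := by
  rw [norm_exp]
  apply Real.exp_le_exp.2
  rw [re_ofReal_mul]
  exact mul_le_mul_of_nonneg_left (ell_re_le ξ) ht.le

lemma U_holder {t : ℝ} (ht : 0 < t) {T : L2 →L[ℂ] L2} (hT : IsHausdorffOp (holderKernel t) T)
    (b : Bool) (f : L2) :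
    U b (T f) =ᵐ[volume] fun ξ => exp (t * ell ξ) * (U b f) ξ := by
  have hc := ell_cont
  have hm : Measurable (fun ξ => exp (t * ell ξ)) :=
    (by fun_prop : Continuous (fun ξ => exp (t * ell ξ))).measurable
  have hM := mul_memLp hm (exp_ell_bound ht) (U b f)
  have : U b (T f) = hM.toLp := by
    rw [U_apply]
    refine conv_fourier (kap_integrable ht) (V b f) _ _ (V_holder hT b f) ?_
    simp_rw [kap_fourier ht]
    exact hM.coeFn_toLp
  rw [this]
  exact hM.coeFn_toLp

lemma U_le (b : Bool) (f : L2) : ‖U b f‖ ≤ ‖f‖ := by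
  have h := U_norm f
  have h1 := sq_nonneg ‖U true f‖
  have h2 := sq_nonneg ‖U false f‖
  refine abs_le_of_sq_le_sq' ?_ (norm_nonneg f) |>.2
  cases b <;> linarith

lemma U_inj {f g : L2} (h : ∀ b, U b f = U b g) : f = g := by
  have := U_norm (f - g)
  rw [map_sub, map_sub, h true, h false] at this
  simpa [sub_eq_zero] using this

lemma U_cont (b : Bool) : Continuous (U b) :=
  AddMonoidHomClass.continuous_of_bound (U b) 1 (fun f => by simpa using U_le b f)

lemma exp_sub_one_le {w : ℂ} (hw : w.re ≤ Real.log 2) : ‖exp w - 1‖ ≤ 2 * ‖w‖ := by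
  have hconv : Convex ℝ {w : ℂ | w.re ≤ Real.log 2} := convex_halfSpace_re_le _
  have := hconv.norm_image_sub_le_of_norm_deriv_le (f := exp) (C := 2) (x := 0) (y := w)
    (fun x _ => differentiable_exp x) (fun x hx => ?_) ?_ hw
  · simpa using this
  · rw [Complex.deriv_exp, norm_exp]
    calc Real.exp x.re ≤ Real.exp (Real.log 2) := Real.exp_le_exp.2 hx
      _ = 2 := Real.exp_log (by norm_num)
  · simpa using Real.log_nonneg (by norm_num)

lemma quot_tendsto (z : ℂ) :
    Tendsto (fun t : ℝ => (t : ℂ)⁻¹ * (exp (t * z) - 1)) (nhdsWithin 0 (Set.Ioi 0)) (nhds z) := by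
  have h : HasDerivAt (fun t : ℝ => exp (t * z)) z 0 := by
    have h1 : HasDerivAt (fun t : ℝ => (t : ℂ) * z) z 0 := by
      simpa using (Complex.ofRealCLM.hasDerivAt (x := (0:ℝ))).mul_const z
    simpa using h1.cexp
  have h2 := h.tendsto_slope_zero_right
  simpa using h2

lemma U_quot {t : ℝ} (ht : 0 < t) {T : L2 →L[ℂ] L2} (hT : IsHausdorffOp (holderKernel t) T)
    (b : Bool) (f : L2) :
    U b ((t : ℂ)⁻¹ • (T f - f)) =ᵐ[volume]
      fun ξ => (t : ℂ)⁻¹ * (exp (t * ell ξ) - 1) * (U b f) ξ := by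
  rw [map_smul, map_sub]
  filter_upwards [Lp.coeFn_smul (t:ℂ)⁻¹ (U b (T f) - U b f), Lp.coeFn_sub (U b (T f)) (U b f),
    U_holder ht hT b f] with ξ h1 h2 h3
  rw [h1, Pi.smul_apply, h2, Pi.sub_apply, h3, smul_eq_mul]
  ring

lemma gen_val {H : ℂ → (L2 →L[ℂ] L2)}
    (hH : ∀ α : ℂ, 0 < α.re → IsHausdorffOp (holderKernel α) (H α)) {f g : L2}
    (h : Tendsto (fun t : ℝ => (t : ℂ)⁻¹ • (H t f - f)) (nhdsWithin 0 (Set.Ioi 0)) (nhds g))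
    (b : Bool) : U b g =ᵐ[volume] fun ξ => ell ξ * (U b f) ξ := by
  let τ : ℕ → ℝ := fun n => 1 / ((n:ℝ) + 1)
  have hτ0 : ∀ n, 0 < τ n := fun n => by positivity
  have hτ : Tendsto τ atTop (nhdsWithin 0 (Set.Ioi 0)) :=
    tendsto_nhdsWithin_iff.2 ⟨tendsto_one_div_add_atTop_nhds_zero_nat,
      Eventually.of_forall hτ0⟩
  have h1 : Tendsto (fun n => U b ((τ n : ℂ)⁻¹ • (H (τ n) f - f))) atTop (nhds (U b g)) :=
    ((U_cont b).tendsto g).comp (h.comp hτ)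
  obtain ⟨ns, hns, hae⟩ := (tendstoInMeasure_of_tendsto_Lp h1).exists_seq_tendsto_ae
  have h2 : ∀ᵐ ξ : ℝ, ∀ n, U b ((τ n : ℂ)⁻¹ • (H (τ n) f - f)) ξ =
      (τ n : ℂ)⁻¹ * (exp (τ n * ell ξ) - 1) * (U b f) ξ :=
    ae_all_iff.2 fun n => U_quot (hτ0 n) (hH _ (by simpa using hτ0 n)) b f
  filter_upwards [hae, h2] with ξ e1 e2
  simp_rw [e2] at e1
  have e3 := (((quot_tendsto (ell ξ)).comp (hτ.comp hns.tendsto_atTop)).mul_const ((U b f) ξ))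
  exact tendsto_nhds_unique e1 e3

lemma n2_tendsto {H : ℂ → (L2 →L[ℂ] L2)}
    (hH : ∀ α : ℂ, 0 < α.re → IsHausdorffOp (holderKernel α) (H α)) {f g : L2}
    (b : Bool) (hg : U b g =ᵐ[volume] fun ξ => ell ξ * (U b f) ξ) :
    Tendsto (fun t : ℝ => n2 (U b ((t : ℂ)⁻¹ • (H t f - f) - g))) (nhdsWithin 0 (Set.Ioi 0))
      (nhds 0) := by
  have hcong : ∀ t : ℝ, 0 < t → U b ((t : ℂ)⁻¹ • (H t f - f) - g) =ᵐ[volume]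
      fun ξ => ((t : ℂ)⁻¹ * (exp (t * ell ξ) - 1) - ell ξ) * (U b f) ξ := by
    intro t ht
    rw [map_sub]
    filter_upwards [Lp.coeFn_sub (U b ((t : ℂ)⁻¹ • (H t f - f))) (U b g), hg,
      U_quot ht (hH t (by simpa using ht)) b f] with ξ h1 h2 h3
    rw [h1, Pi.sub_apply, h2, h3]
    ring
  have hE : ∀ᶠ t : ℝ in nhdsWithin 0 (Set.Ioi 0),
      n2 (fun ξ => ((t : ℂ)⁻¹ * (exp (t * ell ξ) - 1) - ell ξ) * (U b f) ξ) =
        n2 (U b ((t : ℂ)⁻¹ • (H t f - f) - g)) := by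
    filter_upwards [self_mem_nhdsWithin] with t ht
    exact (n2_congr (hcong t ht)).symm
  refine Tendsto.congr' hE ?_
  have h0 : (0:ℝ≥0∞) = ∫⁻ ξ : ℝ, 0 := by simp
  rw [h0]
  unfold n2
  refine tendsto_lintegral_filter_of_dominated_convergence (fun ξ => 9 * ‖(U b g) ξ‖ₑ ^ 2)
    ?_ ?_ ?_ ?_
  · refine Eventually.of_forall fun t => ?_
    have hc := ell_cont
    have hm : Measurable (fun ξ => ((t : ℂ)⁻¹ * (exp (t * ell ξ) - 1) - ell ξ)) :=
      (by fun_prop : Continuous (fun ξ => ((t : ℂ)⁻¹ * (exp (t * ell ξ) - 1) - ell ξ))).measurable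
    exact ((hm.mul (Lp.stronglyMeasurable _).measurable).enorm).pow_const 2
  · have : ∀ᶠ t : ℝ in nhdsWithin 0 (Set.Ioi 0), t ∈ Set.Ioo (0:ℝ) 1 :=
      Ioo_mem_nhdsGT one_pos
    filter_upwards [this] with t ht
    filter_upwards [hg] with ξ h2
    rw [h2, enorm_mul, enorm_mul, mul_pow, mul_pow, ← mul_assoc]
    refine mul_le_mul_left ?_ _
    have ht0 := ht.1
    have hb : ‖(t : ℂ)⁻¹ * (exp (t * ell ξ) - 1) - ell ξ‖ ≤ 3 * ‖ell ξ‖ := by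
      refine (norm_sub_le _ _).trans ?_
      have : ‖exp (t * ell ξ) - 1‖ ≤ 2 * ‖(t:ℂ) * ell ξ‖ := by
        apply exp_sub_one_le
        rw [re_ofReal_mul]
        have h3 := ell_re_le ξ
        have h4 : 0 ≤ Real.log 2 := Real.log_nonneg (by norm_num)
        nlinarith [ht.1, ht.2]
      rw [norm_mul, norm_real, Real.norm_eq_abs, abs_of_pos ht0] at this
      rw [norm_mul, norm_inv, norm_real, Real.norm_eq_abs, abs_of_pos ht0]
      have h5 : t⁻¹ * ‖exp (t * ell ξ) - 1‖ ≤ 2 * ‖ell ξ‖ := by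
        rw [inv_mul_le_iff₀ ht0]; linarith
      linarith
    have hb2 : ‖(t : ℂ)⁻¹ * (exp (t * ell ξ) - 1) - ell ξ‖ₑ ≤ 3 * ‖ell ξ‖ₑ := by
      rw [← ofReal_norm, ← ofReal_norm]
      calc _ ≤ ENNReal.ofReal (3 * ‖ell ξ‖) := ENNReal.ofReal_le_ofReal hb
        _ = _ := by rw [ENNReal.ofReal_mul (by norm_num)]; simp
    calc _ ≤ (3 * ‖ell ξ‖ₑ) ^ 2 := by gcongr
      _ = _ := by rw [mul_pow]; norm_num
  · rw [lintegral_const_mul' _ _ (by simp)]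
    exact ENNReal.mul_ne_top (by simp) (n2_lt (U b g)).ne
  · refine Eventually.of_forall fun ξ => ?_
    have h1 : Tendsto (fun t : ℝ => ((t : ℂ)⁻¹ * (exp (t * ell ξ) - 1) - ell ξ) * (U b f) ξ)
        (nhdsWithin 0 (Set.Ioi 0)) (nhds ((ell ξ - ell ξ) * (U b f) ξ)) :=
      ((quot_tendsto (ell ξ)).sub_const _).mul_const _
    have h2 := (ENNReal.continuous_pow 2).tendsto _ |>.comp h1.enorm
    simpa [Function.comp_def] using h2

lemma gen_mem {H : ℂ → (L2 →L[ℂ] L2)}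
    (hH : ∀ α : ℂ, 0 < α.re → IsHausdorffOp (holderKernel α) (H α)) {f g : L2}
    (hg : ∀ b, U b g =ᵐ[volume] fun ξ => ell ξ * (U b f) ξ) :
    Tendsto (fun t : ℝ => (t : ℂ)⁻¹ • (H t f - f)) (nhdsWithin 0 (Set.Ioi 0)) (nhds g) := by
  have h := (n2_tendsto hH true (hg true)).add (n2_tendsto hH false (hg false))
  simp_rw [← norm_n2, ← ENNReal.ofReal_add (sq_nonneg ‖_‖) (sq_nonneg ‖_‖), ← U_norm] at h
  have h2 := (ENNReal.tendsto_toReal (by simp)).comp h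
  simp only [Function.comp_def, ENNReal.toReal_ofReal (sq_nonneg ‖_‖)] at h2
  rw [tendsto_iff_norm_sub_tendsto_zero]
  have h3 := h2.sqrt
  simpa [Real.sqrt_sq (norm_nonneg _)] using h3

lemma res_meas (lam : ℝ) : Measurable (fun ξ => ((lam : ℂ) - ell ξ)⁻¹) := by
  have hc := ell_cont.measurable
  fun_prop

def Mop (m : ℝ → ℂ) (hm : Measurable m) (C : ℝ) (hC : ∀ ξ, ‖m ξ‖ ≤ C) : L2 →ₗ[ℂ] L2 where
  toFun g := (mul_memLp hm hC g).toLp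
  map_add' f g := by
    rw [← MemLp.toLp_add]
    apply MemLp.toLp_congr
    filter_upwards [Lp.coeFn_add f g] with ξ h
    change m ξ * (f + g : L2) ξ = m ξ * f ξ + m ξ * g ξ
    rw [h, Pi.add_apply, mul_add]
  map_smul' c f := by
    simp only [RingHom.id_apply]
    rw [← MemLp.toLp_const_smul]
    apply MemLp.toLp_congr
    filter_upwards [Lp.coeFn_smul c f] with ξ h
    change m ξ * (c • f : L2) ξ = c * (m ξ * f ξ)
    rw [h, Pi.smul_apply, smul_eq_mul, mul_left_comm]

lemma Mop_coe (m : ℝ → ℂ) (hm : Measurable m) (C : ℝ) (hC : ∀ ξ, ‖m ξ‖ ≤ C) (g : L2) :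
    Mop m hm C hC g =ᵐ[volume] fun ξ => m ξ * g ξ := (mul_memLp hm hC g).coeFn_toLp

def UE : L2 ≃ₗ[ℂ] (L2 × L2) :=
  LinearEquiv.ofBijective ((U true).prod (U false)) ⟨by
    intro f g h
    have h1 := congrArg Prod.fst h
    have h2 := congrArg Prod.snd h
    refine U_inj fun b => ?_
    cases b
    · exact h2
    · exact h1, by
    rintro ⟨p, q⟩
    obtain ⟨f, h1, h2⟩ := U_surj p q
    exact ⟨f, Prod.ext h1 h2⟩⟩

lemma UE_symm (b : Bool) (p : L2 × L2) : U b (UE.symm p) = if b then p.1 else p.2 := by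
  have h := UE.apply_symm_apply p
  cases b
  · exact congrArg Prod.snd h
  · exact congrArg Prod.fst h

/-- `R` is, in the spectral picture, multiplication by `1/(lam - ell)`. -/
def IsMul (lam : ℝ) (R : L2 →L[ℂ] L2) : Prop :=
  ∀ b f, U b (R f) =ᵐ[volume] fun ξ => ((lam : ℂ) - ell ξ)⁻¹ * (U b f) ξ

lemma isMul_bound {lam c : ℝ} (hc : 0 < c) (h : ∀ ξ, c ≤ ‖(lam : ℂ) - ell ξ‖)
    {R : L2 → L2} (hR : ∀ b f, U b (R f) =ᵐ[volume] fun ξ => ((lam : ℂ) - ell ξ)⁻¹ * (U b f) ξ)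
    (f : L2) : ‖R f‖ ≤ c⁻¹ * ‖f‖ := by
  have hb : ∀ b, ‖U b (R f)‖ ≤ c⁻¹ * ‖U b f‖ := by
    intro b
    apply Lp.norm_le_mul_norm_of_ae_le_mul
    filter_upwards [hR b f] with ξ hξ
    rw [hξ, norm_mul, norm_inv]
    gcongr
    exact h ξ
  refine abs_le_of_sq_le_sq' ?_ (by positivity) |>.2
  rw [U_norm (R f), mul_pow, U_norm f, mul_add, ← mul_pow, ← mul_pow]
  have h1 := hb true
  have h2 := hb false
  gcongr

lemma exists_isMul {lam c : ℝ} (hc : 0 < c) (h : ∀ ξ, c ≤ ‖(lam : ℂ) - ell ξ‖) :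
    ∃ R : L2 →L[ℂ] L2, IsMul lam R := by
  have hC : ∀ ξ, ‖((lam : ℂ) - ell ξ)⁻¹‖ ≤ c⁻¹ := by
    intro ξ
    rw [norm_inv]
    gcongr
    exact h ξ
  let M := Mop _ (res_meas lam) c⁻¹ hC
  let R0 : L2 →ₗ[ℂ] L2 := UE.symm.toLinearMap ∘ₗ (M.prodMap M) ∘ₗ UE.toLinearMap
  have hR0 : ∀ b f, U b (R0 f) =ᵐ[volume] fun ξ => ((lam : ℂ) - ell ξ)⁻¹ * (U b f) ξ := by
    intro b f
    have : U b (R0 f) = M (U b f) := by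
      change U b (UE.symm (M (U true f), M (U false f))) = _
      rw [UE_symm]
      cases b <;> rfl
    rw [this]
    exact Mop_coe _ _ _ _ _
  exact ⟨R0.mkContinuous c⁻¹ (isMul_bound hc h hR0), hR0⟩

lemma isMul_norm_le {lam c : ℝ} (hc : 0 < c) (h : ∀ ξ, c ≤ ‖(lam : ℂ) - ell ξ‖)
    {R : L2 →L[ℂ] L2} (hR : IsMul lam R) : ‖R‖ ≤ c⁻¹ :=
  R.opNorm_le_bound (by positivity) (isMul_bound hc h hR)

lemma isMul_resolvent {H : ℂ → (L2 →L[ℂ] L2)}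
    (hH : ∀ α : ℂ, 0 < α.re → IsHausdorffOp (holderKernel α) (H α))
    {A : L2 →ₗ.[ℂ] L2} (hA : IsGeneratorOf (fun t : ℝ => H (t : ℂ)) A)
    {lam : ℝ} (hne : ∀ ξ, (lam : ℂ) - ell ξ ≠ 0) {R : L2 →L[ℂ] L2} (hR : IsMul lam R) :
    IsResolventOf A (lam : ℂ) R := by
  constructor
  · intro f
    have ht := gen_mem hH (f := R f) (g := (lam : ℂ) • R f - f) (by
      intro b
      rw [map_sub, map_smul]
      filter_upwards [Lp.coeFn_sub ((lam : ℂ) • U b (R f)) (U b f),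
        Lp.coeFn_smul (lam : ℂ) (U b (R f)), hR b f] with ξ h1 h2 h3
      rw [h1, Pi.sub_apply, h2, Pi.smul_apply, h3, smul_eq_mul]
      have := hne ξ
      field_simp
      ring)
    have hd : R f ∈ A.domain := (hA (R f)).1.2 ⟨_, ht⟩
    refine ⟨hd, ?_⟩
    have := tendsto_nhds_unique ((hA (R f)).2 hd) ht
    rw [this]
    abel
  · intro f hf
    have hv := fun b => gen_val hH ((hA f).2 hf) b
    refine U_inj fun b => ?_
    apply Lp.ext
    refine (hR b _).trans ?_
    rw [map_sub, map_smul]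
    filter_upwards [Lp.coeFn_sub ((lam : ℂ) • U b f) (U b (A ⟨f, hf⟩)),
        Lp.coeFn_smul (lam : ℂ) (U b f), hv b] with ξ h1 h2 h3
    rw [h1, Pi.sub_apply, h2, Pi.smul_apply, h3, smul_eq_mul, ← sub_mul,
      inv_mul_cancel_left₀ (hne ξ)]

lemma resolvent_unique {A : L2 →ₗ.[ℂ] L2} {z : ℂ} {R R' : L2 →L[ℂ] L2}
    (h : IsResolventOf A z R) (h' : IsResolventOf A z R') : R' = R := by
  ext1 f
  obtain ⟨hd, e⟩ := h'.1 f
  have := h.2 (R' f) hd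
  rw [e] at this
  exact this.symm

lemma isMul_norm_ge {lam : ℝ} (hne : ∀ ξ, (lam : ℂ) - ell ξ ≠ 0) {R : L2 →L[ℂ] L2}
    (hR : IsMul lam R) (ξ₀ : ℝ) : 1 ≤ ‖(lam : ℂ) - ell ξ₀‖ * ‖R‖ := by
  suffices H : ∀ d, ‖(lam : ℂ) - ell ξ₀‖ < d → 1 ≤ d * ‖R‖ by
    have hcl : Tendsto (fun d : ℝ => d * ‖R‖) (nhdsWithin ‖(lam : ℂ) - ell ξ₀‖ (Set.Ioi ‖(lam : ℂ) - ell ξ₀‖))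
        (nhds (‖(lam : ℂ) - ell ξ₀‖ * ‖R‖)) :=
      ((continuous_id.mul continuous_const).tendsto _).mono_left nhdsWithin_le_nhds
    refine ge_of_tendsto hcl ?_
    filter_upwards [self_mem_nhdsWithin] with d hd
    exact H d hd
  intro d hd
  have hd0 : 0 < d := (norm_nonneg _).trans_lt hd
  have hcont : Continuous (fun ξ => ‖(lam : ℂ) - ell ξ‖) := by
    have := ell_cont
    fun_prop
  have hev : ∀ᶠ ξ in nhds ξ₀, ‖(lam : ℂ) - ell ξ‖ < d :=
    (hcont.tendsto ξ₀).eventually (gt_mem_nhds hd)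
  obtain ⟨ε, hε, hball⟩ := Metric.eventually_nhds_iff_ball.1 hev
  let p : L2 := indicatorConstLp 2 (measurableSet_ball (x := ξ₀) (ε := ε))
    measure_ball_lt_top.ne (1:ℂ)
  have hp : p =ᵐ[volume] (Metric.ball ξ₀ ε).indicator fun _ => (1:ℂ) := indicatorConstLp_coeFn
  have hp0 : 0 < ‖p‖ := by
    rw [norm_indicatorConstLp (by simp) (by simp)]
    have hε' : 0 < ε := hε
    have hv : 0 < volume.real (Metric.ball ξ₀ ε) := by
      rw [Measure.real, Real.volume_ball, ENNReal.toReal_ofReal (by linarith)]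
      linarith
    rw [norm_one, one_mul]
    positivity
  obtain ⟨f, h1, h2⟩ := U_surj p 0
  have hf : ‖f‖ = ‖p‖ := by
    have := U_norm f
    rw [h1, h2] at this
    simpa using this
  have h3 : ‖p‖ ≤ d * ‖U true (R f)‖ := by
    apply Lp.norm_le_mul_norm_of_ae_le_mul
    filter_upwards [hR true f, hp] with ξ e1 e2
    rw [e1, h1, e2]
    by_cases hm : ξ ∈ Metric.ball ξ₀ ε
    · rw [Set.indicator_of_mem hm, norm_one, mul_one, norm_inv, ← div_eq_mul_inv,
        one_le_div (norm_pos_iff.2 (hne ξ))]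
      exact (hball ξ hm).le
    · rw [Set.indicator_of_notMem hm]; simp
  have h4 : ‖p‖ ≤ d * (‖R‖ * ‖p‖) := by
    refine h3.trans ?_
    gcongr
    refine (U_le _ _).trans ?_
    rw [← hf]
    exact R.le_opNorm f
  by_contra hlt
  push Not at hlt
  nlinarith

lemma ell_im (ξ : ℝ) : (ell ξ).im = - Real.arctan (4 * Real.pi * ξ) := by
  have hre : 0 < (1/2 + 2 * Real.pi * ξ * I : ℂ).re := by rw [zz_re]; norm_num
  have habs := abs_arg_lt_pi_div_two_iff.2 (Or.inl hre)
  have hlt := abs_lt.1 habs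
  rw [ell, log_im, one_div, arg_inv, if_neg]
  · congr 1
    rw [← Real.arctan_tan hlt.1 hlt.2, tan_arg, zz_re, zz_im]
    congr 1
    ring
  · have := Real.pi_pos
    linarith [hlt.2]

lemma im_le (lam ξ : ℝ) : |Real.arctan (4 * Real.pi * ξ)| ≤ ‖(lam : ℂ) - ell ξ‖ := by
  have := abs_im_le_norm ((lam : ℂ) - ell ξ)
  rwa [sub_im, ofReal_im, ell_im, sub_neg_eq_add, zero_add] at this

lemma re_le (lam ξ : ℝ) : |lam - (ell ξ).re| ≤ ‖(lam : ℂ) - ell ξ‖ := by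
  have := abs_re_le_norm ((lam : ℂ) - ell ξ)
  rwa [sub_re, ofReal_re] at this

lemma ell_zero : ell 0 = Real.log 2 := by
  have : (Real.log 2 : ℂ) = log (2:ℝ) := ofReal_log (by norm_num)
  rw [ell, this]
  norm_num

lemma arctan_abs (x : ℝ) : |Real.arctan x| = Real.arctan |x| := by
  rcases le_total 0 x with h | h
  · rw [abs_of_nonneg h, abs_of_nonneg (Real.arctan_nonneg.2 h)]
  · rw [abs_of_nonpos h, Real.arctan_neg, abs_of_nonpos (Real.arctan_le_zero.2 h)]

lemma lower_exists {lam : ℝ} (h : lam ≠ Real.log 2) :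
    ∃ c, 0 < c ∧ ∀ ξ, c ≤ ‖(lam : ℂ) - ell ξ‖ := by
  rcases lt_or_gt_of_ne h with h | h
  · have hcont : Continuous (fun ξ => (ell ξ).re) := continuous_re.comp ell_cont
    have hev : ∀ᶠ ξ in nhds (0:ℝ), (lam + Real.log 2) / 2 < (ell ξ).re := by
      refine (hcont.tendsto 0).eventually (lt_mem_nhds ?_)
      rw [ell_zero, ofReal_re]
      linarith
    obtain ⟨ε, hε, hball⟩ := Metric.eventually_nhds_iff_ball.1 hev
    refine ⟨min ((Real.log 2 - lam) / 2) (Real.arctan (4 * Real.pi * ε)), ?_, fun ξ => ?_⟩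
    · refine lt_min (by linarith) (Real.arctan_pos.2 ?_)
      have := Real.pi_pos
      positivity
    · by_cases hξ : ξ ∈ Metric.ball (0:ℝ) ε
      · refine (min_le_left _ _).trans (le_trans ?_ (re_le lam ξ))
        rw [abs_sub_comm]
        refine le_trans ?_ (le_abs_self _)
        have := hball ξ hξ
        linarith
      · refine (min_le_right _ _).trans (le_trans ?_ (im_le lam ξ))
        rw [arctan_abs]
        apply Real.arctan_strictMono.monotone
        have hp := Real.pi_pos
        rw [abs_mul, abs_of_pos (by positivity)]
        have : ε ≤ |ξ| := by simpa using hξ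
        gcongr
  · exact ⟨lam - Real.log 2, by linarith, fun ξ => le_trans (by
      have := ell_re_le ξ
      exact le_trans (by linarith) (le_abs_self _)) (re_le lam ξ)⟩

lemma ne_of_lower {lam : ℝ} (h : lam ≠ Real.log 2) (ξ : ℝ) : (lam : ℂ) - ell ξ ≠ 0 := by
  obtain ⟨c, hc, hl⟩ := lower_exists h
  exact norm_pos_iff.1 (hc.trans_le (hl ξ))

lemma exists_re_eq {lam : ℝ} (h : lam < 0) : ∃ ξ, (ell ξ).re = lam := by
  refine ⟨Real.sqrt (Real.exp (-lam) ^ 2 - 1/4) / (2 * Real.pi), ?_⟩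
  have h1 : 1 ≤ Real.exp (-lam) := Real.one_le_exp (by linarith)
  have hp := Real.pi_pos
  rw [ell_re, ← Real.sqrt_sq (norm_nonneg _), ← normSq_eq_norm_sq, normSq_apply, zz_re, zz_im,
    mul_div_cancel₀ _ (by positivity), Real.mul_self_sqrt (by nlinarith)]
  have : (1/2:ℝ) * (1/2) + (Real.exp (-lam) ^ 2 - 1/4) = Real.exp (-lam) ^ 2 := by ring
  rw [this, Real.sqrt_sq (by positivity), Real.log_exp, neg_neg]

lemma upper_ev {d : ℝ} (h0 : 0 < d) (h1 : d < Real.pi / 2) :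
    ∀ᶠ lam : ℝ in atBot, ∀ ξ, d ≤ ‖(lam : ℂ) - ell ξ‖ := by
  filter_upwards [eventually_le_atBot (-d - Real.log (1/2 + Real.tan d))] with lam hlam ξ
  have ht : 0 < Real.tan d := Real.tan_pos_of_pos_of_lt_pi_div_two h0 h1
  have hp := Real.pi_pos
  by_cases hξ : Real.tan d ≤ |4 * Real.pi * ξ|
  · refine le_trans ?_ (im_le lam ξ)
    rw [arctan_abs, ← Real.arctan_tan (x := d) (by linarith) h1]
    exact Real.arctan_strictMono.monotone hξ
  · push Not at hξ
    refine le_trans ?_ (re_le lam ξ)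
    rw [abs_sub_comm]
    refine le_trans ?_ (le_abs_self _)
    rw [ell_re]
    have hn : ‖(1/2 + 2 * Real.pi * ξ * I : ℂ)‖ ≤ 1/2 + Real.tan d := by
      refine (norm_le_abs_re_add_abs_im _).trans ?_
      rw [zz_re, zz_im, abs_of_pos (by norm_num : (0:ℝ) < 1/2)]
      have : |4 * Real.pi * ξ| = 2 * |2 * Real.pi * ξ| := by
        rw [← abs_two, ← abs_mul, abs_two]; ring_nf
      have := abs_nonneg (2 * Real.pi * ξ)
      linarith
    have hl := Real.log_le_log (by linarith [zz_norm ξ]) hn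
    linarith

/-- Every real `λ ≠ log 2` is a regular point of `log C`, the
generator of the Hölder semigroup on `L²(ℝ)`; moreover `‖R(λ, log C)‖ = 1/(λ - log 2)`
for real `λ > log 2`, and `‖R(λ, log C)‖ → 2/π` as `λ → -∞`. -/
theorem stmt14
    (H : ℂ → (L2 →L[ℂ] L2)) (hH0 : H 0 = 1)
    (hHdef : ∀ α : ℂ, 0 < α.re → IsHausdorffOp (holderKernel α) (H α))
    (A : L2 →ₗ.[ℂ] L2) (hA : IsGeneratorOf (fun t : ℝ => H (t : ℂ)) A) :
    (∀ lam : ℝ, lam ≠ Real.log 2 →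
      ∃ R : L2 →L[ℂ] L2, IsResolventOf A (lam : ℂ) R) ∧
    (∀ lam : ℝ, Real.log 2 < lam →
      ∀ R : L2 →L[ℂ] L2, IsResolventOf A (lam : ℂ) R →
        ‖R‖ = 1 / (lam - Real.log 2)) ∧
    (∀ Rfam : ℝ → (L2 →L[ℂ] L2),
      (∀ lam : ℝ, lam < 0 → IsResolventOf A (lam : ℂ) (Rfam lam)) →
      Filter.Tendsto (fun lam : ℝ => ‖Rfam lam‖) Filter.atBot
        (nhds (2 / Real.pi))) := by
  have key : ∀ lam : ℝ, lam ≠ Real.log 2 → ∃ R : L2 →L[ℂ] L2,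
      IsMul lam R ∧ IsResolventOf A (lam : ℂ) R := by
    intro lam h
    obtain ⟨c, hc, hl⟩ := lower_exists h
    obtain ⟨R, hR⟩ := exists_isMul hc hl
    exact ⟨R, hR, isMul_resolvent hHdef hA (ne_of_lower h) hR⟩
  have key2 : ∀ lam : ℝ, lam ≠ Real.log 2 → ∀ R : L2 →L[ℂ] L2, IsResolventOf A (lam : ℂ) R →
      IsMul lam R := by
    intro lam h R hR
    obtain ⟨R', h1, h2⟩ := key lam h
    rw [resolvent_unique h2 hR]
    exact h1
  refine ⟨fun lam h => ?_, fun lam h R hR => ?_, fun Rfam hR => ?_⟩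
  · obtain ⟨R, _, h2⟩ := key lam h
    exact ⟨R, h2⟩
  · have hM := key2 lam h.ne' R hR
    have hpos : 0 < lam - Real.log 2 := by linarith
    apply le_antisymm
    · rw [one_div]
      refine isMul_norm_le hpos (fun ξ => le_trans ?_ (re_le lam ξ)) hM
      have := ell_re_le ξ
      exact le_trans (by linarith) (le_abs_self _)
    · have := isMul_norm_ge (ne_of_lower h.ne') hM 0
      rw [ell_zero, ← ofReal_sub, norm_real, Real.norm_eq_abs, abs_of_pos hpos] at this
      rw [div_le_iff₀ hpos]
      linarith
  · have hlog : 0 < Real.log 2 := Real.log_pos (by norm_num)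
    have hp := Real.pi_pos
    rw [tendsto_order]
    constructor
    · intro a ha
      filter_upwards [eventually_lt_atBot (0:ℝ)] with lam hlam
      refine ha.trans_le ?_
      have hne : lam ≠ Real.log 2 := by linarith
      have hM := key2 lam hne _ (hR lam hlam)
      obtain ⟨ξ, hξ⟩ := exists_re_eq hlam
      have h1 := isMul_norm_ge (ne_of_lower hne) hM ξ
      have h2 : ‖(lam : ℂ) - ell ξ‖ ≤ Real.pi / 2 := by
        refine (norm_le_abs_re_add_abs_im _).trans ?_
        rw [sub_re, ofReal_re, hξ, sub_self, abs_zero, zero_add, sub_im, ofReal_im, ell_im,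
          sub_neg_eq_add, zero_add]
        exact (abs_lt.2 ⟨Real.neg_pi_div_two_lt_arctan _, Real.arctan_lt_pi_div_two _⟩).le
      have h3 : 1 ≤ Real.pi / 2 * ‖Rfam lam‖ :=
        h1.trans (mul_le_mul_of_nonneg_right h2 (norm_nonneg _))
      rw [div_le_iff₀ hp]
      linarith
    · intro a ha
      have ha0 : 0 < a := lt_trans (by positivity) ha
      have hlt : a⁻¹ < Real.pi / 2 := by
        rw [inv_lt_comm₀ ha0 (by positivity), inv_div]
        exact ha
      obtain ⟨d, hd1, hd2⟩ := exists_between hlt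
      have hd0 : 0 < d := lt_trans (by positivity) hd1
      filter_upwards [eventually_lt_atBot (0:ℝ), upper_ev hd0 hd2] with lam hlam hl
      have hne : lam ≠ Real.log 2 := by linarith
      have hM := key2 lam hne _ (hR lam hlam)
      refine (isMul_norm_le hd0 hl hM).trans_lt ?_
      rwa [inv_lt_comm₀ hd0 ha0]
end
end

section
/- Let F be holomorphic in a neighborhood of the circle 𝕋+1 with F(0) = 0. Then there is a function K satisfying (a) K(u) = 0 for a.e. u < 0, (b) K(u)u^{−1/2} ∈ L¹(0,∞), and (c) (ℳK)(z) = F(1/z) on the line Re z = 1/2, such that F(𝒞₊) = (ℋ_K)₊ on L²(ℝ₊). Conversely, if K satisfies (a), (b), (c) with F holomorphic in some neighborhood of 𝕋+1, then F(0) = 0 and (ℋ_K)₊ = F(𝒞₊). -/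
open MeasureTheory Complex Filter

noncomputable section

/-- `C` is the continuous Cesàro operator on `L²(ℝ)`:
`(C f)(x) = ∫₀¹ f(ux) du`. -/
def IsCesaroOp (C : L2 →L[ℂ] L2) : Prop :=
  ∀ f : L2, ∀ᵐ x : ℝ ∂MeasureTheory.volume, C f x = ∫ u in Set.Ioo (0:ℝ) 1, f (u * x)


lemma ae_comp_mul {u : ℝ} (hu : u ≠ 0) {p : ℝ → Prop}
    (h : ∀ᵐ x : ℝ, p x) : ∀ᵐ x : ℝ, p (u * x) := by
  have hq : Measure.QuasiMeasurePreserving (fun x : ℝ => u * x) volume volume := by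
    refine ⟨by fun_prop, ?_⟩
    rw [Real.map_volume_mul_left hu]
    exact Measure.smul_absolutelyContinuous
  exact hq.ae h

lemma L2_sq (g : L2) : Integrable (fun x : ℝ => ‖g x‖ ^ 2) volume := by
  exact (memLp_two_iff_integrable_sq_norm (Lp.aestronglyMeasurable g)).1 (Lp.memLp g)

lemma dil_memLp (g : L2) {u : ℝ} (hu : u ≠ 0) :
    MemLp (fun x : ℝ => g (u * x)) 2 volume := by
  rw [memLp_two_iff_integrable_sq_norm]
  · exact (L2_sq g).comp_mul_left' hu
  · exact ((Lp.stronglyMeasurable g).comp_measurable (by fun_prop)).aestronglyMeasurable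

/-- constant in the Cauchy–Schwarz bound -/
def nn (f g : L2) : ℝ := (∫ x : ℝ, ‖f x‖ ^ (2:ℝ)) ^ (1/2 : ℝ) * (∫ x : ℝ, ‖g x‖ ^ (2:ℝ)) ^ (1/2 : ℝ)

lemma nn_nonneg (f g : L2) : 0 ≤ nn f g := by
  unfold nn; positivity

lemma cc_integrable (f g : L2) {u : ℝ} (hu : u ≠ 0) :
    Integrable (fun x : ℝ => starRingEnd ℂ (f x) * g (u * x)) volume := by
  have h1 := (Lp.memLp f).star
  exact h1.integrable_mul (dil_memLp g hu)

lemma cs_bound (f g : L2) {u : ℝ} (hu : 0 < u) :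
    ∫ x : ℝ, ‖f x‖ * ‖g (u * x)‖ ≤ nn f g * u ^ (-(1/2) : ℝ) := by
  have h := integral_mul_le_Lp_mul_Lq_of_nonneg (μ := (volume : Measure ℝ)) (p := 2) (q := 2)
    Real.HolderConjugate.two_two (f := fun x => ‖f x‖) (g := fun x => ‖g (u * x)‖)
    (Eventually.of_forall fun x => norm_nonneg _) (Eventually.of_forall fun x => norm_nonneg _)
    (by simpa using (Lp.memLp f).norm) (by simpa using (dil_memLp g hu.ne').norm)
  refine h.trans (le_of_eq ?_)
  rw [Measure.integral_comp_mul_left (fun x : ℝ => ‖g x‖ ^ (2:ℝ)) u, smul_eq_mul,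
    Real.mul_rpow (abs_nonneg _) (by positivity), abs_of_pos (inv_pos.2 hu), nn,
    Real.rpow_neg hu.le, Real.inv_rpow hu.le]
  ring

/-- the matrix coefficient of the dilation group -/
def cc (f g : L2) (u : ℝ) : ℂ := ∫ x : ℝ, starRingEnd ℂ (f x) * g (u * x)

lemma cc_bound (f g : L2) {u : ℝ} (hu : 0 < u) : ‖cc f g u‖ ≤ nn f g * u ^ (-(1/2) : ℝ) := by
  refine (norm_integral_le_integral_norm _).trans (le_trans (le_of_eq ?_) (cs_bound f g hu))
  simp

lemma two_meas (f g : L2) : StronglyMeasurable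
    (fun p : ℝ × ℝ => starRingEnd ℂ (f p.1) * g (p.2 * p.1)) := by
  apply StronglyMeasurable.mul
  · exact ((Lp.stronglyMeasurable f).comp_measurable measurable_fst).star
  · exact (Lp.stronglyMeasurable g).comp_measurable (by fun_prop)

lemma cc_meas (f g : L2) : StronglyMeasurable (cc f g) := by
  apply StronglyMeasurable.integral_prod_right (f := fun u x => starRingEnd ℂ (f x) * g (u * x))
  exact (two_meas f g).comp_measurable measurable_swap

/-- weighted integrability -/
def KI (K : ℝ → ℂ) : Prop :=
  IntegrableOn (fun u : ℝ => K u * ((u ^ (-(1/2) : ℝ) : ℝ) : ℂ)) (Set.Ioi 0)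

lemma KI.aesm {K : ℝ → ℂ} (hK : KI K) : AEStronglyMeasurable K (volume.restrict (Set.Ioi 0)) := by
  have h1 : AEStronglyMeasurable (fun u : ℝ => ((u ^ ((1/2) : ℝ) : ℝ) : ℂ))
      (volume.restrict (Set.Ioi 0)) := by
    apply Measurable.aestronglyMeasurable
    fun_prop
  refine (hK.aestronglyMeasurable.mul h1).congr ?_
  filter_upwards [ae_restrict_mem measurableSet_Ioi] with u hu
  have hu : (0:ℝ) < u := hu
  simp only [Pi.mul_apply]
  rw [mul_assoc, ← ofReal_mul, ← Real.rpow_add hu]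
  norm_num

lemma KI.norm {K : ℝ → ℂ} (hK : KI K) :
    IntegrableOn (fun u : ℝ => ‖K u‖ * u ^ (-(1/2) : ℝ)) (Set.Ioi 0) := by
  refine (Integrable.norm hK).congr ?_
  filter_upwards [ae_restrict_mem measurableSet_Ioi] with u hu
  have hu : (0:ℝ) < u := hu
  rw [norm_mul, norm_real, Real.norm_of_nonneg (by positivity)]

lemma KI.of_norm {K : ℝ → ℂ} (hm : AEStronglyMeasurable K (volume.restrict (Set.Ioi 0)))
    (hK : IntegrableOn (fun u : ℝ => ‖K u‖ * u ^ (-(1/2) : ℝ)) (Set.Ioi 0)) : KI K := by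
  have h1 : AEStronglyMeasurable (fun u : ℝ => ((u ^ (-(1/2) : ℝ) : ℝ) : ℂ))
      (volume.restrict (Set.Ioi 0)) := by
    apply Measurable.aestronglyMeasurable
    fun_prop
  refine Integrable.mono' hK (hm.mul h1) ?_
  filter_upwards [ae_restrict_mem measurableSet_Ioi] with u hu
  have hu : (0:ℝ) < u := hu
  rw [norm_mul, norm_real, Real.norm_of_nonneg (by positivity)]

lemma fub_int {K : ℝ → ℂ} (hK : KI K) (f g : L2) :
    Integrable (fun p : ℝ × ℝ => K p.2 * (starRingEnd ℂ (f p.1) * g (p.2 * p.1)))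
      ((volume : Measure ℝ).prod (volume.restrict (Set.Ioi 0))) := by
  have hm : AEStronglyMeasurable
      (fun p : ℝ × ℝ => K p.2 * (starRingEnd ℂ (f p.1) * g (p.2 * p.1)))
      ((volume : Measure ℝ).prod (volume.restrict (Set.Ioi 0))) :=
    hK.aesm.comp_snd.mul (two_meas f g).aestronglyMeasurable
  rw [integrable_prod_iff' hm]
  constructor
  · filter_upwards [ae_restrict_mem measurableSet_Ioi] with u hu
    exact (cc_integrable f g (ne_of_gt hu)).const_mul _
  · refine Integrable.mono' (hK.norm.const_mul (nn f g)) ?_ ?_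
    · exact hm.norm.prod_swap.integral_prod_right'
    · filter_upwards [ae_restrict_mem measurableSet_Ioi] with u hu
      have hu : (0:ℝ) < u := hu
      rw [Real.norm_of_nonneg (by positivity)]
      have : ∀ x : ℝ, ‖K u * (starRingEnd ℂ (f x) * g (u * x))‖ = ‖K u‖ * (‖f x‖ * ‖g (u * x)‖) := by
        intro x; simp
      simp only [this]
      rw [integral_const_mul]
      calc _ ≤ ‖K u‖ * (nn f g * u ^ (-(1/2) : ℝ)) := by
            gcongr; exact cs_bound f g hu
        _ = _ := by ring

lemma fub_eq {K : ℝ → ℂ} (hK : KI K) (f g : L2) :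
    ∫ x : ℝ, starRingEnd ℂ (f x) * (∫ u in Set.Ioi (0:ℝ), K u * g (u * x))
      = ∫ u in Set.Ioi (0:ℝ), K u * cc f g u := by
  have h := integral_integral_swap (f := fun x u => K u * (starRingEnd ℂ (f x) * g (u * x)))
    (fub_int hK f g)
  simp only [integral_const_mul] at h
  refine Eq.trans ?_ h
  congr 1; ext x
  rw [← integral_const_mul]
  congr 1; ext u; ring

lemma fub_int_left {K : ℝ → ℂ} (hK : KI K) (f g : L2) :
    Integrable (fun x : ℝ => starRingEnd ℂ (f x) * (∫ u in Set.Ioi (0:ℝ), K u * g (u * x))) := by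
  refine (fub_int hK f g).integral_prod_left.congr (Eventually.of_forall fun x => ?_)
  simp only
  rw [← integral_const_mul]
  congr 1; ext u; ring

lemma cc_KI {K : ℝ → ℂ} (hK : KI K) (f g : L2) :
    IntegrableOn (fun u : ℝ => K u * cc f g u) (Set.Ioi 0) := by
  refine Integrable.mono' (hK.norm.const_mul (nn f g))
    (hK.aesm.mul (cc_meas f g).aestronglyMeasurable) ?_
  filter_upwards [ae_restrict_mem measurableSet_Ioi] with u hu
  rw [norm_mul]
  calc _ ≤ ‖K u‖ * (nn f g * u ^ (-(1/2) : ℝ)) := by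
            gcongr; exact cc_bound f g hu
        _ = _ := by ring


lemma sph_inv_re {w : ℂ} (hw : w ∈ Metric.sphere (1:ℂ) 1) (h0 : w ≠ 0) : (w⁻¹).re = 1/2 := by
  rw [mem_sphere_iff_norm] at hw
  have h2 : normSq (w - 1) = 1 := by rw [normSq_eq_norm_sq, hw]; norm_num
  have h3 : normSq w ≠ 0 := by simpa using h0
  rw [inv_re, div_eq_div_iff h3 two_ne_zero]
  rw [normSq_apply] at h2 ⊢
  simp at h2
  linarith

lemma inv_mem_sph {z : ℂ} (hz : z.re = 1/2) : z⁻¹ ∈ Metric.sphere (1:ℂ) 1 ∧ z ≠ 0 := by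
  have h0 : z ≠ 0 := by rintro rfl; norm_num at hz
  refine ⟨?_, h0⟩
  rw [mem_sphere_iff_norm]
  have : z⁻¹ - 1 = (1 - z) / z := by field_simp
  rw [this, norm_div, div_eq_one_iff_eq (by simpa using h0)]
  have : ‖1 - z‖ ^ 2 = ‖z‖ ^ 2 := by
    rw [← normSq_eq_norm_sq, ← normSq_eq_norm_sq, normSq_apply, normSq_apply]
    simp [hz]; ring
  exact (pow_left_inj₀ (norm_nonneg _) (norm_nonneg _) two_ne_zero).1 this

lemma KI.mellinConv {K : ℝ → ℂ} (hK : KI K) {z : ℂ} (hz : z.re = 1/2) : MellinConvergent K z := by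
  have hc : AEStronglyMeasurable (fun t : ℝ => (t:ℂ) ^ (z - 1)) (volume.restrict (Set.Ioi 0)) := by
    apply ContinuousOn.aestronglyMeasurable _ measurableSet_Ioi
    intro u hu
    exact (continuousAt_ofReal_cpow_const _ _ (Or.inr (ne_of_gt hu))).continuousWithinAt
  refine Integrable.mono' hK.norm (hc.smul hK.aesm) ?_
  · filter_upwards [ae_restrict_mem measurableSet_Ioi] with u hu
    rw [norm_smul, norm_cpow_eq_rpow_re_of_pos hu, sub_re, hz, mul_comm]
    norm_num

lemma mellin_bound {K : ℝ → ℂ} {z : ℂ} (hz : z.re = 1/2) :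
    ‖mellin K z‖ ≤ ∫ u in Set.Ioi (0:ℝ), ‖K u‖ * u ^ (-(1/2) : ℝ) := by
  refine (norm_integral_le_integral_norm _).trans (le_of_eq ?_)
  apply setIntegral_congr_fun measurableSet_Ioi
  intro u hu
  simp only
  rw [norm_smul, norm_cpow_eq_rpow_re_of_pos hu, sub_re, hz, mul_comm]
  norm_num

/-- symbol of the kernel `K` -/
def GK (K : ℝ → ℂ) (w : ℂ) : ℂ := if w = 0 then 0 else mellin K w⁻¹

lemma KI.add {K L : ℝ → ℂ} (hK : KI K) (hL : KI L) : KI (fun u => K u + L u) := by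
  refine (Integrable.add hK hL).congr (Eventually.of_forall fun u => ?_)
  simp [add_mul]

lemma KI.smul {K : ℝ → ℂ} (hK : KI K) (c : ℂ) : KI (fun u => c * K u) := by
  refine (Integrable.const_mul hK c).congr (Eventually.of_forall fun u => ?_)
  simp [mul_assoc]

lemma KI.sub {K L : ℝ → ℂ} (hK : KI K) (hL : KI L) : KI (fun u => K u - L u) := by
  refine (Integrable.sub hK hL).congr (Eventually.of_forall fun u => ?_)
  simp [sub_mul]

lemma GK_add {K L : ℝ → ℂ} (hK : KI K) (hL : KI L) {w : ℂ} (hw : w ∈ Metric.sphere (1:ℂ) 1) :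
    GK (fun u => K u + L u) w = GK K w + GK L w := by
  unfold GK
  split_ifs with h0
  · simp
  · have hz := sph_inv_re hw h0
    simp only [mellin, smul_add]
    exact integral_add (hK.mellinConv hz) (hL.mellinConv hz)

lemma GK_sub {K L : ℝ → ℂ} (hK : KI K) (hL : KI L) {w : ℂ} (hw : w ∈ Metric.sphere (1:ℂ) 1) :
    GK (fun u => K u - L u) w = GK K w - GK L w := by
  unfold GK
  split_ifs with h0
  · simp
  · have hz := sph_inv_re hw h0
    simp only [mellin, smul_sub]
    exact integral_sub (hK.mellinConv hz) (hL.mellinConv hz)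

lemma GK_smul {K : ℝ → ℂ} (c : ℂ) (w : ℂ) :
    GK (fun u => c * K u) w = c * GK K w := by
  unfold GK
  split_ifs with h0
  · simp
  · exact mellin_const_smul K w⁻¹ c

lemma GK_bound {K : ℝ → ℂ} {w : ℂ} (hw : w ∈ Metric.sphere (1:ℂ) 1) :
    ‖GK K w‖ ≤ ∫ u in Set.Ioi (0:ℝ), ‖K u‖ * u ^ (-(1/2) : ℝ) := by
  unfold GK
  split_ifs with h0
  · rw [norm_zero]
    apply setIntegral_nonneg measurableSet_Ioi
    intro u hu
    have hu : (0:ℝ) < u := hu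
    positivity
  · exact mellin_bound (sph_inv_re hw h0)

section Hpart
variable {Hp : Type} [NormedAddCommGroup Hp] [InnerProductSpace ℂ Hp] [CompleteSpace Hp]

/-- the main property -/
structure QQ (J : Hp →ₗᵢ[ℂ] L2) (Cp : Hp →L[ℂ] Hp) (K : ℝ → ℂ) : Prop where
  ki : KI K
  cont : ContinuousOn (GK K) (Metric.sphere (1:ℂ) 1)
  eq : ∀ f g : Hp, inner ℂ f (cfc (GK K) Cp g) = ∫ u in Set.Ioi (0:ℝ), K u * cc (J f) (J g) u

variable {J : Hp →ₗᵢ[ℂ] L2} {Cp : Hp →L[ℂ] Hp}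

lemma QQ.add (hσp : spectrum ℂ Cp = Metric.sphere (1:ℂ) 1) {K L : ℝ → ℂ}
    (hK : QQ J Cp K) (hL : QQ J Cp L) : QQ J Cp (fun u => K u + L u) := by
  refine ⟨hK.ki.add hL.ki, ?_, ?_⟩
  · exact (hK.cont.add hL.cont).congr fun w hw => GK_add hK.ki hL.ki hw
  · intro f g
    have : cfc (GK fun u => K u + L u) Cp = cfc (GK K) Cp + cfc (GK L) Cp := by
      rw [← cfc_add (a := Cp) (GK K) (GK L) (by rw [hσp]; exact hK.cont) (by rw [hσp]; exact hL.cont)]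
      apply cfc_congr
      intro w hw
      rw [hσp] at hw
      exact GK_add hK.ki hL.ki hw
    rw [this, _root_.add_apply, inner_add_right, hK.eq, hL.eq,
      ← integral_add (cc_KI hK.ki _ _) (cc_KI hL.ki _ _)]
    simp only [add_mul]

lemma QQ.smul (hσp : spectrum ℂ Cp = Metric.sphere (1:ℂ) 1) {K : ℝ → ℂ}
    (hK : QQ J Cp K) (c : ℂ) : QQ J Cp (fun u => c * K u) := by
  refine ⟨hK.ki.smul c, ?_, ?_⟩
  · exact (continuousOn_const.mul hK.cont).congr fun w hw => GK_smul c w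
  · intro f g
    have : cfc (GK fun u => c * K u) Cp = c • cfc (GK K) Cp := by
      rw [← cfc_smul (a := Cp) c (GK K) (by rw [hσp]; exact hK.cont)]
      apply cfc_congr
      intro w hw
      exact GK_smul c w
    rw [this, _root_.smul_apply, inner_smul_right, hK.eq, ← integral_const_mul]
    simp only [mul_assoc]

lemma QQ.congr {K L : ℝ → ℂ} (hK : QQ J Cp K) (h : ∀ᵐ u ∂(volume.restrict (Set.Ioi (0:ℝ))), K u = L u) :
    QQ J Cp L := by
  have hG : GK L = GK K := by
    ext w
    unfold GK
    split_ifs with h0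
    · rfl
    · apply integral_congr_ae
      filter_upwards [h] with u hu
      rw [hu]
  refine ⟨?_, ?_, ?_⟩
  · refine Integrable.congr hK.ki ?_
    filter_upwards [h] with u hu
    rw [hu]
  · rw [hG]; exact hK.cont
  · intro f g
    rw [hG, hK.eq]
    apply integral_congr_ae
    filter_upwards [h] with u hu
    rw [hu]

lemma QQ.closure (hσp : spectrum ℂ Cp = Metric.sphere (1:ℂ) 1) {K : ℝ → ℂ}
    (hKI : KI K) (h : ∀ ε > 0, ∃ L, QQ J Cp L ∧
      ∫ u in Set.Ioi (0:ℝ), ‖K u - L u‖ * u ^ (-(1/2) : ℝ) ≤ ε) : QQ J Cp K := by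
  have hcont : ContinuousOn (GK K) (Metric.sphere (1:ℂ) 1) := by
    apply continuousOn_of_uniform_approx_of_continuousOn
    intro u hu
    obtain ⟨ε, hε, hεu⟩ := Metric.mem_uniformity_dist.1 hu
    obtain ⟨L, hL, hLe⟩ := h (ε/2) (by positivity)
    refine ⟨GK L, hL.cont, fun w hw => hεu ?_⟩
    rw [dist_eq_norm, ← GK_sub hKI hL.ki hw]
    exact lt_of_le_of_lt ((GK_bound hw).trans hLe) (by linarith)
  refine ⟨hKI, hcont, fun f g => ?_⟩
  rw [← sub_eq_zero, ← norm_le_zero_iff]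
  apply le_of_forall_pos_le_add
  intro ε hε
  set M : ℝ := ‖f‖ * ‖g‖ + nn (J f) (J g) + 1 with hM
  have hMpos : 0 < M := by have := nn_nonneg (J f) (J g); positivity
  obtain ⟨L, hL, hLe⟩ := h (ε / M) (by positivity)
  have h1 : ‖inner ℂ f (cfc (GK K) Cp g) - inner ℂ f (cfc (GK L) Cp g)‖ ≤ ‖f‖ * (ε / M * ‖g‖) := by
    rw [← inner_sub_right, ← _root_.sub_apply,
      ← cfc_sub (a := Cp) (GK K) (GK L) (by rw [hσp]; exact hcont) (by rw [hσp]; exact hL.cont)]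
    refine (norm_inner_le_norm _ _).trans ?_
    gcongr
    refine ContinuousLinearMap.le_of_opNorm_le _ ?_ _
    apply norm_cfc_le (by positivity)
    intro w hw
    rw [hσp] at hw
    rw [← GK_sub hKI hL.ki hw]
    exact (GK_bound hw).trans hLe
  have h2 : ‖(∫ u in Set.Ioi (0:ℝ), L u * cc (J f) (J g) u) -
      ∫ u in Set.Ioi (0:ℝ), K u * cc (J f) (J g) u‖ ≤ nn (J f) (J g) * (ε / M) := by
    rw [← integral_sub (cc_KI hL.ki _ _) (cc_KI hKI _ _)]
    refine (norm_integral_le_of_norm_le ((hKI.sub hL.ki).norm.const_mul (nn (J f) (J g))) ?_).trans ?_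
    · filter_upwards [ae_restrict_mem measurableSet_Ioi] with u hu
      rw [← sub_mul, norm_mul, norm_sub_rev]
      calc _ ≤ ‖K u - L u‖ * (nn (J f) (J g) * u ^ (-(1/2) : ℝ)) := by
            gcongr; exact cc_bound _ _ hu
        _ = _ := by ring
    · rw [integral_const_mul]
      gcongr
      exact nn_nonneg _ _
  rw [← hL.eq] at h2
  calc _ ≤ ‖f‖ * (ε / M * ‖g‖) + nn (J f) (J g) * (ε / M) :=
        (norm_sub_le_norm_sub_add_norm_sub _ _ _).trans (add_le_add h1 h2)
    _ = (‖f‖ * ‖g‖ + nn (J f) (J g)) / M * ε := by ring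
    _ ≤ 1 * ε := by
        gcongr
        rw [div_le_one hMpos]; linarith
    _ = _ := by ring


/-- adjoint kernel -/
def ks (K : ℝ → ℂ) (u : ℝ) : ℂ := (u:ℂ)⁻¹ * starRingEnd ℂ (K u⁻¹)

lemma ks_ks (K : ℝ → ℂ) {u : ℝ} (hu : 0 < u) : ks (ks K) u = K u := by
  have : (u:ℂ) ≠ 0 := by exact_mod_cast hu.ne'
  simp [ks]
  field_simp

lemma KI.ks {K : ℝ → ℂ} (hK : KI K) : KI (ks K) := by
  have h1 : IntegrableOn (fun u : ℝ => starRingEnd ℂ (K u * ((u ^ (-(1/2) : ℝ) : ℝ) : ℂ)))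
      (Set.Ioi 0) := by
    have := Integrable.norm hK
    exact (ContinuousLinearEquiv.integrable_comp_iff (conjCLE)).2 hK
  rw [← integrableOn_Ioi_comp_rpow_iff _ (p := -1) (by norm_num)] at h1
  refine h1.congr ?_
  filter_upwards [ae_restrict_mem measurableSet_Ioi] with u hu
  have hu : (0:ℝ) < u := hu
  have hu' : (u:ℂ) ≠ 0 := by exact_mod_cast hu.ne'
  rw [Real.rpow_neg_one, _root_.ks, map_mul, conj_ofReal, real_smul]
  have e : (((|(-1:ℝ)| * u ^ ((-1:ℝ) - 1)) : ℝ) : ℂ) * ((u⁻¹ ^ (-(1/2) : ℝ) : ℝ) : ℂ)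
     = (u:ℂ)⁻¹ * ((u ^ (-(1/2) : ℝ) : ℝ) : ℂ) := by
    rw [← ofReal_inv, ← ofReal_mul, ← ofReal_mul, ← Real.rpow_neg_one u, ← Real.rpow_mul hu.le,
      abs_neg, abs_one, one_mul, ← Real.rpow_add hu, ← Real.rpow_add hu]
    norm_num
  calc _ = (((|(-1:ℝ)| * u ^ ((-1:ℝ) - 1)) : ℝ) : ℂ) * ((u⁻¹ ^ (-(1/2) : ℝ) : ℝ) : ℂ)
        * starRingEnd ℂ (K u⁻¹) := by ring
    _ = _ := by rw [e]; ring

lemma cc_star (f g : L2) {u : ℝ} (hu : 0 < u) :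
    cc g f u = (u:ℂ)⁻¹ * starRingEnd ℂ (cc f g u⁻¹) := by
  have h := Measure.integral_comp_mul_left
    (fun y : ℝ => starRingEnd ℂ (g (u⁻¹ * y)) * f y) u
  have e : ∀ x : ℝ, u⁻¹ * (u * x) = x := fun x => by field_simp
  simp only [e] at h
  unfold cc
  rw [h, abs_of_pos (inv_pos.2 hu), ← integral_conj, real_smul]
  simp [mul_comm]

lemma mellin_ks {K : ℝ → ℂ} {z : ℂ} (hz : z.re = 1/2) :
    mellin (ks K) z = starRingEnd ℂ (mellin K z) := by
  symm
  unfold mellin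
  rw [← integral_conj, ← integral_comp_rpow_Ioi _ (p := -1) (by norm_num)]
  apply setIntegral_congr_fun measurableSet_Ioi
  intro u hu
  have hu : (0:ℝ) < u := hu
  have hu' : (u:ℂ) ≠ 0 := by exact_mod_cast hu.ne'
  simp only [smul_eq_mul, map_mul, ks, Real.rpow_neg_one, real_smul]
  have e1 : starRingEnd ℂ (((u⁻¹ : ℝ) : ℂ) ^ (z - 1)) = (u:ℂ) ^ z := by
    rw [← conj_ofReal (u⁻¹), ← cpow_conj, ofReal_inv, inv_cpow, ← cpow_neg]
    · congr 1
      apply Complex.ext <;> simp [hz]; norm_num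
    · rw [arg_ofReal_of_nonneg hu.le]; exact Real.pi_pos.ne
    · rw [arg_ofReal_of_nonneg (by positivity)]; exact Real.pi_pos.ne
  rw [e1, cpow_sub _ _ hu', cpow_one]
  have e2 : ((|(-1:ℝ)| * u ^ ((-1:ℝ) - 1) : ℝ) : ℂ) = (u:ℂ)⁻¹ * (u:ℂ)⁻¹ := by
    rw [abs_neg, abs_one, one_mul, sub_eq_add_neg, Real.rpow_add hu, Real.rpow_neg_one]
    simp
  rw [e2]; field_simp

lemma QQ.ks {K : ℝ → ℂ} (hσp : spectrum ℂ Cp = Metric.sphere (1:ℂ) 1)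
    (hK : QQ J Cp K) : QQ J Cp (ks K) := by
  have hG : ∀ w ∈ Metric.sphere (1:ℂ) 1, GK (_root_.ks K) w = star (GK K w) := by
    intro w hw
    unfold GK
    split_ifs with h0
    · simp
    · exact mellin_ks (sph_inv_re hw h0)
  refine ⟨hK.ki.ks, ?_, fun f g => ?_⟩
  · exact (hK.cont.star).congr fun w hw => hG w hw
  · have : cfc (GK (_root_.ks K)) Cp = star (cfc (GK K) Cp) := by
      rw [← cfc_star]
      apply cfc_congr
      rw [hσp]
      exact hG
    rw [this, ContinuousLinearMap.star_eq_adjoint, ContinuousLinearMap.adjoint_inner_right,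
      ← inner_conj_symm, hK.eq, ← integral_conj, ← integral_comp_rpow_Ioi _ (p := -1) (by norm_num)]
    apply setIntegral_congr_fun measurableSet_Ioi
    intro u hu
    have hu : (0:ℝ) < u := hu
    have hu' : (u:ℂ) ≠ 0 := by exact_mod_cast hu.ne'
    have e2 : ((|(-1:ℝ)| * u ^ ((-1:ℝ) - 1) : ℝ) : ℂ) = (u:ℂ)⁻¹ * (u:ℂ)⁻¹ := by
      rw [abs_neg, abs_one, one_mul, sub_eq_add_neg, Real.rpow_add hu, Real.rpow_neg_one]
      simp
    simp only [map_mul, _root_.ks, Real.rpow_neg_one, real_smul]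
    rw [e2, cc_star (J f) (J g) (inv_pos.2 hu)]
    simp
    field_simp

lemma KI_of_bdd {K : ℝ → ℂ} {b M : ℝ} (hb0 : 0 ≤ b) (hm : Measurable K) (hb : ∀ u > 0, ‖K u‖ ≤ M)
    (hs : ∀ u > b, K u = 0) : KI K := by
  apply KI.of_norm hm.aestronglyMeasurable
  have h1 : IntegrableOn (fun u : ℝ => M * u ^ (-(1/2) : ℝ)) (Set.Ioc 0 b) := by
    rw [← intervalIntegrable_iff_integrableOn_Ioc_of_le hb0]
    exact (intervalIntegral.intervalIntegrable_rpow' (by norm_num)).const_mul _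
  have h2 := (integrable_indicator_iff measurableSet_Ioc).2 h1
  refine Integrable.mono' (h2.mono_measure Measure.restrict_le_self) ?_ ?_
  · apply Measurable.aestronglyMeasurable
    fun_prop
  · filter_upwards [ae_restrict_mem measurableSet_Ioi] with u hu
    have hu : (0:ℝ) < u := hu
    rw [Real.norm_of_nonneg (by positivity)]
    by_cases hub : u ≤ b
    · rw [Set.indicator_of_mem (Set.mem_Ioc.2 ⟨hu, hub⟩)]
      gcongr; exact hb u hu
    · rw [hs u (not_le.1 hub), norm_zero, zero_mul]
      exact Set.indicator_nonneg (fun v hv => by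
        have := (norm_nonneg _).trans (hb v hv.1)
        have := hv.1
        positivity) _

lemma int_Ioi_ind {b : ℝ} (φ : ℝ → ℂ) :
    ∫ u in Set.Ioi (0:ℝ), (Set.Ioc 0 b).indicator φ u = ∫ u in Set.Ioc (0:ℝ) b, φ u := by
  rw [setIntegral_indicator measurableSet_Ioc]
  congr 2
  ext x; simp

lemma cc_C {C : L2 →L[ℂ] L2} (hC : IsCesaroOp C) (f h : L2) {u : ℝ} (hu : 0 < u) :
    cc f (C h) u = (u:ℂ)⁻¹ * ∫ s in Set.Ioc (0:ℝ) u, cc f h s := by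
  have hKI : KI ((Set.Ioc (0:ℝ) u).indicator (fun _ => (u:ℂ)⁻¹)) := by
    refine KI_of_bdd (b := u) (M := ‖(u:ℂ)⁻¹‖) hu.le ?_ ?_ ?_
    · exact measurable_const.indicator measurableSet_Ioc
    · intro v hv
      exact norm_indicator_le_norm_self (fun _ => (u:ℂ)⁻¹) v
    · intro v hv
      apply Set.indicator_of_notMem
      simp; intro; exact hv
  have h1 := fub_eq hKI f h
  simp only [← Set.indicator_mul_left] at h1
  simp only [int_Ioi_ind, integral_const_mul] at h1
  rw [← h1]
  unfold cc
  apply integral_congr_ae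
  filter_upwards [ae_comp_mul hu.ne' (hC h)] with x hx
  rw [hx]
  congr 1
  have h2 := intervalIntegral.integral_comp_mul_right (a := 0) (b := 1) (fun s => h (s * x)) hu.ne'
  rw [← integral_Ioc_eq_integral_Ioo]
  rw [zero_mul, one_mul, intervalIntegral.integral_of_le hu.le,
    intervalIntegral.integral_of_le zero_le_one, real_smul, ofReal_inv] at h2
  simp only [mul_assoc] at h2
  have e : ∀ s : ℝ, (Set.Ioc 0 u).indicator (fun _ => (u:ℂ)⁻¹) s * h (s * x)
      = (Set.Ioc 0 u).indicator (fun s => (u:ℂ)⁻¹ * h (s * x)) s := by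
    intro s; simp [Set.indicator]
  simp only [e]
  rw [int_Ioi_ind, integral_const_mul]
  exact h2

lemma triangle {c : ℝ → ℂ} (hc : IntegrableOn c (Set.Ioc 0 1)) (m : ℕ) :
    ∫ u in Set.Ioc (0:ℝ) 1, ((m * u ^ (m-1) : ℝ) : ℂ) * ∫ s in Set.Ioc (0:ℝ) u, c s
      = ∫ s in Set.Ioc (0:ℝ) 1, (1 - (s:ℂ) ^ m) * c s := by
  have hInt0 : Integrable (fun p : ℝ × ℝ => {q : ℝ × ℝ | q.2 ≤ q.1}.indicator
      (fun p : ℝ × ℝ => ((m * p.1 ^ (m-1) : ℝ) : ℂ) * c p.2) p)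
      ((volume.restrict (Set.Ioc (0:ℝ) 1)).prod (volume.restrict (Set.Ioc (0:ℝ) 1))) := by
    apply Integrable.indicator
    · refine Integrable.mul_prod (f := fun u : ℝ => ((m * u ^ (m-1) : ℝ) : ℂ)) ?_ hc
      have : Continuous (fun u : ℝ => ((m * u ^ (m-1) : ℝ) : ℂ)) := by fun_prop
      exact (this.integrableOn_Icc).mono_set Set.Ioc_subset_Icc_self
    · exact measurableSet_le measurable_snd measurable_fst
  have h := integral_integral_swap (f := fun u s => {q : ℝ × ℝ | q.2 ≤ q.1}.indicator
      (fun p : ℝ × ℝ => ((m * p.1 ^ (m-1) : ℝ) : ℂ) * c p.2) (u, s)) hInt0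
  refine Eq.trans ?_ (h.trans ?_)
  · apply setIntegral_congr_fun measurableSet_Ioc
    intro u hu
    simp only
    have e : ∀ s : ℝ, {q : ℝ × ℝ | q.2 ≤ q.1}.indicator
      (fun p : ℝ × ℝ => ((m * p.1 ^ (m-1) : ℝ) : ℂ) * c p.2) (u, s)
       = (Set.Iic u).indicator (fun s => ((m * u ^ (m-1) : ℝ) : ℂ) * c s) s := by
      intro s; simp [Set.indicator]
    simp only [e]
    rw [setIntegral_indicator measurableSet_Iic, integral_const_mul]
    congr 3
    ext s; simp; intro _ h2; exact h2.trans hu.2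
  · apply setIntegral_congr_fun measurableSet_Ioc
    intro s hs
    simp only
    have e : ∀ u : ℝ, {q : ℝ × ℝ | q.2 ≤ q.1}.indicator
      (fun p : ℝ × ℝ => ((m * p.1 ^ (m-1) : ℝ) : ℂ) * c p.2) (u, s)
       = (Set.Ici s).indicator (fun u => ((m * u ^ (m-1) : ℝ) : ℂ) * c s) u := by
      intro u; simp [Set.indicator]
    simp only [e]
    rw [setIntegral_indicator measurableSet_Ici, integral_mul_const]
    congr 1
    have e3 : Set.Ioc (0:ℝ) 1 ∩ Set.Ici s = Set.Icc s 1 := by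
      ext u; simp; constructor
      · rintro ⟨⟨a, b⟩, c⟩; exact ⟨c, b⟩
      · rintro ⟨a, b⟩; exact ⟨⟨lt_of_lt_of_le hs.1 a, b⟩, a⟩
    rw [e3, integral_Icc_eq_integral_Ioc, ← intervalIntegral.integral_of_le hs.2,
      intervalIntegral.integral_ofReal]
    have := intervalIntegral.integral_eq_sub_of_hasDerivAt (a := s) (b := 1)
      (f := fun u : ℝ => u ^ m) (f' := fun u : ℝ => m * u ^ (m-1))
      (fun u _ => hasDerivAt_pow m u) (by apply Continuous.intervalIntegrable; fun_prop)
    rw [this]; simp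


lemma cc_intOn (f g : L2) : IntegrableOn (cc f g) (Set.Ioc 0 1) := by
  have hKI : KI ((Set.Ioc (0:ℝ) 1).indicator (fun _ => (1:ℂ))) := by
    refine KI_of_bdd (b := 1) (M := 1) zero_le_one ?_ ?_ ?_
    · exact measurable_const.indicator measurableSet_Ioc
    · intro v hv
      simpa using norm_indicator_le_norm_self (s := Set.Ioc (0:ℝ) 1) (fun _ => (1:ℂ)) v
    · intro v hv
      apply Set.indicator_of_notMem
      simp; intro; exact hv
  refine ((cc_KI hKI f g).mono_set (fun u hu => hu.1)).congr_fun ?_ measurableSet_Ioc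
  intro u hu
  simp [Set.indicator_of_mem hu]

/-- monomial kernels -/
def mon (m : ℕ) : ℝ → ℂ := (Set.Ioc (0:ℝ) 1).indicator (fun u => (u:ℂ) ^ m)

lemma mon_KI (m : ℕ) : KI (mon m) := by
  refine KI_of_bdd (b := 1) (M := 1) zero_le_one ?_ ?_ ?_
  · exact (by fun_prop : Measurable fun u : ℝ => (u:ℂ) ^ m).indicator measurableSet_Ioc
  · intro v hv
    unfold mon
    by_cases h : v ≤ 1
    · rw [Set.indicator_of_mem (Set.mem_Ioc.2 ⟨hv, h⟩), norm_pow, norm_real,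
        Real.norm_of_nonneg (le_of_lt hv)]
      exact pow_le_one₀ (le_of_lt hv) h
    · rw [Set.indicator_of_notMem (by simp; intro; linarith)]; simp
  · intro v hv
    apply Set.indicator_of_notMem
    simp; intro; exact hv

lemma sph_ne {w : ℂ} (hw : w ∈ Metric.sphere (1:ℂ) 1) (m : ℕ) : 1 + m * w ≠ 0 := by
  have h1 : 0 ≤ w.re := by
    rw [mem_sphere_iff_norm] at hw
    have := abs_re_le_norm (w - 1)
    rw [hw] at this
    have := (abs_le.1 this).1
    simp at this
    exact this
  intro h
  have := congrArg re h
  simp at this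
  have : 0 ≤ (m:ℝ) * w.re := by positivity
  linarith

lemma GK_mon (m : ℕ) {w : ℂ} (hw : w ∈ Metric.sphere (1:ℂ) 1) :
    GK (mon m) w = w * (1 + m * w)⁻¹ := by
  unfold GK
  split_ifs with h0
  · simp [h0]
  · have hz := sph_inv_re hw h0
    have h := (hasMellin_cpow_Ioc (m:ℂ) (s := w⁻¹) (by rw [hz]; simp; positivity)).2
    have e : mon m = (Set.Ioc (0:ℝ) 1).indicator (fun t : ℝ => (t:ℂ) ^ (m:ℂ)) := by
      simp [mon]
    rw [e, h]
    have := sph_ne hw m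
    have h3 : w⁻¹ + m ≠ 0 := by
      intro h4; apply this
      have : w * (w⁻¹ + m) = 0 := by rw [h4, mul_zero]
      rw [mul_add, mul_inv_cancel₀ h0] at this
      rw [← this]; ring
    field_simp

lemma inner_cc (f g : L2) : inner ℂ f g = cc f g 1 := by
  rw [L2.inner_def]
  unfold cc
  simp [RCLike.inner_apply, mul_comm]

lemma cc_add_smul (f g h : L2) (a : ℂ) {u : ℝ} (hu : u ≠ 0) :
    cc f (g + a • h) u = cc f g u + a * cc f h u := by
  unfold cc
  rw [← integral_const_mul, ← integral_add (cc_integrable f g hu) ((cc_integrable f h hu).const_mul a)]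
  apply integral_congr_ae
  filter_upwards [ae_comp_mul hu (Lp.coeFn_add g (a • h)), ae_comp_mul hu (Lp.coeFn_smul a h)]
    with x h1 h2
  rw [h1, Pi.add_apply, h2, Pi.smul_apply, smul_eq_mul]
  ring

lemma QQ_mon {C : L2 →L[ℂ] L2} (hC : IsCesaroOp C) (hCp : ∀ g : Hp, J (Cp g) = C (J g))
    (hNp : IsStarNormal Cp)
    (hσp : spectrum ℂ Cp = Metric.sphere (1:ℂ) 1) (m : ℕ) : QQ J Cp (mon m) := by
  have hci : ContinuousOn (fun w : ℂ => (1 + m * w)⁻¹) (Metric.sphere (1:ℂ) 1) := by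
    apply ContinuousOn.inv₀
    · fun_prop
    · intro w hw; exact sph_ne hw m
  refine ⟨mon_KI m, ?_, fun f g => ?_⟩
  · exact (continuousOn_id.mul hci).congr fun w hw => GK_mon m hw
  · set S := cfc (fun w : ℂ => (1 + m * w)⁻¹) Cp with hS
    have h1 : cfc (GK (mon m)) Cp = Cp * S := by
      conv_rhs => rw [← cfc_id' ℂ Cp]
      rw [hS, ← cfc_mul (a := Cp) (fun w : ℂ => w) _ (by fun_prop) (by rw [hσp]; exact hci)]
      apply cfc_congr
      rw [hσp]
      intro w hw
      exact GK_mon m hw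
    have h2 : S + (m:ℂ) • (Cp * S) = 1 := by
      have hG : ContinuousOn (GK (mon m)) (spectrum ℂ Cp) := by
        rw [hσp]
        exact (continuousOn_id.mul hci).congr fun w hw => GK_mon m hw
      rw [← h1, hS, ← cfc_smul (a := Cp) (m:ℂ) (GK (mon m)) hG,
        ← cfc_add (a := Cp) (fun w : ℂ => (1 + m * w)⁻¹) (fun w => (m:ℂ) • GK (mon m) w)
          (by rw [hσp]; exact hci) (by fun_prop), ← cfc_one ℂ Cp]
      apply cfc_congr
      rw [hσp]
      intro w hw
      have := sph_ne hw m
      simp only [GK_mon m hw, smul_eq_mul, Pi.one_apply]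
      field_simp
    set h := S g with hh
    have hg : g = h + (m:ℂ) • Cp h := by
      have := congrArg (fun T : Hp →L[ℂ] Hp => T g) h2
      simpa using this.symm
    have hA : cfc (GK (mon m)) Cp g = Cp h := by rw [h1]; rfl
    have hJg : J g = J h + (m:ℂ) • C (J h) := by
      conv_lhs => rw [hg]
      rw [map_add, map_smul, hCp]
    rw [hA, ← J.inner_map_map, hCp, inner_cc, cc_C hC _ _ one_pos, hJg]
    have e : ∀ u : ℝ, mon m u * cc (J f) (J h + (m:ℂ) • C (J h)) u = (Set.Ioc (0:ℝ) 1).indicator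
        (fun u => (u:ℂ)^m * cc (J f) (J h) u +
          ((m * u ^ (m-1) : ℝ) : ℂ) * ∫ s in Set.Ioc (0:ℝ) u, cc (J f) (J h) s) u := by
      intro u
      unfold mon
      by_cases hu : u ∈ Set.Ioc (0:ℝ) 1
      · rw [Set.indicator_of_mem hu, Set.indicator_of_mem hu, cc_add_smul _ _ _ _ hu.1.ne',
          cc_C hC _ _ hu.1]
        have hu' : (u:ℂ) ≠ 0 := by exact_mod_cast hu.1.ne'
        rcases m with _ | m
        · simp
        · simp; field_simp; ring
      · rw [Set.indicator_of_notMem hu, Set.indicator_of_notMem hu, zero_mul]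
    simp only [e]
    have hci := cc_intOn (J f) (J h)
    have hpow : IntegrableOn (fun u : ℝ => (u:ℂ)^m * cc (J f) (J h) u) (Set.Ioc 0 1) := by
      refine Integrable.bdd_mul (c := 1) hci
        (by apply Measurable.aestronglyMeasurable; fun_prop) ?_
      filter_upwards [ae_restrict_mem measurableSet_Ioc] with u hu
      rw [norm_pow, norm_real, Real.norm_of_nonneg hu.1.le]
      exact pow_le_one₀ hu.1.le hu.2
    have hsec : IntegrableOn (fun u : ℝ => ((m * u ^ (m-1) : ℝ) : ℂ) *
        ∫ s in Set.Ioc (0:ℝ) u, cc (J f) (J h) s) (Set.Ioc 0 1) := by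
      have hcont : ContinuousOn (fun u : ℝ => ∫ s in Set.Ioc (0:ℝ) u, cc (J f) (J h) s)
          (Set.Icc 0 1) := by
        apply intervalIntegral.continuousOn_primitive
        rw [integrableOn_Icc_iff_integrableOn_Ioc]; exact hci
      have : ContinuousOn (fun u : ℝ => ((m * u ^ (m-1) : ℝ) : ℂ) *
        ∫ s in Set.Ioc (0:ℝ) u, cc (J f) (J h) s) (Set.Icc 0 1) :=
        ContinuousOn.mul (by fun_prop) hcont
      exact (this.integrableOn_Icc).mono_set Set.Ioc_subset_Icc_self
    rw [int_Ioi_ind, integral_add hpow hsec, triangle hci]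
    simp only [sub_mul, one_mul]
    rw [integral_sub hci hpow]
    simp

/-- polynomial kernels -/
def pk (p : Polynomial ℂ) : ℝ → ℂ := (Set.Ioc (0:ℝ) 1).indicator (fun u => p.eval (u:ℂ))

lemma QQ_poly (hσp : spectrum ℂ Cp = Metric.sphere (1:ℂ) 1)
    (h : ∀ m, QQ J Cp (mon m)) (p : Polynomial ℂ) : QQ J Cp (pk p) := by
  induction p using Polynomial.induction_on' with
  | add p q hp hq =>
    convert QQ.add hσp hp hq using 1
    ext u
    simp [pk, Set.indicator]
    split_ifs <;> simp
  | monomial n a =>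
    convert QQ.smul hσp (h n) a using 1
    ext u
    simp [pk, mon, Set.indicator]

lemma QQ_supp (hσp : spectrum ℂ Cp = Metric.sphere (1:ℂ) 1)
    (h : ∀ m, QQ J Cp (mon m)) {K : ℝ → ℂ} (hK : KI K) (hs : ∀ u > 1, K u = 0) : QQ J Cp K := by
  apply QQ.closure hσp hK
  intro ε hε
  have hk := (integrable_indicator_iff measurableSet_Ioi).2 hK
  obtain ⟨g, -, hg1, hg2, hg3⟩ := hk.exists_hasCompactSupport_integral_sub_le (ε := ε / 5) (by positivity)
  have hcon : Continuous (fun u : ℝ => g u * ((u ^ (1/2 : ℝ) : ℝ) : ℂ)) := by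
    apply hg2.mul
    exact continuous_ofReal.comp (Real.continuous_rpow_const (by norm_num))
  obtain ⟨p, hp⟩ := exists_polynomial_near_of_continuousOn 0 1
    (fun u : ℝ => (g u * ((u ^ (1/2 : ℝ) : ℝ) : ℂ)).re) (continuous_re.comp hcon).continuousOn
    (ε/5) (by positivity)
  obtain ⟨q, hq⟩ := exists_polynomial_near_of_continuousOn 0 1
    (fun u : ℝ => (g u * ((u ^ (1/2 : ℝ) : ℝ) : ℂ)).im) (continuous_im.comp hcon).continuousOn
    (ε/5) (by positivity)
  set P : Polynomial ℂ := p.map ofRealHom + Polynomial.C I * q.map ofRealHom with hP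
  have hPe : ∀ u : ℝ, P.eval (u:ℂ) = (p.eval u : ℝ) + I * (q.eval u : ℝ) := by
    intro u
    have e : ∀ r : Polynomial ℝ, (r.map ofRealHom).eval (u:ℂ) = ((r.eval u : ℝ) : ℂ) := by
      intro r
      exact Polynomial.eval_map_apply (f := ofRealHom) (p := r) u
    rw [hP, Polynomial.eval_add, Polynomial.eval_mul, Polynomial.eval_C, e, e]
  have hPd : ∀ u ∈ Set.Icc (0:ℝ) 1, ‖g u * ((u ^ (1/2 : ℝ) : ℝ) : ℂ) - P.eval (u:ℂ)‖ ≤ 2 * ε / 5 := by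
    intro u hu
    have h1 := hp u hu
    have h2 := hq u hu
    refine (norm_le_abs_re_add_abs_im _).trans ?_
    rw [abs_sub_comm] at h1 h2
    rw [hPe]
    simp only [sub_re, add_re, sub_im, add_im, ofReal_re, ofReal_im, I_mul_re, I_mul_im, neg_zero,
      add_zero, zero_add]
    linarith
  refine ⟨pk P, QQ_poly hσp h P, ?_⟩
  have hrp : IntegrableOn (fun u : ℝ => 2 * ε / 5 * u ^ (-(1/2) : ℝ)) (Set.Ioc 0 1) := by
    rw [← intervalIntegrable_iff_integrableOn_Ioc_of_le zero_le_one]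
    exact (intervalIntegral.intervalIntegrable_rpow' (by norm_num)).const_mul _
  have hrpI : ∫ u in Set.Ioc (0:ℝ) 1, 2 * ε / 5 * u ^ (-(1/2) : ℝ) = 4 * ε / 5 := by
    rw [integral_const_mul, ← intervalIntegral.integral_of_le zero_le_one,
      integral_rpow (Or.inl (by norm_num))]
    norm_num; ring
  have hrp' := (integrable_indicator_iff measurableSet_Ioc).2 hrp
  set k := (Set.Ioi (0:ℝ)).indicator (fun u : ℝ => K u * ((u ^ (-(1/2) : ℝ) : ℝ) : ℂ)) with hkdef
  have hsub : Integrable (fun u => ‖k u - g u‖) := (hk.sub hg3).norm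
  calc ∫ u in Set.Ioi (0:ℝ), ‖K u - pk P u‖ * u ^ (-(1/2) : ℝ)
      ≤ ∫ u in Set.Ioi (0:ℝ), (‖k u - g u‖ +
        (Set.Ioc (0:ℝ) 1).indicator (fun u : ℝ => 2 * ε / 5 * u ^ (-(1/2) : ℝ)) u) := by
        apply setIntegral_mono_on (hK.sub (QQ_poly hσp h P).ki).norm
          (hsub.add hrp').integrableOn measurableSet_Ioi
        intro u hu
        have hu : (0:ℝ) < u := hu
        simp only [Pi.add_apply]
        by_cases hu1 : u ≤ 1
        · have hmem : u ∈ Set.Ioc (0:ℝ) 1 := ⟨hu, hu1⟩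
          rw [Set.indicator_of_mem hmem, hkdef, Set.indicator_of_mem (Set.mem_Ioi.2 hu), pk,
            Set.indicator_of_mem hmem]
          have hd := hPd u ⟨hu.le, hu1⟩
          have hn : ∀ a : ℂ, ‖a‖ * u ^ (-(1/2) : ℝ) = ‖a * ((u ^ (-(1/2) : ℝ) : ℝ) : ℂ)‖ := by
            intro a
            rw [norm_mul, norm_real, Real.norm_of_nonneg (by positivity)]
          have hone : ((u ^ (1/2 : ℝ) : ℝ) : ℂ) * ((u ^ (-(1/2) : ℝ) : ℝ) : ℂ) = 1 := by
            rw [← ofReal_mul, ← Real.rpow_add hu]; norm_num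
          calc _ = ‖(K u * ((u ^ (-(1/2) : ℝ) : ℝ) : ℂ) - g u) +
                (g u * ((u ^ (1/2 : ℝ) : ℝ) : ℂ) - P.eval (u:ℂ)) * ((u ^ (-(1/2) : ℝ) : ℝ) : ℂ)‖ := by
                rw [hn]; congr 1
                rw [sub_mul, sub_mul, mul_assoc (g u), hone]; ring
            _ ≤ _ := by
                refine (norm_add_le _ _).trans ?_
                rw [← hn]
                gcongr
        · rw [hs u (not_le.1 hu1), pk, Set.indicator_of_notMem (by simp; intro; linarith)]
          rw [sub_zero, norm_zero, zero_mul]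
          have : 0 ≤ (Set.Ioc (0:ℝ) 1).indicator (fun u : ℝ => 2 * ε / 5 * u ^ (-(1/2) : ℝ)) u :=
            Set.indicator_nonneg (fun v hv => by have := hv.1; positivity) _
          exact add_nonneg (norm_nonneg _) this
    _ ≤ ∫ u : ℝ, (‖k u - g u‖ +
        (Set.Ioc (0:ℝ) 1).indicator (fun u : ℝ => 2 * ε / 5 * u ^ (-(1/2) : ℝ)) u) := by
        apply setIntegral_le_integral (hsub.add hrp')
        refine Eventually.of_forall fun u => ?_
        have : 0 ≤ (Set.Ioc (0:ℝ) 1).indicator (fun u : ℝ => 2 * ε / 5 * u ^ (-(1/2) : ℝ)) u :=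
            Set.indicator_nonneg (fun v hv => by have := hv.1; positivity) _
        exact add_nonneg (norm_nonneg _) this
    _ ≤ ε / 5 + 4 * ε / 5 := by
        rw [integral_add hsub hrp', integral_indicator measurableSet_Ioc, hrpI]
        gcongr
    _ = ε := by ring

lemma QQ_all (hσp : spectrum ℂ Cp = Metric.sphere (1:ℂ) 1)
    (h : ∀ m, QQ J Cp (mon m)) {K : ℝ → ℂ} (hK : KI K) : QQ J Cp K := by
  have hind : ∀ s : Set ℝ, MeasurableSet s → KI (s.indicator K) := by
    intro s hs
    refine (Integrable.indicator hK hs).congr (Eventually.of_forall fun u => ?_)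
    simp [Set.indicator]
  have h1 : QQ J Cp ((Set.Iic 1).indicator K) := by
    apply QQ_supp hσp h (hind _ measurableSet_Iic)
    intro u hu
    apply Set.indicator_of_notMem
    simpa using hu
  have h2 : QQ J Cp (ks ((Set.Ioi 1).indicator K)) := by
    apply QQ_supp hσp h (hind _ measurableSet_Ioi).ks
    intro u hu
    unfold ks
    rw [Set.indicator_of_notMem]
    · simp
    · have : u⁻¹ ≤ 1 := inv_le_one_of_one_le₀ (le_of_lt hu)
      simpa using this
  refine (h1.add hσp (h2.ks hσp)).congr ?_
  filter_upwards [ae_restrict_mem measurableSet_Ioi] with u hu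
  rw [ks_ks _ hu]
  by_cases h : u ≤ 1
  · simp [Set.indicator, h, not_lt.2 h]
  · simp [Set.indicator, h, not_le.1 h]


lemma GK_eq_F {F : ℂ → ℂ} {K : ℝ → ℂ} (hFc : ContinuousOn F (Metric.sphere (1:ℂ) 1))
    (hGc : ContinuousOn (GK K) (Metric.sphere (1:ℂ) 1))
    (hM : ∀ z : ℂ, z.re = 1/2 → mellin K z = F z⁻¹) :
    F 0 = 0 ∧ ∀ w ∈ Metric.sphere (1:ℂ) 1, F w = GK K w := by
  have hne : ∀ w ∈ Metric.sphere (1:ℂ) 1, w ≠ 0 → F w = GK K w := by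
    intro w hw h0
    unfold GK
    rw [if_neg h0, hM _ (sph_inv_re hw h0), inv_inv]
  have hF0 : F 0 = 0 := by
    let z : ℕ → ℂ := fun n => 1/2 + n * I
    have hz : ∀ n, (z n).re = 1/2 := by intro n; simp [z]
    have hmem0 : (0:ℂ) ∈ Metric.sphere (1:ℂ) 1 := by simp
    have hlim : Tendsto (fun n => (z n)⁻¹) atTop (nhds 0) := by
      rw [tendsto_zero_iff_norm_tendsto_zero]
      refine squeeze_zero' (g := fun n : ℕ => ((n:ℝ))⁻¹) (Eventually.of_forall fun n => norm_nonneg _) ?_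
        tendsto_inv_atTop_nhds_zero_nat
      filter_upwards [eventually_gt_atTop 0] with n hn
      rw [norm_inv]
      have : (n:ℝ) ≤ ‖z n‖ := by
        have := abs_im_le_norm (z n)
        simpa [z] using this
      have hn' : (0:ℝ) < n := by exact_mod_cast hn
      gcongr
    have hlim' : Tendsto (fun n => (z n)⁻¹) atTop (nhdsWithin 0 (Metric.sphere (1:ℂ) 1)) :=
      tendsto_nhdsWithin_iff.2 ⟨hlim, Eventually.of_forall fun n => (inv_mem_sph (hz n)).1⟩
    have h1 : Tendsto (fun n => F ((z n)⁻¹)) atTop (nhds (F 0)) := (hFc 0 hmem0).tendsto.comp hlim'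
    have h2 : Tendsto (fun n => GK K ((z n)⁻¹)) atTop (nhds (GK K 0)) :=
      (hGc 0 hmem0).tendsto.comp hlim'
    have h3 : (fun n => F ((z n)⁻¹)) = fun n => GK K ((z n)⁻¹) := by
      ext n
      exact hne _ (inv_mem_sph (hz n)).1 (inv_ne_zero (inv_mem_sph (hz n)).2)
    rw [h3] at h1
    rw [tendsto_nhds_unique h1 h2]
    simp [GK]
  refine ⟨hF0, fun w hw => ?_⟩
  by_cases h0 : w = 0
  · rw [h0, hF0]; simp [GK]
  · exact hne w hw h0

lemma ae_formula (hJ : ∀ f : L2, (∃ g : Hp, J g = f) ↔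
      ∀ᵐ x : ℝ ∂MeasureTheory.volume, x < 0 → f x = 0)
    {K : ℝ → ℂ} (hneg : ∀ᵐ u : ℝ ∂MeasureTheory.volume, u < 0 → K u = 0)
    (hK : KI K) {T : Hp →L[ℂ] Hp}
    (hT : ∀ f g : Hp, inner ℂ f (T g) = ∫ u in Set.Ioi (0:ℝ), K u * cc (J f) (J g) u) (g : Hp) :
    ∀ᵐ x : ℝ ∂MeasureTheory.volume, (J (T g)) x = ∫ u : ℝ, K u * (J g) (u * x) := by
  have hred : ∀ x : ℝ, ∫ u : ℝ, K u * (J g) (u * x) = ∫ u in Set.Ioi (0:ℝ), K u * (J g) (u * x) := by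
    intro x
    symm
    apply setIntegral_eq_integral_of_ae_compl_eq_zero
    filter_upwards [hneg, Measure.ae_ne volume (0:ℝ)] with u hu hu0 hu1
    have : u < 0 := lt_of_le_of_ne (by simpa using hu1) hu0
    rw [hu this, zero_mul]
  simp only [hred]
  have hpos : ∀ᵐ x ∂(volume.restrict (Set.Ioi (0:ℝ))),
      (J (T g)) x = ∫ u in Set.Ioi (0:ℝ), K u * (J g) (u * x) := by
    -- test functions
    have key : ∀ s : Set ℝ, MeasurableSet s → volume.restrict (Set.Ioi (0:ℝ)) s < ⊤ →
        ∃ f : Hp, (J f : ℝ → ℂ) =ᵐ[volume] (s ∩ Set.Ioi 0).indicator (fun _ => (1:ℂ)) := by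
      intro s hs hfin
      rw [Measure.restrict_apply hs] at hfin
      have hms := hs.inter (measurableSet_Ioi (a := (0:ℝ)))
      obtain ⟨f, hf⟩ := (hJ (indicatorConstLp 2 hms hfin.ne (1:ℂ))).2 (by
        filter_upwards [indicatorConstLp_coeFn (p := 2) (hs := hms) (hμs := hfin.ne) (c := (1:ℂ))] with x hx hx0
        rw [hx]
        apply Set.indicator_of_notMem
        simp only [Set.mem_inter_iff, Set.mem_Ioi, not_and, not_lt]
        intro _; exact hx0.le)
      exact ⟨f, by rw [hf]; exact indicatorConstLp_coeFn⟩
    have conv : ∀ (s : Set ℝ) (f : Hp), 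
        ((J f : ℝ → ℂ) =ᵐ[volume] (s ∩ Set.Ioi 0).indicator (fun _ => (1:ℂ))) → ∀ φ : ℝ → ℂ,
        (fun x => starRingEnd ℂ (J f x) * φ x) =ᵐ[volume] (s ∩ Set.Ioi 0).indicator φ := by
      intro s f hf φ
      filter_upwards [hf] with x hx
      rw [hx]
      by_cases h : x ∈ s ∩ Set.Ioi 0
      · simp only [Set.indicator_of_mem h, map_one, one_mul]
      · simp only [Set.indicator_of_notMem h, map_zero, zero_mul]
    apply ae_eq_of_forall_setIntegral_eq_of_sigmaFinite
    · intro s hs hfin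
      obtain ⟨f, hf⟩ := key s hs hfin
      have h1 := cc_integrable (J f) (J (T g)) one_ne_zero
      simp only [one_mul] at h1
      have h2 := h1.congr (conv s f hf _)
      rw [IntegrableOn, Measure.restrict_restrict hs]
      exact (integrable_indicator_iff (hs.inter measurableSet_Ioi)).1 h2
    · intro s hs hfin
      obtain ⟨f, hf⟩ := key s hs hfin
      have h2 := (fub_int_left hK (J f) (J g)).congr (conv s f hf _)
      rw [IntegrableOn, Measure.restrict_restrict hs]
      exact (integrable_indicator_iff (hs.inter measurableSet_Ioi)).1 h2
    · intro s hs hfin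
      obtain ⟨f, hf⟩ := key s hs hfin
      have h := hT f g
      rw [← fub_eq hK, ← J.inner_map_map, inner_cc] at h
      unfold cc at h
      simp only [one_mul] at h
      rw [integral_congr_ae (conv s f hf _), integral_congr_ae (conv s f hf _),
        integral_indicator (hs.inter measurableSet_Ioi),
        integral_indicator (hs.inter measurableSet_Ioi)] at h
      rw [Measure.restrict_restrict hs]
      exact h
  rw [ae_restrict_iff' measurableSet_Ioi] at hpos
  have hg0 := (hJ (J g)).1 ⟨g, rfl⟩
  filter_upwards [hpos, (hJ (J (T g))).1 ⟨_, rfl⟩, Measure.ae_ne volume (0:ℝ)] with x h1 h2 h3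
  rcases lt_or_gt_of_ne h3 with hx | hx
  · rw [h2 hx]
    symm
    apply setIntegral_eq_zero_of_ae_eq_zero
    filter_upwards [ae_comp_mul hx.ne hg0] with u hu hu0
    rw [mul_comm u x, hu (mul_neg_of_neg_of_pos hx hu0), mul_zero]
  · exact h1 hx

end Hpart


/-- superposition of power kernels -/
def kS (S : Set ℝ) (a c : ℝ → ℂ) : ℝ → ℂ :=
  S.indicator (fun u => ∫ θ in Set.Ioc 0 (2 * Real.pi), a θ * (u:ℂ) ^ (c θ))

lemma kS_meas {S : Set ℝ} (hS : MeasurableSet S) {a c : ℝ → ℂ} (ha : Continuous a)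
    (hc : Continuous c) : Measurable (kS S a c) := by
  apply Measurable.indicator _ hS
  apply StronglyMeasurable.measurable
  apply StronglyMeasurable.integral_prod_right (f := fun (u θ : ℝ) => a θ * (u:ℂ) ^ (c θ))
  apply Measurable.stronglyMeasurable
  have h1 := ha.measurable
  have h2 := hc.measurable
  simp only [Function.uncurry_def]
  fun_prop

lemma kS_main {S : Set ℝ} (hS : MeasurableSet S) (hS0 : S ⊆ Set.Ioi 0) {a c : ℝ → ℂ} (ha : Continuous a)
    (hc : Continuous c) {b : ℝ} (hb : ∀ θ, ∀ u ∈ S, u ^ (c θ).re ≤ u ^ b)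
    (hi : IntegrableOn (fun u : ℝ => u ^ (b - 1/2)) S) :
    KI (kS S a c) ∧ ∀ z : ℂ, z.re = 1/2 → mellin (kS S a c) z =
      ∫ θ in (0)..(2 * Real.pi), a θ * ∫ u in S, (u:ℂ) ^ (z - 1 + c θ) := by
  obtain ⟨A, hA⟩ := (isCompact_Icc (a := (0:ℝ)) (b := 2 * Real.pi)).exists_bound_of_continuousOn
    ha.continuousOn
  have hA0 : 0 ≤ A := (norm_nonneg _).trans (hA 0 ⟨le_rfl, by positivity⟩)
  have hφ : ∀ u ∈ S, ∀ θ ∈ Set.Ioc 0 (2 * Real.pi), ‖a θ * (u:ℂ) ^ (c θ)‖ ≤ A * u ^ b := by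
    intro u hu θ hθ
    rw [norm_mul, norm_cpow_eq_rpow_re_of_pos (hS0 hu)]
    have hu0 : (0:ℝ) < u := hS0 hu
    exact mul_le_mul (hA θ ⟨hθ.1.le, hθ.2⟩) (hb θ u hu) (by positivity) hA0
  constructor
  · apply KI.of_norm (kS_meas hS ha hc).aestronglyMeasurable
    have h1 := (integrable_indicator_iff hS).2 (hi.const_mul (A * (2 * Real.pi)))
    refine Integrable.mono' (h1.mono_measure Measure.restrict_le_self) ?_ ?_
    · apply Measurable.aestronglyMeasurable
      have := kS_meas hS ha hc
      fun_prop
    · filter_upwards [ae_restrict_mem measurableSet_Ioi] with u hu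
      have hu : (0:ℝ) < u := hu
      rw [Real.norm_of_nonneg (by positivity)]
      by_cases huS : u ∈ S
      · rw [Set.indicator_of_mem huS, kS, Set.indicator_of_mem huS]
        have h2 : ‖∫ θ in Set.Ioc 0 (2 * Real.pi), a θ * (u:ℂ) ^ (c θ)‖ ≤ A * u ^ b * (2 * Real.pi) := by
          refine (norm_setIntegral_le_of_norm_le_const (C := A * u ^ b) measure_Ioc_lt_top (hφ u huS)).trans ?_
          rw [Real.volume_real_Ioc_of_le (by positivity), sub_zero]
        calc _ ≤ A * u ^ b * (2 * Real.pi) * u ^ (-(1/2) : ℝ) := by gcongr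
          _ = A * (2 * Real.pi) * (u ^ b * u ^ (-(1/2) : ℝ)) := by ring
          _ = _ := by rw [← Real.rpow_add hu]; rfl
      · rw [Set.indicator_of_notMem huS, kS, Set.indicator_of_notMem huS, norm_zero, zero_mul]
  · intro z hz
    have hInt0 : Integrable (fun p : ℝ × ℝ => a p.2 * (p.1:ℂ) ^ (z - 1 + c p.2))
        ((volume.restrict S).prod (volume.restrict (Set.Ioc 0 (2 * Real.pi)))) := by
      refine Integrable.mono' ((hi.const_mul A).comp_fst (volume.restrict (Set.Ioc 0 (2 * Real.pi)))) ?_ ?_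
      · apply Measurable.aestronglyMeasurable
        have h1 := ha.measurable
        have h2 := hc.measurable
        fun_prop
      · rw [Measure.prod_restrict]
        filter_upwards [ae_restrict_mem (hS.prod measurableSet_Ioc)] with p hp
        have hu : (0:ℝ) < p.1 := hS0 hp.1
        have hu' : (p.1:ℂ) ≠ 0 := by exact_mod_cast hu.ne'
        have h3 := hφ p.1 hp.1 p.2 hp.2
        rw [cpow_add _ _ hu']
        calc _ = ‖a p.2 * (p.1:ℂ) ^ (c p.2)‖ * ‖(p.1:ℂ) ^ (z - 1)‖ := by
              rw [← norm_mul]; congr 1; ring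
          _ ≤ A * p.1 ^ b * p.1 ^ (-(1/2) : ℝ) := by
              rw [norm_cpow_eq_rpow_re_of_pos hu (z - 1), sub_re, hz]
              norm_num at h3 ⊢
              gcongr
          _ = _ := by rw [mul_assoc, ← Real.rpow_add hu]; rfl
    have hsw := integral_integral_swap (f := fun (u θ : ℝ) => a θ * (u:ℂ) ^ (z - 1 + c θ)) hInt0
    rw [intervalIntegral.integral_of_le (by positivity)]
    simp only [integral_const_mul] at hsw
    rw [← hsw]
    unfold mellin kS
    have e : ∀ u : ℝ, (u:ℂ) ^ (z - 1) • S.indicator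
        (fun u => ∫ θ in Set.Ioc 0 (2 * Real.pi), a θ * (u:ℂ) ^ (c θ)) u = S.indicator
        (fun u : ℝ => (u:ℂ) ^ (z - 1) * ∫ θ in Set.Ioc 0 (2 * Real.pi), a θ * (u:ℂ) ^ (c θ)) u := by
      intro u; simp [Set.indicator]
    simp only [e]
    rw [setIntegral_indicator hS, Set.inter_eq_right.2 hS0]
    apply setIntegral_congr_fun hS
    intro u hu
    have hu : (0:ℝ) < u := hS0 hu
    have hu' : (u:ℂ) ≠ 0 := by exact_mod_cast hu.ne'
    simp only
    rw [← integral_const_mul]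
    congr 1; ext θ
    rw [cpow_add _ _ hu']; ring

lemma annulus {U : Set ℂ} (hU : IsOpen U) (hsub : Metric.sphere (1:ℂ) 1 ⊆ U) :
    ∃ δ : ℝ, 0 < δ ∧ δ < 1 ∧ Metric.closedBall (1:ℂ) (1 + δ) \ Metric.ball 1 (1 - δ) ⊆ U := by
  obtain ⟨δ, hδ, hs⟩ := (isCompact_sphere (1:ℂ) 1).exists_cthickening_subset_open hU hsub
  refine ⟨min δ (1/2), by positivity, lt_of_le_of_lt (min_le_right _ _) (by norm_num), ?_⟩
  intro l hl
  have h1 : ‖l - 1‖ ≤ 1 + min δ (1/2) := by simpa [dist_eq_norm] using hl.1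
  have h2 : 1 - min δ (1/2) ≤ ‖l - 1‖ := by simpa [dist_eq_norm] using hl.2
  have h3 : min δ (1/2) ≤ 1/2 := min_le_right _ _
  have h4 : min δ (1/2) ≤ δ := min_le_left _ _
  have h5 : 0 < ‖l - 1‖ := by linarith
  have h5' : (‖l - 1‖ : ℂ) ≠ 0 := by exact_mod_cast h5.ne'
  apply hs
  apply Metric.mem_cthickening_of_dist_le l (1 + (l - 1) / ‖l - 1‖)
  · simp [h5.ne']
  · rw [dist_eq_norm]
    have : l - (1 + (l - 1) / ‖l - 1‖) = (l - 1) / ‖l - 1‖ * ((‖l - 1‖ - 1 : ℝ) : ℂ) := by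
      push_cast
      field_simp
      ring
    rw [this, norm_mul, norm_div, norm_real, norm_norm, div_self h5.ne', one_mul, norm_real,
      Real.norm_eq_abs, abs_le]
    constructor <;> linarith

lemma cauchy_annulus {F : ℂ → ℂ} {U : Set ℂ} (hU : IsOpen U) (hF : DifferentiableOn ℂ F U) {δ : ℝ}
    (h0 : 0 < δ) (h1 : δ < 1)
    (hA : Metric.closedBall (1:ℂ) (1 + δ) \ Metric.ball 1 (1 - δ) ⊆ U)
    {w : ℂ} (hw : w ∈ Metric.sphere (1:ℂ) 1) :
    (∮ l in C(1, 1 + δ), F l * (l - w)⁻¹) - (∮ l in C(1, 1 - δ), F l * (l - w)⁻¹)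
      = 2 * Real.pi * I * F w := by
  have hwn : ‖w - 1‖ = 1 := by simpa [dist_eq_norm] using hw
  have hwA : Metric.closedBall (1:ℂ) (1 + δ) \ Metric.ball 1 (1 - δ) ∈ nhds w := by
    have : Metric.ball (1:ℂ) (1 + δ) \ Metric.closedBall 1 (1 - δ) ∈ nhds w := by
      apply (Metric.isOpen_ball.sdiff Metric.isClosed_closedBall).mem_nhds
      simp [dist_eq_norm, hwn, h0]
    exact mem_of_superset this (Set.sdiff_subset_sdiff Metric.ball_subset_closedBall Metric.ball_subset_closedBall)
  have hd : ∀ l ∈ U, DifferentiableAt ℂ F l := fun l hl => hF.differentiableAt (hU.mem_nhds hl)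
  have hwU : w ∈ U := hA (mem_of_mem_nhds hwA)
  have key := Complex.circleIntegral_eq_of_differentiable_on_annulus_off_countable
    (c := 1) (r := 1 - δ) (R := 1 + δ) (by linarith) (by linarith) (f := dslope F w) (s := {w})
    (Set.countable_singleton w)
    ((continuousOn_dslope hwA).2 ⟨hF.continuousOn.mono hA, hd w hwU⟩)
    (by
      rintro l ⟨hl, hne⟩
      rw [differentiableAt_dslope_of_ne (by simpa using hne)]
      exact hd l (hA ⟨Metric.ball_subset_closedBall hl.1,
        fun h => hl.2 (Metric.ball_subset_closedBall h)⟩))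
  have exp : ∀ ρ : ℝ, 0 < ρ → ρ ≠ 1 → 1 - δ ≤ ρ → ρ ≤ 1 + δ → (∮ l in C(1, ρ), dslope F w l) =
      (∮ l in C(1, ρ), F l * (l - w)⁻¹) - F w * ∮ l in C(1, ρ), (l - w)⁻¹ := by
    intro ρ hρ hρ1 ha hb
    have hne : ∀ l ∈ Metric.sphere (1:ℂ) ρ, l - w ≠ 0 := by
      intro l hl h
      rw [sub_eq_zero] at h
      rw [h] at hl
      exact hρ1 (by rw [← hwn]; simpa [dist_eq_norm] using hl.symm)
    have hinv : ContinuousOn (fun l : ℂ => (l - w)⁻¹) (Metric.sphere (1:ℂ) ρ) :=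
      ContinuousOn.inv₀ (by fun_prop) hne
    have hFs : ContinuousOn F (Metric.sphere (1:ℂ) ρ) := by
      apply hF.continuousOn.mono
      intro l hl
      have hl' : dist l 1 = ρ := hl
      apply hA
      simp [hl', ha, hb]
    rw [← smul_eq_mul (F w), ← circleIntegral.integral_smul, ← circleIntegral.integral_sub]
    · apply circleIntegral.integral_congr hρ.le
      intro l hl
      have := hne l hl
      simp only
      rw [dslope_of_ne _ (by simpa [sub_eq_zero] using this), slope_def_field, smul_eq_mul]
      field_simp
    · exact (hFs.mul hinv).circleIntegrable hρ.le
    · exact (hinv.const_smul (F w)).circleIntegrable hρ.le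
  rw [exp _ (by linarith) (by linarith) (by linarith) le_rfl,
    exp _ (by linarith) (by linarith) le_rfl (by linarith),
    circleIntegral.integral_sub_inv_of_mem_ball (by simp [dist_eq_norm, hwn, h0])] at key
  have hz : (∮ l in C(1, 1 - δ), (l - w)⁻¹) = 0 := by
    apply Complex.circleIntegral_eq_zero_of_differentiable_on_off_countable (by linarith)
      Set.countable_empty
    · apply ContinuousOn.inv₀ (by fun_prop)
      intro l hl h
      rw [sub_eq_zero] at h
      rw [h] at hl
      simp [dist_eq_norm, hwn] at hl
      linarith
    · rintro l ⟨hl, -⟩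
      apply DifferentiableAt.inv (by fun_prop)
      intro h
      rw [sub_eq_zero] at h
      rw [h] at hl
      simp [dist_eq_norm, hwn] at hl
      linarith
  rw [hz] at key
  linear_combination key


lemma kS_zero {S : Set ℝ} (hS0 : S ⊆ Set.Ioi 0) (a c : ℝ → ℂ) {u : ℝ} (hu : u < 0) : kS S a c u = 0 := by
  apply Set.indicator_of_notMem
  intro h
  exact absurd (hS0 h) (by simpa using hu.le)

lemma circ_re {l : ℂ} {ρ : ℝ} (hl : ‖l - 1‖ = ρ) :
    normSq l = ρ ^ 2 - 1 + 2 * l.re ∧ l.re ≤ ρ + 1 := by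
  constructor
  · have : normSq (l - 1) = ρ ^ 2 := by rw [normSq_eq_norm_sq, hl]
    rw [normSq_apply] at this ⊢
    simp at this
    linarith
  · have := (abs_le.1 (abs_re_le_norm (l - 1))).2
    rw [hl] at this
    simp at this
    linarith

lemma exists_K {F : ℂ → ℂ} {U : Set ℂ} (hU : IsOpen U)
    (hsub : Metric.sphere (1:ℂ) 1 ⊆ U) (hF : DifferentiableOn ℂ F U) (hF0 : F 0 = 0) :
    ∃ K : ℝ → ℂ, Measurable K ∧ (∀ u < 0, K u = 0) ∧ KI K ∧
      ∀ z : ℂ, z.re = 1/2 → mellin K z = F z⁻¹ := by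
  obtain ⟨δ, h0, h1, hA⟩ := annulus hU hsub
  let cf : ℝ → ℝ → ℂ := fun ρ θ => -(circleMap 1 ρ θ)⁻¹
  let af : ℝ → ℝ → ℂ := fun ρ θ => deriv (circleMap 1 ρ) θ *
    (F (circleMap 1 ρ θ) * ((circleMap 1 ρ θ)⁻¹) ^ 2)
  have hmem : ∀ ρ : ℝ, 0 < ρ → ∀ θ, ‖circleMap 1 ρ θ - 1‖ = ρ := by
    intro ρ hρ θ
    simp [abs_of_pos hρ]
  have hne : ∀ ρ : ℝ, 0 < ρ → ρ ≠ 1 → ∀ θ, circleMap 1 ρ θ ≠ 0 := by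
    intro ρ hρ hρ1 θ h
    have := hmem ρ hρ θ
    rw [h] at this
    simp at this
    exact hρ1 this.symm
  have hcc : ∀ ρ : ℝ, 0 < ρ → ρ ≠ 1 → Continuous (cf ρ) := by
    intro ρ hρ hρ1
    exact ((continuous_circleMap 1 ρ).inv₀ (hne ρ hρ hρ1)).neg
  have hac : ∀ ρ : ℝ, 0 < ρ → ρ ≠ 1 → 1 - δ ≤ ρ → ρ ≤ 1 + δ → Continuous (af ρ) := by
    intro ρ hρ hρ1 ha hb
    apply Continuous.mul
    · have hd : deriv (circleMap 1 ρ) = fun θ => circleMap 0 ρ θ * I := by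
        ext θ
        simp [deriv_circleMap]
      rw [hd]
      exact (continuous_circleMap 0 ρ).mul continuous_const
    · apply Continuous.mul
      · apply hF.continuousOn.comp_continuous (continuous_circleMap 1 ρ)
        intro θ
        apply hA
        have := hmem ρ hρ θ
        rw [← dist_eq_norm] at this
        simp only [Set.mem_sdiff, Metric.mem_closedBall, Metric.mem_ball, not_lt, this]
        exact ⟨hb, ha⟩
      · exact ((continuous_circleMap 1 ρ).inv₀ (hne ρ hρ hρ1)).pow 2
  have hR0 : 0 < 1 + δ := by linarith
  have hr0 : 0 < 1 - δ := by linarith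
  have hR1 : 1 + δ ≠ 1 := by linarith
  have hr1 : 1 - δ ≠ 1 := by linarith
  have haR := hac (1+δ) hR0 hR1 (by linarith) le_rfl
  have har := hac (1-δ) hr0 hr1 le_rfl (by linarith)
  have hcR := hcc (1+δ) hR0 hR1
  have hcr := hcc (1-δ) hr0 hr1
  -- real parts
  have hreR : ∀ θ, -(1/(2 + δ)) ≤ (cf (1+δ) θ).re := by
    intro θ
    obtain ⟨e1, e2⟩ := circ_re (hmem (1+δ) hR0 θ)
    have hpos : 0 < normSq (circleMap 1 (1+δ) θ) := normSq_pos.2 (hne _ hR0 hR1 θ)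
    simp only [cf, neg_re, inv_re]
    rw [neg_le_neg_iff, div_le_div_iff₀ hpos (by linarith), e1]
    nlinarith
  have hrer : ∀ θ, (cf (1-δ) θ).re ≤ -(1/(2 - δ)) := by
    intro θ
    obtain ⟨e1, e2⟩ := circ_re (hmem (1-δ) hr0 θ)
    have hpos : 0 < normSq (circleMap 1 (1-δ) θ) := normSq_pos.2 (hne _ hr0 hr1 θ)
    simp only [cf, neg_re, inv_re]
    rw [neg_le_neg_iff, div_le_div_iff₀ (by linarith) hpos, e1]
    nlinarith
  have hbR : 1/(2 + δ) < 1/2 := by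
    apply one_div_lt_one_div_of_lt <;> linarith
  have hbr : 1/2 < 1/(2 - δ) := by
    apply one_div_lt_one_div_of_lt <;> linarith
  have hSR : Set.Ioc (0:ℝ) 1 ⊆ Set.Ioi 0 := fun u hu => hu.1
  have hSr : Set.Ioi (1:ℝ) ⊆ Set.Ioi 0 := fun u hu => Set.mem_Ioi.2 (lt_trans one_pos (Set.mem_Ioi.1 hu))
  obtain ⟨kiR, mR⟩ := kS_main measurableSet_Ioc hSR haR hcR (b := -(1/(2 + δ)))
    (fun θ u hu => Real.rpow_le_rpow_of_exponent_ge hu.1 hu.2 (hreR θ)) (by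
      rw [← intervalIntegrable_iff_integrableOn_Ioc_of_le zero_le_one]
      exact intervalIntegral.intervalIntegrable_rpow' (by linarith))
  obtain ⟨kir, mr⟩ := kS_main measurableSet_Ioi hSr har hcr (b := -(1/(2 - δ)))
    (fun θ u hu => Real.rpow_le_rpow_of_exponent_le (le_of_lt hu) (hrer θ))
    (integrableOn_Ioi_rpow_of_lt (by linarith) one_pos)
  refine ⟨fun u => (2 * Real.pi * I)⁻¹ * (kS (Set.Ioc 0 1) (af (1+δ)) (cf (1+δ)) u +
    kS (Set.Ioi 1) (af (1-δ)) (cf (1-δ)) u), ?_, ?_, (kiR.add kir).smul _, ?_⟩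
  · exact ((kS_meas measurableSet_Ioc haR hcR).add (kS_meas measurableSet_Ioi har hcr)).const_mul _
  · intro u hu
    simp [kS_zero hSR _ _ hu, kS_zero hSr _ _ hu]
  · intro z hz
    have hz0 := (inv_mem_sph hz).2
    have e1 : mellin (fun u => (2 * Real.pi * I)⁻¹ * (kS (Set.Ioc 0 1) (af (1+δ)) (cf (1+δ)) u +
        kS (Set.Ioi 1) (af (1-δ)) (cf (1-δ)) u)) z = (2 * Real.pi * I)⁻¹ *
        (mellin (kS (Set.Ioc 0 1) (af (1+δ)) (cf (1+δ))) z +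
          mellin (kS (Set.Ioi 1) (af (1-δ)) (cf (1-δ))) z) := by
      rw [← (hasMellin_add (kiR.mellinConv hz) (kir.mellinConv hz)).2]
      exact mellin_const_smul (fun u => kS (Set.Ioc 0 1) (af (1+δ)) (cf (1+δ)) u +
        kS (Set.Ioi 1) (af (1-δ)) (cf (1-δ)) u) z ((2 * Real.pi * I)⁻¹ : ℂ)
    rw [e1, mR z hz, mr z hz]
    have iR : ∀ θ, ∫ u in Set.Ioc (0:ℝ) 1, (u:ℂ) ^ (z - 1 + cf (1+δ) θ) =
        (z - (circleMap 1 (1+δ) θ)⁻¹)⁻¹ := by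
      intro θ
      have hre := hreR θ
      have hs : 0 < (z + cf (1+δ) θ).re := by rw [add_re, hz]; linarith
      rw [← intervalIntegral.integral_of_le zero_le_one, integral_cpow (Or.inl (by
        simp only [add_re, sub_re, one_re] at hs ⊢; linarith))]
      have e : z - 1 + cf (1+δ) θ + 1 = z + cf (1+δ) θ := by ring
      have hs0 : z + cf (1+δ) θ ≠ 0 := by intro h; rw [h] at hs; simp at hs
      rw [e, ofReal_one, ofReal_zero, one_cpow, zero_cpow hs0, sub_zero, one_div]
      simp only [cf, sub_eq_add_neg]
    have ir : ∀ θ, ∫ u in Set.Ioi (1:ℝ), (u:ℂ) ^ (z - 1 + cf (1-δ) θ) =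
        -(z - (circleMap 1 (1-δ) θ)⁻¹)⁻¹ := by
      intro θ
      have hre := hrer θ
      rw [integral_Ioi_cpow_of_lt (by simp only [add_re, sub_re, one_re, hz]; linarith) one_pos]
      have e : z - 1 + cf (1-δ) θ + 1 = z + cf (1-δ) θ := by ring
      rw [e, ofReal_one, one_cpow, neg_div, one_div]
      simp only [cf, sub_eq_add_neg]
    simp only [iR, ir]
    -- Cauchy
    have hw := (inv_mem_sph hz).1
    have c1 := cauchy_annulus hU hF h0 h1 hA hw
    have c2 := cauchy_annulus hU hF h0 h1 hA (w := 0) (by simp)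
    rw [hF0, mul_zero] at c2
    have comb : ∀ ρ : ℝ, 0 < ρ → ρ ≠ 1 → 1 - δ ≤ ρ → ρ ≤ 1 + δ →
        ∫ θ in (0)..(2 * Real.pi), af ρ θ * (z - (circleMap 1 ρ θ)⁻¹)⁻¹ =
        (∮ l in C(1, ρ), F l * (l - z⁻¹)⁻¹) - ∮ l in C(1, ρ), F l * (l - 0)⁻¹ := by
      intro ρ hρ hρ1 ha hb
      have hsn : ∀ w ∈ Metric.sphere (1:ℂ) 1, ∀ l ∈ Metric.sphere (1:ℂ) ρ, l - w ≠ 0 := by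
        intro w hw l hl h
        rw [sub_eq_zero] at h
        rw [h] at hl
        exact hρ1 (by rw [← Metric.mem_sphere.1 hl, Metric.mem_sphere.1 hw])
      have hFs : ContinuousOn F (Metric.sphere (1:ℂ) ρ) := by
        apply hF.continuousOn.mono
        intro l hl
        have hl' : dist l 1 = ρ := hl
        apply hA
        simp [hl', ha, hb]
      have hci : ∀ w ∈ Metric.sphere (1:ℂ) 1, CircleIntegrable (fun l => F l * (l - w)⁻¹) 1 ρ := by
        intro w hw
        exact (hFs.mul (ContinuousOn.inv₀ (by fun_prop) (hsn w hw))).circleIntegrable hρ.le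
      rw [← circleIntegral.integral_sub (hci _ hw) (hci 0 (by simp))]
      unfold circleIntegral
      apply intervalIntegral.integral_congr
      intro θ _
      simp only [af, smul_eq_mul]
      rw [mul_assoc]
      congr 1
      have hl0 := hne ρ hρ hρ1 θ
      have hlw := hsn z⁻¹ hw (circleMap 1 ρ θ) (circleMap_mem_sphere 1 hρ.le θ)
      generalize circleMap 1 ρ θ = l at hl0 hlw
      rw [mul_assoc, ← mul_sub]
      congr 1
      have hzl : z - l⁻¹ = z * l⁻¹ * (l - z⁻¹) := by field_simp
      rw [hzl, sub_zero, mul_inv, mul_inv, inv_inv]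
      have : (l - z⁻¹)⁻¹ - l⁻¹ = z⁻¹ * l⁻¹ * (l - z⁻¹)⁻¹ := by
        rw [inv_sub_inv hlw hl0, div_eq_mul_inv, mul_inv]; ring
      rw [this]
      field_simp
    simp only [mul_neg]
    rw [intervalIntegral.integral_neg, comb _ hR0 hR1 (by linarith) le_rfl,
      comb _ hr0 hr1 le_rfl (by linarith)]
    have hpi : (2 * Real.pi * I : ℂ) ≠ 0 := by
      simp [Real.pi_ne_zero]
    rw [inv_mul_eq_iff_eq_mul₀ hpi, ← c1]
    linear_combination -c2

/-- Let `Hp ≅ L²(ℝ₊)` be the closed subspace of `L²(ℝ)` of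
functions vanishing a.e. on `(-∞, 0)` (realized as a Hilbert space `Hp` with a
linear isometry `J` onto that subspace), and let `C₊` be the restriction of the
Cesàro operator to it. Let `F` be holomorphic in a neighborhood of the circle
`𝕋+1 = σ(C₊)`. If `F 0 = 0`, then there is a kernel `K` with (a) `K = 0` a.e. on
`(-∞,0)`, (b) `K(u) u^{-1/2} ∈ L¹(0,∞)`, (c) `(ℳK)(z) = F(1/z)` on `Re z = 1/2`,
such that `F(C₊) = (ℋ_K)₊`. Conversely, any measurable `K` satisfying (a), (b), (c)
has `F 0 = 0` and `(ℋ_K)₊ = F(C₊)`. Here `F(C₊)` is realized for the normal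
operator `C₊` as `cfc F C₊`. -/
theorem stmt17
    (C : L2 →L[ℂ] L2) (hC : IsCesaroOp C) (hN : IsStarNormal C)
    (hσ : spectrum ℂ C = Metric.sphere (1:ℂ) 1)
    (Hp : Type) [NormedAddCommGroup Hp] [InnerProductSpace ℂ Hp] [CompleteSpace Hp]
    (J : Hp →ₗᵢ[ℂ] L2)
    (hJ : ∀ f : L2, (∃ g : Hp, J g = f) ↔
      ∀ᵐ x : ℝ ∂MeasureTheory.volume, x < 0 → f x = 0)
    (Cp : Hp →L[ℂ] Hp) (hCp : ∀ g : Hp, J (Cp g) = C (J g))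
    (hNp : IsStarNormal Cp)
    (hσp : spectrum ℂ Cp = Metric.sphere (1:ℂ) 1)
    (F : ℂ → ℂ) (U : Set ℂ) (hU : IsOpen U)
    (hsub : Metric.sphere (1:ℂ) 1 ⊆ U)
    (hF : DifferentiableOn ℂ F U) :
    (F 0 = 0 →
      ∃ K : ℝ → ℂ, Measurable K ∧
        (∀ᵐ u : ℝ ∂MeasureTheory.volume, u < 0 → K u = 0) ∧
        MeasureTheory.IntegrableOn (fun u : ℝ => ‖K u‖ * u ^ (-(1/2) : ℝ)) (Set.Ioi 0) ∧
        (∀ z : ℂ, z.re = 1/2 → mellin K z = F z⁻¹) ∧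
        (∀ g : Hp, ∀ᵐ x : ℝ ∂MeasureTheory.volume,
          (J ((cfc F Cp) g)) x = ∫ u : ℝ, K u * (J g) (u * x))) ∧
    (∀ K : ℝ → ℂ, Measurable K →
      (∀ᵐ u : ℝ ∂MeasureTheory.volume, u < 0 → K u = 0) →
      MeasureTheory.IntegrableOn (fun u : ℝ => ‖K u‖ * u ^ (-(1/2) : ℝ)) (Set.Ioi 0) →
      (∀ z : ℂ, z.re = 1/2 → mellin K z = F z⁻¹) →
      (F 0 = 0 ∧
        ∀ g : Hp, ∀ᵐ x : ℝ ∂MeasureTheory.volume,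
          (J ((cfc F Cp) g)) x = ∫ u : ℝ, K u * (J g) (u * x))) := by
  have hFc : ContinuousOn F (Metric.sphere (1:ℂ) 1) := hF.continuousOn.mono hsub
  have hmon : ∀ m, QQ J Cp (mon m) := fun m => QQ_mon hC hCp hNp hσp m
  have main : ∀ K : ℝ → ℂ, KI K → (∀ᵐ u : ℝ ∂volume, u < 0 → K u = 0) →
      (∀ z : ℂ, z.re = 1/2 → mellin K z = F z⁻¹) → (F 0 = 0 ∧ ∀ g : Hp, ∀ᵐ x : ℝ ∂volume,
        (J ((cfc F Cp) g)) x = ∫ u : ℝ, K u * (J g) (u * x)) := by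
    intro K hK hneg hM
    have hQ := QQ_all hσp hmon hK
    obtain ⟨h0, hG⟩ := GK_eq_F hFc hQ.cont hM
    refine ⟨h0, fun g => ?_⟩
    have : cfc F Cp = cfc (GK K) Cp := cfc_congr (by rw [hσp]; exact hG)
    rw [this]
    exact ae_formula hJ hneg hK hQ.eq g
  constructor
  · intro h0
    obtain ⟨K, hm, hn, hk, hM⟩ := exists_K hU hsub hF h0
    have hneg : ∀ᵐ u : ℝ ∂volume, u < 0 → K u = 0 := Eventually.of_forall hn
    exact ⟨K, hm, hneg, hk.norm, hM, (main K hk hneg hM).2⟩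
  · intro K hm hneg hI hM
    exact main K (KI.of_norm hm.aestronglyMeasurable hI) hneg hM
end
end

section
/- For every complex α with Re(α) > 0, the fractional power (𝒞₊)^α of the Cesàro operator 𝒞₊ on L²(ℝ₊) (defined via the functional calculus for normal operators applied to the branch of z^α on the closed right half-plane with 1^α = 1 and 0^α := 0) equals the Hölder operator H_{α+} on L²(ℝ₊), (H_{α+} f)(x) = (1/Γ(α)) ∫₀¹ (log(1/u))^{α−1} f(ux) du. -/
open MeasureTheory Complex Filter

noncomputable section

def wnorm (φ : ℝ → ℂ) : ENNReal :=
  ∫⁻ u in Set.Ioo (0:ℝ) 1, ‖φ u‖ₑ * ENNReal.ofReal (u ^ (-(1/2) : ℝ))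

lemma jensen_sq {α : Type*} [MeasurableSpace α] (ν : Measure α) (w h : α → ENNReal)
    (hw : Measurable w) (hh : Measurable h) :
    (∫⁻ x, w x * h x ∂ν) ^ 2 ≤ (∫⁻ x, w x ∂ν) * ∫⁻ x, w x * h x ^ 2 ∂ν := by
  have key := ENNReal.lintegral_mul_le_Lp_mul_Lq ν (p := 2) (q := 2)
    (by constructor <;> norm_num)
    (f := fun x => w x ^ (1/2 : ℝ)) (g := fun x => w x ^ (1/2 : ℝ) * h x)
    (by fun_prop) (by fun_prop)
  have hsq : ∀ x, w x ^ (1/2 : ℝ) * w x ^ (1/2 : ℝ) = w x := by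
    intro x
    rw [← ENNReal.rpow_add_of_nonneg _ _ (by norm_num) (by norm_num)]; norm_num
  have e1 : ∀ x, ((fun x => w x ^ (1/2 : ℝ)) * (fun x => w x ^ (1/2 : ℝ) * h x)) x = w x * h x := by
    intro x; simp only [Pi.mul_apply]; rw [← mul_assoc, hsq]
  have e2 : ∀ x, (w x ^ (1/2 : ℝ)) ^ (2:ℝ) = w x := by
    intro x; rw [← ENNReal.rpow_mul]; norm_num
  have e3 : ∀ x, (w x ^ (1/2 : ℝ) * h x) ^ (2:ℝ) = w x * h x ^ 2 := by
    intro x; rw [ENNReal.mul_rpow_of_nonneg _ _ (by norm_num), e2]; norm_num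
  simp only [e1, e2, e3] at key
  calc _ ≤ _ := pow_le_pow_left' key 2
    _ = _ := by
      rw [mul_pow, ← ENNReal.rpow_natCast, ← ENNReal.rpow_natCast, ← ENNReal.rpow_mul,
        ← ENNReal.rpow_mul]; norm_num

lemma lint_scale (h : ℝ → ENNReal) (hh : Measurable h) (u : ℝ) (hu : 0 < u) :
    ENNReal.ofReal u * ∫⁻ x, h (u * x) = ∫⁻ x, h x := by
  have := Real.map_volume_mul_left hu.ne'
  rw [← lintegral_map (f := h) (g := fun x => u * x) hh (by fun_prop), this,
    lintegral_smul_measure, smul_eq_mul, ← mul_assoc, ← ENNReal.ofReal_mul hu.le,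
    abs_of_pos (by positivity), mul_inv_cancel₀ hu.ne']; simp

lemma schur (φ f : ℝ → ℂ) (hφ : Measurable φ) (hf : Measurable f) :
    ∫⁻ x, (∫⁻ u in Set.Ioo (0:ℝ) 1, ‖φ u‖ₑ * ‖f (u * x)‖ₑ) ^ 2 ≤
      wnorm φ ^ 2 * ∫⁻ x, ‖f x‖ₑ ^ 2 := by
  have hpt : ∀ x, (∫⁻ u in Set.Ioo (0:ℝ) 1, ‖φ u‖ₑ * ‖f (u * x)‖ₑ) ^ 2 ≤
      wnorm φ * ∫⁻ u in Set.Ioo (0:ℝ) 1, ‖φ u‖ₑ * ENNReal.ofReal (u ^ (-(1/2) : ℝ)) *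
        (ENNReal.ofReal (u ^ ((1/2) : ℝ)) * ‖f (u * x)‖ₑ) ^ 2 := by
    intro x
    refine le_trans (le_of_eq ?_) (jensen_sq _ _ _ (by fun_prop) (by fun_prop))
    · congr 1
      refine setLIntegral_congr_fun measurableSet_Ioo fun u hu => ?_
      rw [mul_assoc, ← mul_assoc (ENNReal.ofReal _), ← ENNReal.ofReal_mul (Real.rpow_nonneg hu.1.le _),
        ← Real.rpow_add hu.1]
      norm_num
  calc _ ≤ _ := lintegral_mono hpt
    _ = wnorm φ * ∫⁻ x, ∫⁻ u in Set.Ioo (0:ℝ) 1, ‖φ u‖ₑ * ENNReal.ofReal (u ^ (-(1/2) : ℝ)) *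
        (ENNReal.ofReal (u ^ ((1/2) : ℝ)) * ‖f (u * x)‖ₑ) ^ 2 := by
      rw [lintegral_const_mul]
      apply Measurable.lintegral_prod_right'
        (f := fun p : ℝ × ℝ => ‖φ p.2‖ₑ * ENNReal.ofReal (p.2 ^ (-(1/2) : ℝ)) *
        (ENNReal.ofReal (p.2 ^ ((1/2) : ℝ)) * ‖f (p.2 * p.1)‖ₑ) ^ 2)
      fun_prop
    _ = wnorm φ * ∫⁻ u in Set.Ioo (0:ℝ) 1, ∫⁻ x, ‖φ u‖ₑ * ENNReal.ofReal (u ^ (-(1/2) : ℝ)) *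
        (ENNReal.ofReal (u ^ ((1/2) : ℝ)) * ‖f (u * x)‖ₑ) ^ 2 := by
      rw [lintegral_lintegral_swap]
      apply Measurable.aemeasurable
      show Measurable (fun p : ℝ × ℝ => ‖φ p.2‖ₑ * ENNReal.ofReal (p.2 ^ (-(1/2) : ℝ)) *
        (ENNReal.ofReal (p.2 ^ ((1/2) : ℝ)) * ‖f (p.2 * p.1)‖ₑ) ^ 2)
      fun_prop
    _ = wnorm φ * ∫⁻ u in Set.Ioo (0:ℝ) 1, ‖φ u‖ₑ * ENNReal.ofReal (u ^ (-(1/2) : ℝ)) *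
        ∫⁻ x, ‖f x‖ₑ ^ 2 := by
      congr 1
      refine setLIntegral_congr_fun measurableSet_Ioo fun u hu => ?_
      rw [lintegral_const_mul _ (by fun_prop)]
      congr 1
      simp_rw [mul_pow]
      rw [lintegral_const_mul _ (by fun_prop), ← ENNReal.ofReal_pow (Real.rpow_nonneg hu.1.le _),
        ← Real.rpow_natCast, ← Real.rpow_mul hu.1.le]
      norm_num
      exact lint_scale (fun x => ‖f x‖ₑ ^ 2) (by fun_prop) u hu.1
    _ = _ := by
      rw [lintegral_mul_const _ (by fun_prop), ← mul_assoc, sq]; rfl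


lemma norm_gker {a r : ℂ} {t : ℝ} (ht : 0 < t) :
    ‖(t:ℂ) ^ (a - 1) * cexp (-(r * t))‖ = t ^ (a.re - 1) * Real.exp (-(r.re) * t) := by
  rw [norm_mul, norm_cpow_eq_rpow_re_of_pos ht, norm_exp]; simp

lemma int_rpow_exp {s b : ℝ} (hs : 0 < s) (hb : 0 < b) :
    IntegrableOn (fun t : ℝ => t ^ (s - 1) * Real.exp (-b * t)) (Set.Ioi 0) := by
  have := integrableOn_rpow_mul_exp_neg_mul_rpow (s := s - 1) (p := 1) (b := b) (by linarith) one_pos hb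
  simpa using this

lemma meas_gker (a r : ℂ) : AEStronglyMeasurable
    (fun t : ℝ => (t:ℂ) ^ (a - 1) * cexp (-(r * t))) (volume.restrict (Set.Ioi 0)) := by
  apply Measurable.aestronglyMeasurable
  fun_prop

lemma int_gker {a r : ℂ} (ha : 0 < a.re) (hr : 0 < r.re) :
    IntegrableOn (fun t : ℝ => (t:ℂ) ^ (a - 1) * cexp (-(r * t))) (Set.Ioi 0) := by
  refine Integrable.mono' (int_rpow_exp ha hr) (meas_gker a r) ?_
  filter_upwards [ae_restrict_mem measurableSet_Ioi] with t ht
  rw [norm_gker ht]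

lemma deriv_gker {a r : ℂ} (ha : 0 < a.re) (hr : 0 < r.re) :
    DifferentiableAt ℂ (fun r : ℂ => ∫ t in Set.Ioi (0:ℝ), (t:ℂ) ^ (a - 1) * cexp (-(r * t))) r := by
  have hs : {w : ℂ | r.re / 2 < w.re} ∈ nhds r :=
    (isOpen_lt continuous_const continuous_re).mem_nhds (by show r.re / 2 < r.re; linarith)
  refine (hasDerivAt_integral_of_dominated_loc_of_deriv_le (μ := volume.restrict (Set.Ioi (0:ℝ)))
    (F := fun (r : ℂ) (t : ℝ) => (t:ℂ) ^ (a - 1) * cexp (-(r * t)))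
    (F' := fun (r : ℂ) (t : ℝ) => (t:ℂ) ^ (a - 1) * (cexp (-(r * t)) * (-t)))
    (bound := fun t => t ^ ((a.re + 1) - 1) * Real.exp (-(r.re/2) * t))
    hs (Eventually.of_forall fun w => meas_gker a w) (int_gker ha hr) ?_ ?_
    (int_rpow_exp (by linarith) (by linarith)) ?_).2.differentiableAt
  · apply Measurable.aestronglyMeasurable
    fun_prop
  · filter_upwards [ae_restrict_mem measurableSet_Ioi] with t ht w hw
    have ht : 0 < t := ht
    rw [← mul_assoc, norm_mul, norm_gker ht]
    simp only [norm_neg, Complex.norm_real, Real.norm_eq_abs, abs_of_pos ht]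
    have : t ^ (a.re + 1 - 1) = t ^ (a.re - 1) * t := by
      rw [← Real.rpow_add_one ht.ne']; ring_nf
    rw [this, mul_right_comm]
    gcongr
  · refine Eventually.of_forall fun t w _ => ?_
    have h1 : HasDerivAt (fun w : ℂ => -(w * t)) (-(t:ℂ)) w := by
      have h0 := ((hasDerivAt_id w).mul_const (t:ℂ)).fun_neg
      simpa using h0
    exact h1.cexp.const_mul _

lemma gamma_cx {a r : ℂ} (ha : 0 < a.re) (hr : 0 < r.re) :
    ∫ t in Set.Ioi (0:ℝ), (t:ℂ) ^ (a - 1) * cexp (-(r * t)) = (1 / r) ^ a * Gamma a := by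
  have hU : IsOpen {w : ℂ | 0 < w.re} := isOpen_lt continuous_const continuous_re
  have h1 : AnalyticOnNhd ℂ (fun r : ℂ => ∫ t in Set.Ioi (0:ℝ), (t:ℂ) ^ (a - 1) * cexp (-(r * t)))
      {w : ℂ | 0 < w.re} :=
    DifferentiableOn.analyticOnNhd (fun w hw => (deriv_gker ha hw).differentiableWithinAt) hU
  have h2 : AnalyticOnNhd ℂ (fun r : ℂ => (1 / r) ^ a * Gamma a) {w : ℂ | 0 < w.re} := by
    refine DifferentiableOn.analyticOnNhd (fun w hw => DifferentiableAt.differentiableWithinAt ?_) hU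
    have hw : 0 < w.re := hw
    have hw0 : w ≠ 0 := by rintro rfl; simp at hw
    have : (1 / w) ∈ slitPlane := by
      left; rw [one_div, inv_re]; exact div_pos hw (normSq_pos.2 hw0)
    refine DifferentiableAt.mul_const ?_ _
    refine DifferentiableAt.cpow (by fun_prop (disch := assumption)) (by fun_prop) this
  have hpre : IsPreconnected {w : ℂ | 0 < w.re} := (convex_halfSpace_re_gt 0).isPreconnected
  refine h1.eqOn_of_preconnected_of_frequently_eq h2 hpre (z₀ := 1) (by simp) ?_ hr
  have hseq : Tendsto (fun n : ℕ => ((1 + 1 / ((n:ℝ) + 1) : ℝ) : ℂ)) atTop (nhdsWithin 1 {1}ᶜ) := by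
    rw [tendsto_nhdsWithin_iff]
    constructor
    · have := (tendsto_one_div_add_atTop_nhds_zero_nat (𝕜 := ℝ)).const_add 1
      have := (continuous_ofReal.tendsto _).comp this
      simpa [Function.comp_def] using this
    · refine Eventually.of_forall fun n => ?_
      simp only [Set.mem_compl_iff, Set.mem_singleton_iff]
      intro h
      have h' : (1 + 1 / ((n:ℝ) + 1) : ℝ) = 1 := by exact_mod_cast h
      have : 0 < 1 / ((n:ℝ) + 1) := by positivity
      linarith
  refine hseq.frequently (Frequently.of_forall fun n => ?_)
  exact integral_cpow_mul_exp_neg_mul_Ioi ha (by positivity)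

lemma image_exp : Set.image (fun t : ℝ => Real.exp (-t)) (Set.Ioi 0) = Set.Ioo 0 1 := by
  ext u; constructor
  · rintro ⟨t, ht, rfl⟩
    exact ⟨Real.exp_pos _, by simpa using ht⟩
  · intro hu
    refine ⟨-Real.log u, ?_, ?_⟩
    · have := Real.log_neg hu.1 hu.2
      simpa using this
    · simp [Real.exp_log hu.1]

lemma hasDeriv_exp : ∀ t ∈ Set.Ioi (0:ℝ), HasDerivWithinAt (fun t : ℝ => Real.exp (-t))
    (-Real.exp (-t)) (Set.Ioi 0) t := by
  intro t _
  have := ((hasDerivAt_id t).neg.exp).hasDerivWithinAt (s := Set.Ioi 0)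
  simpa using this

lemma inj_exp : Set.InjOn (fun t : ℝ => Real.exp (-t)) (Set.Ioi 0) := by
  intro a _ b _ h; simpa using h

lemma cov_pt {a r : ℂ} (t : ℝ) :
    |-Real.exp (-t)| • (((Real.log (Real.exp (-t))⁻¹ : ℝ) : ℂ) ^ (a - 1) * ((Real.exp (-t) : ℝ):ℂ) ^ (r - 1))
      = (t:ℂ) ^ (a - 1) * cexp (-(r * t)) := by
  rw [← Real.exp_neg, neg_neg, Real.log_exp, abs_neg, abs_of_pos (Real.exp_pos _), real_smul,
    cpow_def_of_ne_zero (x := ((Real.exp (-t) : ℝ):ℂ)) (by exact_mod_cast (Real.exp_pos _).ne'),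
    ← ofReal_log (Real.exp_pos _).le, Real.log_exp, mul_left_comm, ofReal_exp, ← Complex.exp_add]
  congr 2
  push_cast; ring

lemma symb_int {a r : ℂ} (ha : 0 < a.re) (hr : 0 < r.re) :
    IntegrableOn (fun u : ℝ => ((Real.log u⁻¹ : ℝ) : ℂ) ^ (a - 1) * (u:ℂ) ^ (r - 1)) (Set.Ioo 0 1) := by
  rw [← image_exp, integrableOn_image_iff_integrableOn_abs_deriv_smul measurableSet_Ioi
    hasDeriv_exp inj_exp]
  simp_rw [cov_pt]
  exact int_gker ha hr

lemma symb_eq {a r : ℂ} (ha : 0 < a.re) (hr : 0 < r.re) :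
    ∫ u in Set.Ioo (0:ℝ) 1, ((Real.log u⁻¹ : ℝ) : ℂ) ^ (a - 1) * (u:ℂ) ^ (r - 1)
     = (1 / r) ^ a * Gamma a := by
  rw [← image_exp, integral_image_eq_integral_abs_deriv_smul measurableSet_Ioi
    hasDeriv_exp inj_exp]
  simp_rw [cov_pt]
  exact gamma_cx ha hr

lemma enorm_symb (c : ℂ) {r : ℂ} (hr : r.re = 1/2) {u : ℝ} (hu : 0 < u) :
    ‖c * (u:ℂ) ^ (r - 1)‖ₑ = ‖c‖ₑ * ENNReal.ofReal (u ^ (-(1/2) : ℝ)) := by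
  rw [enorm_mul]
  congr 1
  rw [← ofReal_norm, norm_cpow_eq_rpow_re_of_pos hu]
  congr 2
  simp [hr]; norm_num

lemma lint_symb (φ : ℝ → ℂ) {r : ℂ} (hr : r.re = 1/2) :
    ∫⁻ u in Set.Ioo (0:ℝ) 1, ‖φ u * (u:ℂ) ^ (r - 1)‖ₑ = wnorm φ :=
  setLIntegral_congr_fun measurableSet_Ioo fun u hu => enorm_symb (φ u) hr hu.1

lemma int_symb (φ : ℝ → ℂ) (hφ : Measurable φ) (hw : wnorm φ ≠ ⊤) {r : ℂ} (hr : r.re = 1/2) :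
    IntegrableOn (fun u : ℝ => φ u * (u:ℂ) ^ (r - 1)) (Set.Ioo 0 1) := by
  refine ⟨Measurable.aestronglyMeasurable (by fun_prop), ?_⟩
  rw [hasFiniteIntegral_iff_enorm, lint_symb φ hr]
  exact hw.lt_top

lemma wnorm_log {a : ℂ} (ha : 0 < a.re) :
    wnorm (fun u : ℝ => ((Real.log u⁻¹ : ℝ) : ℂ) ^ (a - 1)) ≠ ⊤ := by
  have h := (symb_int (a := a) (r := 1/2) ha (by norm_num)).2
  rw [hasFiniteIntegral_iff_enorm,
    lint_symb (fun u : ℝ => ((Real.log u⁻¹ : ℝ) : ℂ) ^ (a - 1)) (by norm_num)] at h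
  exact h.ne

lemma wnorm_one : wnorm (fun _ => 1) ≠ ⊤ := by
  have := wnorm_log (a := 1) (by simp)
  simpa using this

lemma wnorm_mono_const (φ : ℝ → ℂ) (c : ℝ) (hc : ∀ u ∈ Set.Ioo (0:ℝ) 1, ‖φ u‖ ≤ c) :
    wnorm φ ≤ ENNReal.ofReal c * wnorm (fun _ => 1) := by
  unfold wnorm
  rw [← lintegral_const_mul _ (by fun_prop)]
  refine setLIntegral_mono (by fun_prop) fun u hu => ?_
  simp only [enorm_one, one_mul]
  gcongr
  rw [← ofReal_norm]
  exact ENNReal.ofReal_le_ofReal (hc u hu)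

lemma wnorm_bdd (φ : ℝ → ℂ) (hφ : Continuous φ) : wnorm φ ≠ ⊤ := by
  obtain ⟨c, hc⟩ := (isCompact_Icc (a := (0:ℝ)) (b := 1)).exists_bound_of_continuousOn hφ.continuousOn
  refine ne_top_of_le_ne_top (ENNReal.mul_ne_top ENNReal.ofReal_ne_top wnorm_one)
    (wnorm_mono_const φ c fun u hu => hc u (Set.Ioo_subset_Icc_self hu))

lemma wnorm_add_le (φ χ : ℝ → ℂ) (hφ : Measurable φ) :
    wnorm (fun u => φ u + χ u) ≤ wnorm φ + wnorm χ := by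
  unfold wnorm
  rw [← lintegral_add_left (by fun_prop)]
  refine lintegral_mono fun u => ?_
  rw [← add_mul]
  gcongr
  exact enorm_add_le _ _

lemma wnorm_mul_const (φ : ℝ → ℂ) (hφ : Measurable φ) (c : ℂ) :
    wnorm (fun u => c * φ u) = ‖c‖ₑ * wnorm φ := by
  unfold wnorm
  rw [← lintegral_const_mul _ (by fun_prop)]
  simp_rw [enorm_mul, mul_assoc]

lemma poly_meas (p : Polynomial ℂ) : Continuous (fun u : ℝ => p.eval (u:ℂ)) :=
  p.continuous.comp continuous_ofReal

lemma approx (φ : ℝ → ℂ) (hφ : Measurable φ) (h : wnorm φ ≠ ⊤) (ε : ℝ) (hε : 0 < ε) :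
    ∃ p : Polynomial ℂ, wnorm (fun u => φ u - p.eval (u:ℂ)) ≤ ENNReal.ofReal ε := by
  set d : ℝ → ENNReal := fun u => ENNReal.ofReal (u ^ (-(1/2) : ℝ)) with hd
  have hdm : Measurable d := by fun_prop
  set ν := (volume.restrict (Set.Ioo (0:ℝ) 1)).withDensity d with hν
  have hval : ∀ χ : ℝ → ℂ, Measurable χ → ∫⁻ u, ‖χ u‖ₑ ∂ν = wnorm χ := by
    intro χ hχ
    rw [hν, lintegral_withDensity_eq_lintegral_mul _ hdm (by fun_prop)]
    unfold wnorm
    refine lintegral_congr fun u => ?_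
    simp only [Pi.mul_apply, hd]; rw [mul_comm]
  have hfin : IsFiniteMeasure ν := by
    constructor
    have := hval (fun _ => 1) (by fun_prop)
    simp only [enorm_one, lintegral_const, one_mul] at this
    rw [this]; exact wnorm_one.lt_top
  have hint : Integrable φ ν := by
    refine ⟨hφ.aestronglyMeasurable, ?_⟩
    rw [hasFiniteIntegral_iff_enorm, hval φ hφ]
    exact h.lt_top
  obtain ⟨g, hg, -⟩ := hint.exists_boundedContinuous_lintegral_sub_le (ε := ENNReal.ofReal (ε/2))
    (by simpa using hε)
  have hgc : Continuous g := g.continuous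
  rw [hval (fun u => φ u - g u) (by fun_prop)] at hg
  set M := (wnorm (fun _ => 1)).toReal
  have hM : 0 ≤ M := ENNReal.toReal_nonneg
  set δ := ε / (4 * (M + 1)) with hδ
  have hδ0 : 0 < δ := by positivity
  obtain ⟨p1, h1⟩ := exists_polynomial_near_of_continuousOn 0 1 (fun u => (g u).re)
    (by fun_prop) δ hδ0
  obtain ⟨p2, h2⟩ := exists_polynomial_near_of_continuousOn 0 1 (fun u => (g u).im)
    (by fun_prop) δ hδ0
  refine ⟨p1.map ofRealHom + Polynomial.C I * p2.map ofRealHom, ?_⟩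
  set p := p1.map ofRealHom + Polynomial.C I * p2.map ofRealHom with hp
  have hpe : ∀ u : ℝ, p.eval (u:ℂ) = ((p1.eval u : ℝ) : ℂ) + I * ((p2.eval u : ℝ) : ℂ) := by
    intro u
    have := fun q : Polynomial ℝ => Polynomial.eval_map_apply (f := ofRealHom) (p := q) u
    simp only [hp, Polynomial.eval_add, Polynomial.eval_mul, Polynomial.eval_C]
    simp only [ofRealHom_eq_coe] at this
    rw [this, this]
  have hgp : wnorm (fun u => g u - p.eval (u:ℂ)) ≤ ENNReal.ofReal (ε/2) := by
    refine (wnorm_mono_const _ (2 * δ) fun u hu => ?_).trans ?_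
    · have hu' := Set.Ioo_subset_Icc_self hu
      have a1 := h1 u hu'
      have a2 := h2 u hu'
      refine (norm_le_abs_re_add_abs_im _).trans ?_
      rw [hpe]
      simp only [sub_re, add_re, mul_re, I_re, I_im, ofReal_re, ofReal_im, sub_im, add_im, mul_im]
      rw [abs_sub_comm] at a1 a2
      ring_nf at a1 a2 ⊢
      linarith
    · rw [← ENNReal.ofReal_toReal wnorm_one, ← ENNReal.ofReal_mul (by positivity)]
      apply ENNReal.ofReal_le_ofReal
      show 2 * δ * M ≤ ε / 2
      rw [hδ]
      have : 2 * (ε / (4 * (M + 1))) * M = ε / 2 * (M / (M + 1)) := by field_simp; ring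
      rw [this]
      have : M / (M + 1) ≤ 1 := (div_le_one (by positivity)).2 (by linarith)
      nlinarith
  have hs := wnorm_add_le (fun u => φ u - g u) (fun u => g u - p.eval (u:ℂ)) (by fun_prop)
  simp only [sub_add_sub_cancel] at hs
  refine hs.trans ((add_le_add hg hgp).trans ?_)
  rw [← ENNReal.ofReal_add (by positivity) (by positivity)]
  simp

lemma int_dil (φ f : ℝ → ℂ) (hφ : Measurable φ) (hw : wnorm φ ≠ ⊤) (hf : Measurable f)
    (hf2 : ∫⁻ x, ‖f x‖ₑ ^ 2 ≠ ⊤) :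
    ∀ᵐ x : ℝ, IntegrableOn (fun u : ℝ => φ u * f (u * x)) (Set.Ioo 0 1) := by
  have h := schur φ f hφ hf
  have hfin : ∫⁻ x, (∫⁻ u in Set.Ioo (0:ℝ) 1, ‖φ u‖ₑ * ‖f (u * x)‖ₑ) ^ 2 ≠ ⊤ :=
    ne_top_of_le_ne_top (ENNReal.mul_ne_top (by simpa using hw) hf2) h
  have hm : Measurable fun x : ℝ => (∫⁻ u in Set.Ioo (0:ℝ) 1, ‖φ u‖ₑ * ‖f (u * x)‖ₑ) := by
    apply Measurable.lintegral_prod_right' (f := fun p : ℝ × ℝ => ‖φ p.2‖ₑ * ‖f (p.2 * p.1)‖ₑ)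
    fun_prop
  filter_upwards [ae_lt_top (by fun_prop) hfin] with x hx
  refine ⟨Measurable.aestronglyMeasurable (by fun_prop), ?_⟩
  rw [hasFiniteIntegral_iff_enorm]
  simp_rw [enorm_mul]
  simpa [lt_top_iff_ne_top] using hx

lemma ae_dil {P : ℝ → Prop} (h : ∀ᵐ y : ℝ, P y) {x : ℝ} (hx : x ≠ 0) : ∀ᵐ u : ℝ, P (u * x) := by
  apply ae_of_ae_map (f := fun u : ℝ => u * x) (p := P) (by fun_prop)
  rw [Real.map_volume_mul_right hx]
  exact Measure.ae_smul_measure h _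

lemma resolvent_pt (ψ : ℝ → ℂ) (hψ : IntegrableOn ψ (Set.Ioo 0 1)) (n : ℕ) :
    ∫ u in Set.Ioo (0:ℝ) 1, (u:ℂ) ^ n * ((n:ℂ) * ∫ v in Set.Ioo (0:ℝ) 1, ψ (v * u)) =
      (∫ s in Set.Ioo (0:ℝ) 1, ψ s) - ∫ s in Set.Ioo (0:ℝ) 1, (s:ℂ) ^ n * ψ s := by
  rcases Nat.eq_zero_or_pos n with rfl | hn
  · simp
  have hμ : IsFiniteMeasure (volume.restrict (Set.Ioo (0:ℝ) 1)) := ⟨by simp⟩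
  set μ := volume.restrict (Set.Ioo (0:ℝ) 1) with hμd
  have hin : ∀ u ∈ Set.Ioo (0:ℝ) 1, (u:ℂ) ^ n * ((n:ℂ) * ∫ v in Set.Ioo (0:ℝ) 1, ψ (v * u)) =
      ∫ s, (if s < u then (n:ℂ) * (u:ℂ) ^ (n-1) else 0) * ψ s ∂μ := by
    intro u hu
    have e1 : ∫ v in Set.Ioo (0:ℝ) 1, ψ (v * u) = (u:ℂ)⁻¹ * ∫ s in Set.Ioo (0:ℝ) u, ψ s := by
      rw [← integral_Ioc_eq_integral_Ioo, ← integral_Ioc_eq_integral_Ioo,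
        ← intervalIntegral.integral_of_le zero_le_one, ← intervalIntegral.integral_of_le hu.1.le,
        intervalIntegral.integral_comp_mul_right _ hu.1.ne']
      simp
    have e2 : ∫ s, (if s < u then (n:ℂ) * (u:ℂ) ^ (n-1) else 0) * ψ s ∂μ =
        (n:ℂ) * (u:ℂ) ^ (n-1) * ∫ s in Set.Ioo (0:ℝ) u, ψ s := by
      rw [← integral_const_mul]
      have : Set.Ioo (0:ℝ) u = Set.Iio u ∩ Set.Ioo 0 1 := by
        ext s; simp only [Set.mem_Ioo, Set.mem_inter_iff, Set.mem_Iio]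
        constructor
        · rintro ⟨a, b⟩; exact ⟨b, a, b.trans hu.2⟩
        · rintro ⟨a, b, _⟩; exact ⟨b, a⟩
      rw [this, ← Measure.restrict_restrict measurableSet_Iio, ← integral_indicator measurableSet_Iio]
      refine integral_congr_ae (Eventually.of_forall fun s => ?_)
      by_cases hs : s < u <;> simp [hs]
    rw [e1, e2]
    have hu0 : (u:ℂ) ≠ 0 := by exact_mod_cast hu.1.ne'
    obtain ⟨m, rfl⟩ : ∃ m, n = m + 1 := ⟨n - 1, by omega⟩
    simp only [Nat.add_sub_cancel, pow_succ]
    field_simp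
  rw [setIntegral_congr_fun measurableSet_Ioo hin]
  have hprod : Integrable (fun p : ℝ × ℝ =>
      (if p.2 < p.1 then (n:ℂ) * (p.1:ℂ) ^ (n-1) else 0) * ψ p.2) (μ.prod μ) := by
    have hi : Integrable (fun p : ℝ × ℝ => ψ p.2) (μ.prod μ) := Integrable.comp_snd hψ μ
    refine hi.bdd_mul (c := n) ?_ ?_
    · apply Measurable.aestronglyMeasurable
      exact Measurable.ite (measurableSet_lt measurable_snd measurable_fst) (by fun_prop) (by fun_prop)
    · rw [hμd, Measure.prod_restrict]
      filter_upwards [ae_restrict_mem (measurableSet_Ioo.prod measurableSet_Ioo)] with p hp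
      split_ifs
      · have : ‖(p.1:ℂ)‖ ≤ 1 := by
          rw [Complex.norm_real, Real.norm_eq_abs, abs_of_pos hp.1.1]; exact hp.1.2.le
        rw [norm_mul, norm_pow, Complex.norm_natCast]
        exact mul_le_of_le_one_right (by positivity) (pow_le_one₀ (norm_nonneg _) this)
      · simp
  rw [integral_integral_swap hprod]
  have hsin : ∀ s ∈ Set.Ioo (0:ℝ) 1, ∫ u, (if s < u then (n:ℂ) * (u:ℂ) ^ (n-1) else 0) * ψ s ∂μ =
      ψ s - (s:ℂ) ^ n * ψ s := by
    intro s hs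
    rw [integral_mul_const, ← one_sub_mul]
    congr 1
    have : Set.Ioo s 1 = Set.Ioi s ∩ Set.Ioo 0 1 := by
      ext u; simp only [Set.mem_Ioo, Set.mem_inter_iff, Set.mem_Ioi]
      constructor
      · rintro ⟨a, b⟩; exact ⟨a, hs.1.trans a, b⟩
      · rintro ⟨a, _, b⟩; exact ⟨a, b⟩
    have e : ∫ u, (if s < u then (n:ℂ) * (u:ℂ) ^ (n-1) else 0) ∂μ =
        ∫ u in Set.Ioo s 1, (n:ℂ) * (u:ℂ) ^ (n-1) := by
      rw [this, ← Measure.restrict_restrict measurableSet_Ioi, ← integral_indicator measurableSet_Ioi]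
      refine integral_congr_ae (Eventually.of_forall fun u => ?_)
      by_cases hs : s < u <;> simp [hs]
    rw [e, ← integral_Ioc_eq_integral_Ioo, ← intervalIntegral.integral_of_le hs.2.le]
    have hd : ∀ u ∈ Set.uIcc s 1, HasDerivAt (fun u : ℝ => (u:ℂ) ^ n) ((n:ℂ) * (u:ℂ) ^ (n-1)) u := by
      intro u _
      have := (hasDerivAt_pow n (u:ℂ)).comp_ofReal
      exact this
    rw [intervalIntegral.integral_eq_sub_of_hasDerivAt hd (Continuous.intervalIntegrable (by fun_prop) _ _)]
    simp
  rw [setIntegral_congr_fun measurableSet_Ioo hsin, integral_sub hψ]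
  refine Integrable.bdd_mul (c := 1) hψ (Measurable.aestronglyMeasurable (by fun_prop)) ?_
  filter_upwards [ae_restrict_mem measurableSet_Ioo] with s hs
  rw [norm_pow, Complex.norm_real, Real.norm_eq_abs, abs_of_pos hs.1]
  exact pow_le_one₀ hs.1.le hs.2.le

lemma L2_fin (f : L2) : ∫⁻ x, ‖f x‖ₑ ^ 2 = ENNReal.ofReal (‖f‖ ^ 2) := by
  have h : ‖f‖ₑ = eLpNorm f 2 volume := Lp.enorm_def f
  rw [eLpNorm_eq_lintegral_rpow_enorm_toReal (by norm_num) (by norm_num)] at h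
  have h2 : ‖f‖ₑ ^ 2 = ∫⁻ x, ‖f x‖ₑ ^ 2 := by
    rw [h, ← ENNReal.rpow_natCast, ← ENNReal.rpow_mul]
    norm_num
  rw [← h2, ← ofReal_norm, ENNReal.ofReal_pow (norm_nonneg _)]

lemma L2_ne_top (f : L2) : ∫⁻ x, ‖f x‖ₑ ^ 2 ≠ ⊤ := by
  rw [L2_fin]; exact ENNReal.ofReal_ne_top

lemma L2_meas (f : L2) : Measurable f := (Lp.stronglyMeasurable f).measurable

lemma cesaro_res (C : L2 →L[ℂ] L2) (hC : IsCesaroOp C) (f : L2) (n : ℕ) :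
    ∀ᵐ x : ℝ, C f x = ∫ u in Set.Ioo (0:ℝ) 1, (u:ℂ) ^ n * (f + (n:ℂ) • C f : L2) (u * x) := by
  have hmf := L2_meas f
  have hmC := L2_meas (C f)
  have hae : ∀ᵐ y : ℝ, (f + (n:ℂ) • C f : L2) y = f y + (n:ℂ) * C f y := by
    filter_upwards [Lp.coeFn_add f ((n:ℂ) • C f), Lp.coeFn_smul (n:ℂ) (C f)] with y h1 h2
    rw [h1, Pi.add_apply, h2]; simp
  have hpw : wnorm (fun u : ℝ => (u:ℂ) ^ n) ≠ ⊤ := wnorm_bdd _ (by fun_prop)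
  have hne : ∀ᵐ x : ℝ, x ≠ 0 := by simp [ae_iff, measure_singleton]
  filter_upwards [hC f, hne, int_dil (fun _ => 1) f (by fun_prop) wnorm_one hmf (L2_ne_top f),
    int_dil (fun u : ℝ => (u:ℂ) ^ n) f (by fun_prop) hpw hmf (L2_ne_top f),
    int_dil (fun u : ℝ => (u:ℂ) ^ n) (C f) (by fun_prop) hpw hmC (L2_ne_top (C f))]
    with x hx hx0 i1 i2 i3
  simp only [one_mul] at i1
  have e1 : ∫ u in Set.Ioo (0:ℝ) 1, (u:ℂ) ^ n * (f + (n:ℂ) • C f : L2) (u * x) =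
      ∫ u in Set.Ioo (0:ℝ) 1, ((u:ℂ) ^ n * f (u * x) + (n:ℂ) * ((u:ℂ) ^ n * C f (u * x))) := by
    refine integral_congr_ae (ae_restrict_of_ae ?_)
    filter_upwards [ae_dil hae hx0] with u hu
    rw [hu]; ring
  have e2 : ∫ u in Set.Ioo (0:ℝ) 1, (n:ℂ) * ((u:ℂ) ^ n * C f (u * x)) =
      ∫ u in Set.Ioo (0:ℝ) 1, (u:ℂ) ^ n * ((n:ℂ) * ∫ v in Set.Ioo (0:ℝ) 1, f (v * u * x)) := by
    refine integral_congr_ae (ae_restrict_of_ae ?_)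
    filter_upwards [ae_dil (hC f) hx0] with u hu
    rw [hu]; simp_rw [mul_assoc]; ring
  rw [e1, integral_add i2 (i3.const_mul _), e2, resolvent_pt (fun s => f (s * x)) i1 n, hx]
  ring

lemma sphere_re {z : ℂ} (hz : z ∈ Metric.sphere (1:ℂ) 1) : 2 * z.re = normSq z := by
  rw [mem_sphere_iff_norm] at hz
  have h : normSq (z - 1) = 1 := by rw [normSq_eq_norm_sq, hz]; norm_num
  rw [normSq_apply] at h ⊢
  simp at h
  linarith

lemma sphere_inv {z : ℂ} (hz : z ∈ Metric.sphere (1:ℂ) 1) (h0 : z ≠ 0) : (z⁻¹).re = 1/2 := by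
  have := sphere_re hz
  have hp := normSq_pos.2 h0
  rw [inv_re]; field_simp; linarith

lemma sphere_ne {z : ℂ} (hz : z ∈ Metric.sphere (1:ℂ) 1) (n : ℕ) : 1 + (n:ℂ) * z ≠ 0 := by
  intro h
  have := sphere_re hz
  have hp := normSq_nonneg z
  have h' := congrArg Complex.re h
  simp at h'
  have : 0 ≤ (n:ℝ) * z.re := mul_nonneg (by positivity) (by linarith)
  linarith

lemma symb_pow {z : ℂ} (hz : z ∈ Metric.sphere (1:ℂ) 1) (h0 : z ≠ 0) (n : ℕ) :
    ∫ u in Set.Ioo (0:ℝ) 1, (u:ℂ) ^ n * (u:ℂ) ^ (z⁻¹ - 1) = z * (1 + n * z)⁻¹ := by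
  have hre := sphere_inv hz h0
  have e : ∫ u in Set.Ioo (0:ℝ) 1, (u:ℂ) ^ n * (u:ℂ) ^ (z⁻¹ - 1) =
      ∫ u in Set.Ioo (0:ℝ) 1, (u:ℂ) ^ (n + (z⁻¹ - 1)) := by
    refine setIntegral_congr_fun measurableSet_Ioo fun u hu => ?_
    have : (u:ℂ) ≠ 0 := by exact_mod_cast hu.1.ne'
    simp only [cpow_add _ _ this, cpow_natCast]
  have hr : 0 < ((n:ℂ) + (z⁻¹ - 1) + 1).re := by
    have : ((n:ℂ) + (z⁻¹ - 1) + 1).re = n + (z⁻¹).re := by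
      simp only [add_re, sub_re, one_re, natCast_re]; ring
    rw [this, hre]; positivity
  rw [e, ← integral_Ioc_eq_integral_Ioo, ← intervalIntegral.integral_of_le zero_le_one,
    integral_cpow (Or.inl (by simp only [add_re, one_re] at hr; simp only [add_re]; linarith))]
  have hne : (n:ℂ) + (z⁻¹ - 1) + 1 ≠ 0 := by intro h; rw [h] at hr; simp at hr
  have h1 := sphere_ne hz n
  simp only [ofReal_one, one_cpow, ofReal_zero, zero_cpow hne, sub_zero]
  have : (n:ℂ) + (z⁻¹ - 1) + 1 = (1 + n * z) / z := by field_simp; ring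
  rw [this]; field_simp

lemma poly_op
    (C : L2 →L[ℂ] L2) (hC : IsCesaroOp C)
    (Hp : Type) [NormedAddCommGroup Hp] [InnerProductSpace ℂ Hp] [CompleteSpace Hp]
    (J : Hp →ₗᵢ[ℂ] L2)
    (Cp : Hp →L[ℂ] Hp) (hCp : ∀ g : Hp, J (Cp g) = C (J g))
    (hNp : IsStarNormal Cp)
    (hσp : spectrum ℂ Cp = Metric.sphere (1:ℂ) 1) (p : Polynomial ℂ) :
    ∃ m : ℂ → ℂ, ContinuousOn m (spectrum ℂ Cp) ∧ m 0 = 0 ∧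
      (∀ z ∈ Metric.sphere (1:ℂ) 1, z ≠ 0 →
        m z = ∫ u in Set.Ioo (0:ℝ) 1, p.eval (u:ℂ) * (u:ℂ) ^ (z⁻¹ - 1)) ∧
      ∀ g : Hp, ∀ᵐ x : ℝ, J (cfc m Cp g) x =
        ∫ u in Set.Ioo (0:ℝ) 1, p.eval (u:ℂ) * J g (u * x) := by
  induction p using Polynomial.induction_on' with
  | add p q hp hq =>
    obtain ⟨m, cm, m0, hm, om⟩ := hp
    obtain ⟨k, ck, k0, hk, ok⟩ := hq
    refine ⟨fun z => m z + k z, cm.add ck, by simp [m0, k0], fun z hz h0 => ?_, fun g => ?_⟩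
    · show m z + k z = _
      rw [hm z hz h0, hk z hz h0, ← integral_add]
      · simp [add_mul]
      · exact int_symb _ (poly_meas p).measurable (wnorm_bdd _ (poly_meas p)) (sphere_inv hz h0)
      · exact int_symb _ (poly_meas q).measurable (wnorm_bdd _ (poly_meas q)) (sphere_inv hz h0)
    · rw [cfc_add _ _ _ cm ck, ContinuousLinearMap.add_apply, map_add]
      filter_upwards [om g, ok g, Lp.coeFn_add (J (cfc m Cp g)) (J (cfc k Cp g)),
        int_dil _ _ (poly_meas p).measurable (wnorm_bdd _ (poly_meas p)) (L2_meas (J g)) (L2_ne_top _),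
        int_dil _ _ (poly_meas q).measurable (wnorm_bdd _ (poly_meas q)) (L2_meas (J g)) (L2_ne_top _)]
        with x h1 h2 h3 i1 i2
      rw [h3, Pi.add_apply, h1, h2, ← integral_add i1 i2]
      simp [add_mul]
  | monomial n a =>
    have hc : ContinuousOn (fun z : ℂ => (1 + (n:ℂ) * z)⁻¹) (spectrum ℂ Cp) := by
      rw [hσp]
      exact ContinuousOn.inv₀ (by fun_prop) fun z hz => sphere_ne hz n
    have hc2 : ContinuousOn (fun z : ℂ => z * (1 + (n:ℂ) * z)⁻¹) (spectrum ℂ Cp) :=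
      continuousOn_id.mul hc
    have hmul : cfc (fun z : ℂ => z * (1 + (n:ℂ) * z)⁻¹) Cp =
        Cp * cfc (fun z : ℂ => (1 + (n:ℂ) * z)⁻¹) Cp := by
      rw [cfc_mul (fun z => z) _ Cp continuousOn_id hc, cfc_id' ℂ Cp]
    have hone : cfc (fun z : ℂ => (1 + (n:ℂ) * z)⁻¹) Cp +
        (n:ℂ) • (Cp * cfc (fun z : ℂ => (1 + (n:ℂ) * z)⁻¹) Cp) = 1 := by
      rw [← hmul, ← cfc_smul (n:ℂ) _ Cp hc2, ← cfc_add Cp _ (fun z : ℂ => (n:ℂ) • (z * (1 + (n:ℂ) * z)⁻¹)) hc (hc2.const_smul (n:ℂ)),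
        ← cfc_one ℂ Cp]
      refine cfc_congr fun z hz => ?_
      rw [hσp] at hz
      have := sphere_ne hz n
      simp only [smul_eq_mul, Pi.one_apply]
      field_simp
    refine ⟨fun z => a * (z * (1 + (n:ℂ) * z)⁻¹), continuousOn_const.mul hc2, by simp,
      fun z hz h0 => ?_, fun g => ?_⟩
    · show a * (z * (1 + (n:ℂ) * z)⁻¹) = _
      rw [← symb_pow hz h0, ← integral_const_mul]
      simp only [Polynomial.eval_monomial, mul_assoc]
    · rw [cfc_const_mul _ _ _ hc2, hmul]
      set F := cfc (fun z : ℂ => (1 + (n:ℂ) * z)⁻¹) Cp g with hF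
      have hg : J g = J F + (n:ℂ) • C (J F) := by
        have := congrArg (fun T : Hp →L[ℂ] Hp => J (T g)) hone
        simp only [ContinuousLinearMap.add_apply, ContinuousLinearMap.smul_apply,
          ContinuousLinearMap.mul_apply, ContinuousLinearMap.one_apply, map_add, map_smul, hCp] at this
        exact this.symm
      have hl : J ((a • (Cp * cfc (fun z : ℂ => (1 + (n:ℂ) * z)⁻¹) Cp)) g) = a • C (J F) := by
        simp only [ContinuousLinearMap.smul_apply,
          ContinuousLinearMap.mul_apply, map_smul, hCp, hF]
      rw [hl, hg]
      filter_upwards [cesaro_res C hC (J F) n, Lp.coeFn_smul a (C (J F))] with x h1 h2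
      rw [h2, Pi.smul_apply, h1, smul_eq_mul, ← integral_const_mul]
      simp only [Polynomial.eval_monomial, mul_assoc]

lemma cont_pow {α : ℂ} (hα : 0 < α.re) :
    ContinuousOn (fun z : ℂ => z ^ α) (Metric.sphere (1:ℂ) 1) := by
  intro z hz
  apply ContinuousAt.continuousWithinAt
  by_cases h0 : z = 0
  · subst h0
    exact (continuousAt_cpow_zero_of_re_pos hα).comp (f := fun z : ℂ => (z, α)) (by fun_prop)
  · refine continuousAt_cpow_const (Or.inl ?_)
    have := sphere_re hz
    have := normSq_pos.2 h0
    linarith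

lemma symb_bound {α : ℂ} (hα : 0 < α.re) (p : Polynomial ℂ) (m : ℂ → ℂ) (m0 : m 0 = 0)
    (hm : ∀ z ∈ Metric.sphere (1:ℂ) 1, z ≠ 0 →
        m z = ∫ u in Set.Ioo (0:ℝ) 1, p.eval (u:ℂ) * (u:ℂ) ^ (z⁻¹ - 1)) (ε : ℝ) (hε : 0 < ε)
    (hp : wnorm (fun u : ℝ => (Gamma α)⁻¹ * ((Real.log u⁻¹ : ℝ) : ℂ) ^ (α - 1) - p.eval (u:ℂ))
      ≤ ENNReal.ofReal ε) (z : ℂ) (hz : z ∈ Metric.sphere (1:ℂ) 1) : ‖z ^ α - m z‖ ≤ ε := by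
  by_cases h0 : z = 0
  · subst h0
    have : α ≠ 0 := by rintro rfl; simp at hα
    simp [m0, zero_cpow this, hε.le]
  have hre := sphere_inv hz h0
  have hG : Gamma α ≠ 0 := Gamma_ne_zero_of_re_pos hα
  have e : z ^ α = ∫ u in Set.Ioo (0:ℝ) 1,
      (Gamma α)⁻¹ * (((Real.log u⁻¹ : ℝ) : ℂ) ^ (α - 1) * (u:ℂ) ^ (z⁻¹ - 1)) := by
    rw [integral_const_mul, symb_eq hα (by rw [hre]; norm_num)]
    simp; field_simp
  rw [hm z hz h0, e, ← integral_sub ((symb_int hα (by rw [hre]; norm_num)).const_mul _)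
    (int_symb _ (poly_meas p).measurable (wnorm_bdd _ (poly_meas p)) hre)]
  rw [← ENNReal.ofReal_le_ofReal_iff hε.le, ofReal_norm]
  refine (enorm_integral_le_lintegral_enorm _).trans (le_trans (le_of_eq ?_) hp)
  rw [← lint_symb _ hre]
  refine lintegral_congr fun u => ?_
  congr 1; ring

lemma enn_sq (a b : ENNReal) : (a + b) ^ 2 ≤ 2 * (a ^ 2 + b ^ 2) := by
  have := ENNReal.rpow_add_le_mul_rpow_add_rpow a b (p := 2) (by norm_num)
  norm_num at this
  exact this

/-- Let `Hp ≅ L²(ℝ₊)` be the closed subspace of `L²(ℝ)` of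
functions vanishing a.e. on `(-∞, 0)` (realized as a Hilbert space `Hp` with a
linear isometry `J` onto that subspace), and let `C₊` be the (normal) Cesàro
operator on it, with spectrum `𝕋+1`. For `Re α > 0`, the fractional power `(C₊)^α`,
taken via the functional calculus for normal operators applied to the branch
`z ↦ z^α` on the closed right half-plane with `1^α = 1`, `0^α = 0` (the principal
complex power), equals the Hölder operator `H_{α+}`:
`(H_{α+} f)(x) = (1/Γ(α)) ∫₀¹ (log(1/u))^{α-1} f(ux) du`. -/
theorem stmt18
    (C : L2 →L[ℂ] L2) (hC : IsCesaroOp C)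
    (Hp : Type) [NormedAddCommGroup Hp] [InnerProductSpace ℂ Hp] [CompleteSpace Hp]
    (J : Hp →ₗᵢ[ℂ] L2)
    (hJ : ∀ f : L2, (∃ g : Hp, J g = f) ↔
      ∀ᵐ x : ℝ ∂MeasureTheory.volume, x < 0 → f x = 0)
    (Cp : Hp →L[ℂ] Hp) (hCp : ∀ g : Hp, J (Cp g) = C (J g))
    (hNp : IsStarNormal Cp)
    (hσp : spectrum ℂ Cp = Metric.sphere (1:ℂ) 1)
    (α : ℂ) (hα : 0 < α.re) :
    ∀ g : Hp, ∀ᵐ x : ℝ ∂MeasureTheory.volume,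
      (J ((cfc (fun z : ℂ => z ^ α) Cp) g)) x =
        (Complex.Gamma α)⁻¹ *
          ∫ u in Set.Ioo (0:ℝ) 1, ((Real.log u⁻¹ : ℝ) : ℂ) ^ (α - 1) * (J g) (u * x) := by
  intro g
  set φ : ℝ → ℂ := fun u => (Gamma α)⁻¹ * ((Real.log u⁻¹ : ℝ) : ℂ) ^ (α - 1) with hφ
  have hφm : Measurable φ := by fun_prop
  have hφw : wnorm φ ≠ ⊤ := by
    rw [hφ, wnorm_mul_const _ (by fun_prop)]
    exact ENNReal.mul_ne_top (by simp) (wnorm_log hα)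
  have hcont : ContinuousOn (fun z : ℂ => z ^ α) (spectrum ℂ Cp) := hσp ▸ cont_pow hα
  set T := cfc (fun z : ℂ => z ^ α) Cp with hT
  have hGm := L2_meas (J g)
  have hTm := L2_meas (J (T g))
  have hrw : ∀ x : ℝ, (Gamma α)⁻¹ *
      ∫ u in Set.Ioo (0:ℝ) 1, ((Real.log u⁻¹ : ℝ) : ℂ) ^ (α - 1) * (J g) (u * x) =
      ∫ u in Set.Ioo (0:ℝ) 1, φ u * J g (u * x) := by
    intro x
    rw [← integral_const_mul]; simp only [hφ, mul_assoc]
  simp_rw [hrw]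
  have hIm : Measurable fun x : ℝ => ∫ u in Set.Ioo (0:ℝ) 1, φ u * J g (u * x) := by
    have : StronglyMeasurable fun p : ℝ × ℝ => φ p.2 * J g (p.2 * p.1) := by
      apply Measurable.stronglyMeasurable; fun_prop
    exact (this.integral_prod_right' (ν := volume.restrict (Set.Ioo (0:ℝ) 1))).measurable
  have hbound : ∀ ε : ℝ, 0 < ε →
      ∫⁻ x, ‖J (T g) x - ∫ u in Set.Ioo (0:ℝ) 1, φ u * J g (u * x)‖ₑ ^ 2 ≤
        ENNReal.ofReal (4 * ‖g‖ ^ 2 * ε ^ 2) := by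
    intro ε hε
    obtain ⟨p, hp⟩ := approx φ hφm hφw ε hε
    obtain ⟨m, cm, m0, hm, om⟩ := poly_op C hC Hp J Cp hCp hNp hσp p
    have hnorm : ‖T - cfc m Cp‖ ≤ ε := by
      rw [hT, ← cfc_sub _ _ _ hcont cm]
      refine norm_cfc_le hε.le fun z hz => ?_
      exact symb_bound hα p m m0 hm ε hε hp z (hσp ▸ hz)
    have hpt : ∀ᵐ x : ℝ, ‖J (T g) x - ∫ u in Set.Ioo (0:ℝ) 1, φ u * J g (u * x)‖ₑ ^ 2 ≤
        2 * (‖J ((T - cfc m Cp) g) x‖ₑ ^ 2 +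
          (∫⁻ u in Set.Ioo (0:ℝ) 1, ‖φ u - p.eval (u:ℂ)‖ₑ * ‖J g (u * x)‖ₑ) ^ 2) := by
      filter_upwards [om g, Lp.coeFn_sub (J (T g)) (J (cfc m Cp g)),
        int_dil φ _ hφm hφw hGm (L2_ne_top _),
        int_dil _ _ (poly_meas p).measurable (wnorm_bdd _ (poly_meas p)) hGm (L2_ne_top _)]
        with x h1 h2 i1 i2
      refine le_trans (pow_le_pow_left' ?_ 2) (enn_sq _ _)
      have e1 : J ((T - cfc m Cp) g) x = J (T g) x - J (cfc m Cp g) x := by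
        rw [ContinuousLinearMap.sub_apply, map_sub, h2, Pi.sub_apply]
      have e2 : J (T g) x - ∫ u in Set.Ioo (0:ℝ) 1, φ u * J g (u * x) =
          J ((T - cfc m Cp) g) x -
            ∫ u in Set.Ioo (0:ℝ) 1, (φ u - p.eval (u:ℂ)) * J g (u * x) := by
        simp_rw [sub_mul]
        rw [integral_sub i1 i2, e1, h1]; ring
      rw [e2]
      refine (enorm_sub_le).trans ?_
      gcongr
      refine (enorm_integral_le_lintegral_enorm _).trans (le_of_eq ?_)
      simp_rw [enorm_mul]
    have hJm := L2_meas (J ((T - cfc m Cp) g))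
    have hpm := (poly_meas p).measurable
    calc _ ≤ _ := lintegral_mono_ae hpt
      _ = 2 * ((∫⁻ x, ‖J ((T - cfc m Cp) g) x‖ₑ ^ 2) + ∫⁻ x,
          (∫⁻ u in Set.Ioo (0:ℝ) 1, ‖φ u - p.eval (u:ℂ)‖ₑ * ‖J g (u * x)‖ₑ) ^ 2) := by
        rw [lintegral_const_mul', lintegral_add_left (by fun_prop)]
        norm_num
      _ ≤ 2 * (ENNReal.ofReal (ε ^ 2 * ‖g‖ ^ 2) + ENNReal.ofReal (ε ^ 2 * ‖g‖ ^ 2)) := by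
        gcongr
        · rw [L2_fin, J.norm_map]
          apply ENNReal.ofReal_le_ofReal
          rw [← mul_pow]
          gcongr
          exact ((T - cfc m Cp).le_opNorm g).trans (by gcongr)
        · refine (schur _ _ (hφm.sub hpm) hGm).trans ?_
          rw [L2_fin, J.norm_map, ENNReal.ofReal_mul (by positivity), ENNReal.ofReal_pow hε.le]
          gcongr
          exact hp
      _ = _ := by
        rw [← ENNReal.ofReal_add (by positivity) (by positivity),
          show (2:ENNReal) = ENNReal.ofReal 2 by simp, ← ENNReal.ofReal_mul (by norm_num)]
        congr 1; ring
  have hzero : ∫⁻ x, ‖J (T g) x - ∫ u in Set.Ioo (0:ℝ) 1, φ u * J g (u * x)‖ₑ ^ 2 = 0 := by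
    have hlim : Tendsto (fun ε : ℝ => ENNReal.ofReal (4 * ‖g‖ ^ 2 * ε ^ 2))
        (nhdsWithin 0 (Set.Ioi 0)) (nhds 0) := by
      have : Continuous (fun ε : ℝ => ENNReal.ofReal (4 * ‖g‖ ^ 2 * ε ^ 2)) :=
        ENNReal.continuous_ofReal.comp (by fun_prop)
      have h := (this.tendsto 0).mono_left (nhdsWithin_le_nhds (s := Set.Ioi 0))
      simpa using h
    refine le_antisymm (ge_of_tendsto hlim ?_) zero_le
    filter_upwards [self_mem_nhdsWithin] with ε hε using hbound ε hε
  rw [lintegral_eq_zero_iff (by fun_prop)] at hzero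
  filter_upwards [hzero] with x hx
  simpa [sub_eq_zero] using hx
end
end
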